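/- arXiv:1402.4184 — 4 statements merged into one kernel-verified Lean document; each statement's English description precedes it below -/
import Mathlib

section
/- Let G be a countably infinite discrete group, let G ↷ X be a free Borel action on a standard Borel space X, and let μ be a Borel probability measure on X. Then for every Borel set B ⊆ X and every ε > 0 there exists a Borel set A ⊆ X with μ(A Δ B) < ε such that the closure of f_A(X) is contained in Free(2^G). In particular, the set of Borel sets A ⊆ X with f_A(X) ⊆ Free(2^G) is dense in the pseudometric space of Borel subsets of X with pseudometric d(A,B) = μ(A Δ B). -/
open MeasureTheory Set

/-- The left shift action of `G` on the 2-shift `2^G = G → Bool`: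
`(g • w)(h) = w (g⁻¹ * h)`. -/
def shift {G : Type*} [Group G] (g : G) (w : G → Bool) : G → Bool :=
  fun h => w (g⁻¹ * h)

/-- The free part of the 2-shift: points with trivial stabilizer. -/
def FreePart (G : Type*) [Group G] : Set (G → Bool) :=
  {w | ∀ g : G, g ≠ 1 → shift g w ≠ w}

section Construction

open scoped Pointwise Classical

/-- A set is syndetic if finitely many translates of it cover the space. -/
def Syndetic (G : Type*) {X : Type*} [SMul G X] (U : Set X) : Prop :=
  ∃ H : Finset G, ∀ x : X, ∃ h ∈ H, h • x ∈ U

variable {G : Type*} [Group G] {X : Type*} [MulAction G X]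

theorem exists_finset_many_visits [Infinite G]
    {U : Set X} {H : Finset G} (hH : ∀ x : X, ∃ h ∈ H, h • x ∈ U) (K : ℕ) :
    ∃ F : Finset G, F.card ≤ K * H.card ∧ ∀ x : X, K ≤ (F.filter fun f => f • x ∈ U).card := by
  induction K with
  | zero => exact ⟨∅, by simp, by simp⟩
  | succ K ih =>
    obtain ⟨F, hF, hFU⟩ := ih
    obtain ⟨g, hg⟩ := Infinite.exists_notMem_finset (H⁻¹ * F)
    have hdisj : Disjoint F (H.image (· * g)) := by
      rw [Finset.disjoint_right]
      intro a ha haF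
      obtain ⟨h, hh, rfl⟩ := Finset.mem_image.mp ha
      exact hg (Finset.mem_mul.mpr ⟨h⁻¹, Finset.inv_mem_inv hh, h * g, haF, by group⟩)
    refine ⟨F ∪ H.image (· * g), ?_, fun x => ?_⟩
    · refine (Finset.card_union_le _ _).trans ?_
      rw [add_mul, one_mul]
      exact add_le_add hF Finset.card_image_le
    · rw [Finset.filter_union, Finset.card_union_of_disjoint
        (Finset.disjoint_filter_filter hdisj)]
      refine add_le_add (hFU x) (Finset.card_pos.mpr ?_)
      obtain ⟨h, hh, hx⟩ := hH (g • x)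
      exact ⟨h * g, Finset.mem_filter.mpr ⟨Finset.mem_image_of_mem _ hh, by rwa [mul_smul]⟩⟩

theorem exists_subset_disjoint_mul_right {δ : G} (hδ : δ ≠ 1) (E : Finset G) :
    ∃ I ⊆ E, E.card ≤ 3 * I.card ∧ ∀ v ∈ I, v * δ ∉ I := by
  obtain ⟨I, hI, hmax⟩ := Finset.exists_max_image
    (E.powerset.filter fun I => ∀ v ∈ I, v * δ ∉ I) Finset.card ⟨∅, by simp⟩
  simp only [Finset.mem_filter, Finset.mem_powerset] at hI hmax
  refine ⟨I, hI.1, ?_, hI.2⟩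
  have hsub : E ⊆ I ∪ (I.image (· * δ) ∪ I.image (· * δ⁻¹)) := by
    intro v hv
    by_contra hcon
    simp only [Finset.mem_union, Finset.mem_image, not_or, not_exists, not_and] at hcon
    obtain ⟨h1, h2, h3⟩ := hcon
    have := hmax (insert v I) ⟨Finset.insert_subset hv hI.1, ?_⟩
    · rw [Finset.card_insert_of_notMem h1] at this
      omega
    · intro w hw hwI
      rcases Finset.mem_insert.mp hw with rfl | hw
      · rcases Finset.mem_insert.mp hwI with h | h
        · exact hδ (by simpa using h)
        · exact h3 _ h (by group)
      · rcases Finset.mem_insert.mp hwI with h | h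
        · exact h2 _ hw h
        · exact hI.2 w hw h
  calc E.card ≤ _ := Finset.card_le_card hsub
    _ ≤ I.card + (I.card + I.card) := (Finset.card_union_le _ _).trans
      (add_le_add le_rfl ((Finset.card_union_le _ _).trans
        (add_le_add Finset.card_image_le Finset.card_image_le)))
    _ = 3 * I.card := by ring

/-- A union bound: if each constraint determines at least `m` bits of a pattern from
the remaining ones, and there are fewer than `2 ^ m` constraints, then some pattern violates
all of them. -/
theorem exists_subset_avoiding {α ι : Type*} (F : Finset α) (D : Finset ι) (m : ℕ)
    (hm : D.card < 2 ^ m) (Bad : ι → Finset α → Prop)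
    (hBad : ∀ i ∈ D, ∃ I ⊆ F, m ≤ I.card ∧
      ∀ a b, Bad i a → Bad i b → a \ I = b \ I → a = b) :
    ∃ a ⊆ F, ∀ i ∈ D, ¬ Bad i a := by
  by_contra! hcon
  have hcard : ∀ i ∈ D, (F.powerset.filter (Bad i)).card * 2 ^ m ≤ 2 ^ F.card := by
    intro i hi
    obtain ⟨I, hIF, hIm, hI⟩ := hBad i hi
    have h1 : (F.powerset.filter (Bad i)).card ≤ (F \ I).powerset.card := by
      refine Finset.card_le_card_of_injOn (fun a => a \ I) ?_ ?_
      · intro a ha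
        simp only [Finset.coe_filter, Finset.mem_powerset, mem_ofPred_eq] at ha
        exact Finset.mem_coe.mpr (Finset.mem_powerset.mpr
          (Finset.sdiff_subset_sdiff ha.1 le_rfl))
      · intro a ha b hb hab
        simp only [Finset.coe_filter, mem_ofPred_eq] at ha hb
        exact hI a b ha.2 hb.2 hab
    rw [Finset.card_powerset, Finset.card_sdiff_of_subset hIF] at h1
    calc _ ≤ 2 ^ (F.card - I.card) * 2 ^ I.card :=
          Nat.mul_le_mul h1 (Nat.pow_le_pow_right two_pos hIm)
      _ = 2 ^ F.card := by rw [← pow_add, Nat.sub_add_cancel (Finset.card_le_card hIF)]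
  have hcover : F.powerset ⊆ D.biUnion fun i => F.powerset.filter (Bad i) := by
    intro a ha
    obtain ⟨i, hi, hb⟩ := hcon a (Finset.mem_powerset.mp ha)
    exact Finset.mem_biUnion.mpr ⟨i, hi, Finset.mem_filter.mpr ⟨ha, hb⟩⟩
  have h2 : 2 ^ F.card * 2 ^ m ≤ D.card * 2 ^ F.card := by
    calc 2 ^ F.card * 2 ^ m ≤ (∑ i ∈ D, (F.powerset.filter (Bad i)).card) * 2 ^ m := by
          rw [← Finset.card_powerset]
          exact Nat.mul_le_mul_right _ ((Finset.card_le_card hcover).trans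
            Finset.card_biUnion_le)
      _ = ∑ i ∈ D, (F.powerset.filter (Bad i)).card * 2 ^ m := Finset.sum_mul ..
      _ ≤ ∑ i ∈ D, 2 ^ F.card := Finset.sum_le_sum hcard
      _ = D.card * 2 ^ F.card := by simp
  have h3 : D.card * 2 ^ F.card < 2 ^ m * 2 ^ F.card :=
    Nat.mul_lt_mul_of_pos_right hm (by positivity)
  rw [mul_comm (2 ^ m)] at h3
  omega

theorem exists_poly_lt_two_pow (h : ℕ) : ∃ m : ℕ, 2 * ((3 * m + 2) * h) ^ 6 < 2 ^ m := by
  have ht : Filter.Tendsto (fun m : ℕ => (m : ℝ) ^ 6 / 2 ^ m) Filter.atTop (nhds 0) :=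
    tendsto_pow_const_div_const_pow_of_one_lt 6 (by norm_num)
  have hpos : (0 : ℝ) < 1 / (2 * (5 * h + 1) ^ 6) := by positivity
  obtain ⟨m, hm1, hm⟩ := ((Filter.eventually_ge_atTop 1).and
    (ht.eventually (gt_mem_nhds hpos))).exists
  refine ⟨m, ?_⟩
  rw [div_lt_div_iff₀ (by positivity) (by positivity), one_mul] at hm
  have hm' : m ^ 6 * (2 * (5 * h + 1) ^ 6) < 2 ^ m := by exact_mod_cast hm
  refine lt_of_le_of_lt ?_ hm'
  calc 2 * ((3 * m + 2) * h) ^ 6 ≤ 2 * (m * (5 * h + 1)) ^ 6 := by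
        gcongr 2 * ?_ ^ 6
        nlinarith
    _ = m ^ 6 * (2 * (5 * h + 1) ^ 6) := by ring

theorem iff_congr_left_cancel {p q r : Prop} (h : (p ↔ q) ↔ (p ↔ r)) : q ↔ r := by
  tauto

/-- The greedy step: around `x` there is a pattern of flips on `F` making the views of `A` from `x`
and from `δ • x` differ for each `δ ∈ D`, whatever the flips `q` made elsewhere. -/
theorem exists_pattern (F D : Finset G) (m : ℕ) (hDcard : D.card < 2 ^ m)
    (hD1 : ∀ δ ∈ D, δ ≠ 1) (U U' A Z : Set X) (x : X)
    (hF : 3 * m + 2 ≤ (F.filter fun f => f • x ∈ U).card)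
    (hU'F : ∀ x : X, (F.filter fun f => f • x ∈ U').card ≤ 1) (q : G → Finset G) :
    ∃ a : Finset G, ∀ δ ∈ D, ∃ v ∈ F, v • x ∈ U \ U' ∧ (v * δ) • x ∉ U' ∧
      ¬ ((v • x ∈ A ↔ v ∈ a) ↔ ((v * δ) • x ∈ A ↔ ((v * δ) • x ∈ U \ U' ∧
        ∃ f ∈ F, (f⁻¹ * v * δ) • x ∈ Z ∧
          f ∈ if f⁻¹ * v * δ = 1 then a else q (f⁻¹ * v * δ)))) := by
  obtain ⟨a, -, ha⟩ := exists_subset_avoiding F D m hDcard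
    (fun δ a => ∀ v ∈ F, v • x ∈ U \ U' → (v * δ) • x ∉ U' →
      ((v • x ∈ A ↔ v ∈ a) ↔ ((v * δ) • x ∈ A ↔ ((v * δ) • x ∈ U \ U' ∧
        ∃ f ∈ F, (f⁻¹ * v * δ) • x ∈ Z ∧
          f ∈ if f⁻¹ * v * δ = 1 then a else q (f⁻¹ * v * δ)))))
    (by
      intro δ hδ
      obtain ⟨I, hIE, hIc, hI⟩ := exists_subset_disjoint_mul_right (hD1 δ hδ)
        (F.filter fun v => v • x ∈ U \ U' ∧ (v * δ) • x ∉ U')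
      refine ⟨I, hIE.trans (Finset.filter_subset _ _), ?_, ?_⟩
      · have hsub : (F.filter fun v => v • x ∈ U) ⊆
            (F.filter fun v => v • x ∈ U \ U' ∧ (v * δ) • x ∉ U') ∪
            ((F.filter fun v => v • x ∈ U') ∪ (F.filter fun v => v • (δ • x) ∈ U')) := by
          intro v hv
          simp only [Finset.mem_union, Finset.mem_filter, mem_sdiff, smul_smul] at hv ⊢
          tauto
        have h1 := hF.trans (Finset.card_le_card hsub)
        have h2 := Finset.card_union_le
          (F.filter fun v => v • x ∈ U \ U' ∧ (v * δ) • x ∉ U')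
          ((F.filter fun v => v • x ∈ U') ∪ (F.filter fun v => v • (δ • x) ∈ U'))
        have h3 := Finset.card_union_le
          (F.filter fun v => v • x ∈ U') (F.filter fun v => v • (δ • x) ∈ U')
        have h4 := hU'F x
        have h5 := hU'F (δ • x)
        omega
      · intro a b ha hb hab
        have hoff : ∀ v ∉ I, v ∈ a ↔ v ∈ b := by
          intro v hv
          have h := Finset.ext_iff.mp hab v
          simpa [hv] using h
        ext v
        by_cases hv : v ∈ I
        · have hvE := Finset.mem_filter.mp (hIE hv)
          have h1 := ha v hvE.1 hvE.2.1 hvE.2.2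
          have h2 := hb v hvE.1 hvE.2.1 hvE.2.2
          have h3 : ∀ f, (f ∈ if f⁻¹ * v * δ = 1 then a else q (f⁻¹ * v * δ)) ↔
              (f ∈ if f⁻¹ * v * δ = 1 then b else q (f⁻¹ * v * δ)) := by
            intro f
            split_ifs with hf
            · rw [mul_assoc, inv_mul_eq_one] at hf
              exact hoff f (hf ▸ hI v hv)
            · rfl
          simp only [h3] at h1
          exact iff_congr_left_cancel (h1.trans h2.symm)
        · exact hoff v hv)
  refine ⟨a, fun δ hδ => ?_⟩
  by_contra hcon
  refine ha δ hδ fun v hv hvO hvU => ?_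
  by_contra hne
  exact hcon ⟨v, hv, hvO, hvU, hne⟩

variable [MeasurableSpace X]

theorem exists_measurable_coloring [StandardBorelSpace X] [MeasurableConstSMul G X]
    (hfree : ∀ (g : G) (x : X), g • x = x → g = 1) (N : Finset G) :
    ∃ c : X → ℕ, Measurable c ∧ ∀ x, ∀ g ∈ N, g ≠ 1 → c (g • x) ≠ c x := by
  obtain ⟨φ, hφ⟩ := exists_measurableEmbedding_real X
  have hex : ∀ x, ∃ n : ℕ, ∀ g ∈ N, g ≠ 1 → ⌊n * φ (g • x)⌋ ≠ ⌊n * φ x⌋ := by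
    intro x
    have key : ∀ g : G, ∃ m : ℕ, g ≠ 1 → ∀ n ≥ m, ⌊(n : ℝ) * φ (g • x)⌋ ≠ ⌊n * φ x⌋ := by
      intro g
      by_cases hg : g = 1
      · exact ⟨0, fun h => absurd hg h⟩
      have hne : φ (g • x) - φ x ≠ 0 := fun h =>
        hg (hfree g x (hφ.injective (sub_eq_zero.mp h)))
      have hpos := abs_pos.mpr hne
      obtain ⟨m, hm⟩ := exists_nat_gt (1 / |φ (g • x) - φ x|)
      refine ⟨m, fun _ n hn h => ?_⟩
      have h1 := Int.abs_sub_lt_one_of_floor_eq_floor h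
      rw [← mul_sub, abs_mul, Nat.abs_cast] at h1
      rw [div_lt_iff₀ hpos] at hm
      have hn' : (m : ℝ) ≤ n := by exact_mod_cast hn
      nlinarith
    choose m hm using key
    exact ⟨N.sup m, fun g hg hg1 => hm g hg1 _ (Finset.le_sup hg)⟩
  have hmeas : ∀ n : ℕ, Measurable fun x => ⌊(n : ℝ) * φ x⌋ := fun n =>
    Int.measurable_floor.comp (hφ.measurable.const_mul _)
  have hset : ∀ n : ℕ, MeasurableSet
      {x | ∀ g ∈ N, g ≠ 1 → ⌊(n : ℝ) * φ (g • x)⌋ ≠ ⌊n * φ x⌋} := by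
    intro n
    have : {x | ∀ g ∈ N, g ≠ 1 → ⌊(n : ℝ) * φ (g • x)⌋ ≠ ⌊n * φ x⌋} =
        ⋂ g ∈ N, {x | g ≠ 1 → ⌊(n : ℝ) * φ (g • x)⌋ ≠ ⌊n * φ x⌋} := by
      ext x; simp
    rw [this]
    refine Finset.measurableSet_biInter _ fun g _ => ?_
    refine (MeasurableSet.const _).imp ?_
    exact (measurableSet_eq_fun ((hmeas n).comp (measurable_const_smul g)) (hmeas n)).compl
  have hfind : Measurable fun x => Nat.find (hex x) := measurable_find hex hset
  refine ⟨fun x => Encodable.encode (Nat.find (hex x), ⌊(Nat.find (hex x) : ℝ) * φ x⌋),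
    ?_, ?_⟩
  · have h2 : Measurable fun x => ⌊(Nat.find (hex x) : ℝ) * φ x⌋ :=
      Int.measurable_floor.comp
        (((measurable_from_top (f := fun n : ℕ => (n : ℝ))).comp hfind).mul hφ.measurable)
    exact (measurable_of_countable (Encodable.encode : ℕ × ℤ → ℕ)).comp (hfind.prodMk h2)
  · intro x g hg hg1 h
    have h' := Encodable.encode_injective h
    rw [Prod.mk.injEq] at h'
    have hs := Nat.find_spec (hex x) g hg hg1
    rw [← h'.1] at hs
    apply hs
    rw [h'.2, h'.1]

/-- Greedy choice along a measurable countable colouring: labels are chosen one colour at a time,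
each choice seeing the labels of the points of smaller colour in a finite neighbourhood. -/
theorem exists_measurable_greedy [MeasurableConstSMul G X] {P : Type*} [Countable P] (d : P)
    {c : X → ℕ} (hc : Measurable c) (N : Finset G) (R : X → (G → P) → P → Prop)
    (hR : ∀ q a, MeasurableSet {x | R x q a}) (hex : ∀ x q, ∃ a, R x q a) :
    ∃ p : X → P, (∀ a, MeasurableSet {x | p x = a}) ∧
      ∀ x, R x (fun g => if g ∈ N ∧ c (g • x) < c x then p (g • x) else d) (p x) := by
  obtain ⟨e, he⟩ := exists_injective_nat P
  have hex' : ∀ x q, ∃ a, R x q a ∧ ∀ b, R x q b → e a ≤ e b := by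
    intro x q
    have h : ∃ n, ∃ a, R x q a ∧ e a = n := (hex x q).elim fun a ha => ⟨_, a, ha, rfl⟩
    obtain ⟨a, ha, hea⟩ := Nat.find_spec h
    exact ⟨a, ha, fun b hb => hea ▸ Nat.find_min' h ⟨b, hb, rfl⟩⟩
  choose φ hφ hφmin using hex'
  have hφm : ∀ q a, MeasurableSet {x | φ x q = a} := by
    intro q a
    have : {x | φ x q = a} = {x | R x q a} ∩ ⋂ b, {x | R x q b → e a ≤ e b} := by
      ext x
      simp only [mem_ofPred_eq, mem_inter_iff, mem_iInter]
      constructor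
      · rintro rfl
        exact ⟨hφ x q, hφmin x q⟩
      · rintro ⟨h1, h2⟩
        exact he (le_antisymm (hφmin x q a h1) (h2 _ (hφ x q)))
    rw [this]
    exact (hR q a).inter (MeasurableSet.iInter fun b => (hR q b).imp (MeasurableSet.const _))
  let p : X → P := (measure c).wf.fix fun x rec =>
    φ x fun g => if h : g ∈ N ∧ c (g • x) < c x then rec (g • x) h.2 else d
  have hp : ∀ x, p x = φ x (fun g => if g ∈ N ∧ c (g • x) < c x then p (g • x) else d) := by
    intro x
    have h := (measure c).wf.fix_eq (C := fun _ => P) (fun x rec =>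
      φ x fun g => if h : g ∈ N ∧ c (g • x) < c x then rec (g • x) h.2 else d) x
    refine h.trans ?_
    congr 1
  have hpm : ∀ n a, MeasurableSet {x | c x = n ∧ p x = a} := by
    intro n
    induction n using Nat.strong_induction_on with
    | _ n ih =>
      intro a
      have hlt : ∀ (g : G) (b : P), MeasurableSet {x | c (g • x) < n ∧ p (g • x) = b} := by
        intro g b
        have : {x | c (g • x) < n ∧ p (g • x) = b} =
            ⋃ k ∈ Finset.range n, (fun x => g • x) ⁻¹' {x | c x = k ∧ p x = b} := by
          ext x; simp
        rw [this]
        exact Finset.measurableSet_biUnion _ fun k hk =>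
          measurable_const_smul g (ih k (Finset.mem_range.mp hk) b)
      let ext' : (N → P) → G → P := fun r g => if h : g ∈ N then r ⟨g, h⟩ else d
      have : {x | c x = n ∧ p x = a} = {x | c x = n} ∩ ⋃ r : N → P, ({x | φ x (ext' r) = a} ∩
          ⋂ g : N, ({x | c (g.1 • x) < n ∧ p (g.1 • x) = r g} ∪
            ({x | c (g.1 • x) < n}ᶜ ∩ {_x | r g = d}))) := by
        ext x
        simp only [mem_ofPred_eq, mem_inter_iff, mem_iUnion, mem_iInter, mem_union,
          mem_compl_iff]
        refine and_congr_right fun hn => ?_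
        have hq : ∀ r : N → P, (∀ g : N, (c (g.1 • x) < n ∧ p (g.1 • x) = r g) ∨
            (¬ c (g.1 • x) < n ∧ r g = d)) →
            (fun g => if g ∈ N ∧ c (g • x) < c x then p (g • x) else d) = ext' r := by
          intro r hr
          funext g
          by_cases hg : g ∈ N
          · rcases hr ⟨g, hg⟩ with h | h
            · simp only [ext', hg, hn, h.1, h.2, and_self, if_true, dif_pos]
            · simp only [ext', hg, hn, h.1, h.2, and_false, if_false, dif_pos]
          · simp [ext', hg]
        constructor
        · intro h
          refine ⟨fun g => if c (g.1 • x) < n then p (g.1 • x) else d, ?_⟩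
          have hr : ∀ g : N, (c (g.1 • x) < n ∧ p (g.1 • x) =
              (if c (g.1 • x) < n then p (g.1 • x) else d)) ∨
            (¬ c (g.1 • x) < n ∧ (if c (g.1 • x) < n then p (g.1 • x) else d) = d) := by
            intro g
            by_cases hg : c (g.1 • x) < n <;> simp [hg]
          refine ⟨?_, hr⟩
          rw [← hq _ hr, ← hp, h]
        · rintro ⟨r, h, hr⟩
          rw [hp, hq r hr, h]
      rw [this]
      refine (hc (measurableSet_singleton n)).inter (MeasurableSet.iUnion fun r =>
        (hφm _ a).inter (MeasurableSet.iInter fun g => (hlt _ _).union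
          (MeasurableSet.inter ?_ (MeasurableSet.const _))))
      exact ((hc.comp (measurable_const_smul g.1)) measurableSet_Iio).compl
  refine ⟨p, fun a => ?_, fun x => ?_⟩
  · have : {x | p x = a} = ⋃ n, {x | c x = n ∧ p x = a} := by ext x; simp
    rw [this]
    exact MeasurableSet.iUnion fun n => hpm n a
  · have h := hφ x (fun g => if g ∈ N ∧ c (g • x) < c x then p (g • x) else d)
    rwa [← hp] at h

theorem exists_measurable_maximal_separated [StandardBorelSpace X] [MeasurableConstSMul G X]
    (hfree : ∀ (g : G) (x : X), g • x = x → g = 1) (S : Finset G) (h1 : (1 : G) ∈ S)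
    (hS : ∀ s ∈ S, s⁻¹ ∈ S) {U : Set X} (hU : MeasurableSet U) :
    ∃ Y ⊆ U, MeasurableSet Y ∧ (∀ y ∈ Y, ∀ s ∈ S, s • y ∈ Y → s = 1) ∧
      ∀ u ∈ U, ∃ s ∈ S, s • u ∈ Y := by
  obtain ⟨c, hc, hcS⟩ := exists_measurable_coloring hfree S
  obtain ⟨p, hp, hR⟩ := exists_measurable_greedy false hc S
    (fun x q a => a = true ↔ (x ∈ U ∧ ∀ s ∈ S, q s = false))
    (fun q a => (MeasurableSet.const _).iff (hU.inter (MeasurableSet.const _)))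
    (fun x q => ⟨decide (x ∈ U ∧ ∀ s ∈ S, q s = false), by simp⟩)
  refine ⟨{x | p x = true}, fun x hx => ((hR x).1 hx).1, hp true, ?_, ?_⟩
  · intro y hy s hs hsy
    by_contra hne
    rcases lt_or_gt_of_ne (hcS y s hs hne) with h | h
    · have hns := ((hR y).1 hy).2 s hs
      beta_reduce at hns
      rw [if_pos ⟨hs, h⟩] at hns
      exact Bool.false_ne_true (hns.symm.trans hsy)
    · have hns := ((hR (s • y)).1 hsy).2 s⁻¹ (hS s hs)
      beta_reduce at hns
      rw [inv_smul_smul, if_pos ⟨hS s hs, h⟩] at hns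
      exact Bool.false_ne_true (hns.symm.trans hy)
  · intro u hu
    by_cases h : p u = true
    · exact ⟨1, h1, by simpa using h⟩
    · by_contra! hcon
      refine h ((hR u).2 ⟨hu, fun s hs => ?_⟩)
      beta_reduce
      split_ifs
      · exact Bool.eq_false_iff.mpr (hcon s hs)
      · rfl

/-- One step of the construction: changing `A` only on the syndetic set `U`, we can separate the
orbit pattern at `x` from that at `γ • x`, uniformly in `x`, in a way that survives any later change
on a smaller syndetic set. -/
theorem exists_separating_modification [Countable G] [Infinite G] [StandardBorelSpace X]
    [MeasurableConstSMul G X] (hfree : ∀ (g : G) (x : X), g • x = x → g = 1) {γ : G} (hγ : γ ≠ 1) {A U : Set X}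
    (hA : MeasurableSet A) (hU : MeasurableSet U) (hUs : Syndetic G U) :
    ∃ A' U' : Set X, MeasurableSet A' ∧ MeasurableSet U' ∧ U' ⊆ U ∧ Syndetic G U' ∧
      (∀ x ∉ U, x ∈ A' ↔ x ∈ A) ∧
      ∃ T : Finset G, ∀ A'' : Set X, (∀ x ∉ U', x ∈ A'' ↔ x ∈ A') →
        ∀ x : X, ∃ t ∈ T, ¬ (t • x ∈ A'' ↔ (t * γ) • x ∈ A'') := by
  rcases isEmpty_or_nonempty X with hX | ⟨⟨x₀⟩⟩
  · exact ⟨A, U, hA, hU, subset_rfl, hUs, fun _ _ => Iff.rfl, ∅, fun _ _ x => isEmptyElim x⟩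
  obtain ⟨H, hH⟩ := hUs
  obtain ⟨m, hm⟩ := exists_poly_lt_two_pow H.card
  obtain ⟨F, hFc, hF⟩ := exists_finset_many_visits hH (3 * m + 2)
  obtain ⟨f₀, hf₀⟩ : F.Nonempty := by
    have h : 0 < (F.filter fun f => f • x₀ ∈ U).card := lt_of_lt_of_le (by omega) (hF x₀)
    exact (Finset.card_pos.mp h).mono (Finset.filter_subset _ _)
  obtain ⟨L, hL⟩ : ∃ L, L = F⁻¹ * F := ⟨_, rfl⟩
  have hLmem : ∀ f ∈ F, ∀ g ∈ F, f⁻¹ * g ∈ L := fun f hf g hg => by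
    rw [hL]
    exact Finset.mul_mem_mul (Finset.inv_mem_inv hf) hg
  have hL1 : (1 : G) ∈ L := by simpa using hLmem f₀ hf₀ f₀ hf₀
  have hLinv : ∀ l ∈ L, l⁻¹ ∈ L := by
    intro l hl
    rw [hL, Finset.mem_mul] at hl
    obtain ⟨a, ha, b, hb, rfl⟩ := hl
    rw [Finset.mem_inv'] at ha
    simpa using hLmem b hb a⁻¹ ha
  obtain ⟨D, hD⟩ : ∃ D, D = (L * (L * L)).image (fun s => s * γ * s⁻¹) ∪
    (L * (L * L)).image (fun s => s * γ⁻¹ * s⁻¹) := ⟨_, rfl⟩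
  have hDcard : D.card < 2 ^ m := by
    have h1 : L.card ≤ F.card * F.card := by
      rw [hL]
      exact Finset.card_mul_le.trans (by rw [Finset.card_inv])
    have h2 : (L * (L * L)).card ≤ L.card * (L.card * L.card) :=
      Finset.card_mul_le.trans (Nat.mul_le_mul_left _ Finset.card_mul_le)
    have h3 : D.card ≤ (L * (L * L)).card + (L * (L * L)).card := by
      rw [hD]
      exact (Finset.card_union_le _ _).trans
        (add_le_add Finset.card_image_le Finset.card_image_le)
    refine lt_of_le_of_lt ?_ hm
    calc D.card ≤ 2 * (L.card * (L.card * L.card)) := by omega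
      _ ≤ 2 * ((F.card * F.card) * ((F.card * F.card) * (F.card * F.card))) := by gcongr
      _ = 2 * F.card ^ 6 := by ring
      _ ≤ 2 * ((3 * m + 2) * H.card) ^ 6 := by gcongr
  have hD1 : ∀ δ ∈ D, δ ≠ 1 := by
    rintro δ hδ rfl
    rw [hD, Finset.mem_union, Finset.mem_image, Finset.mem_image] at hδ
    rcases hδ with ⟨s, -, hs⟩ | ⟨s, -, hs⟩
    · exact hγ (by simpa using hs)
    · exact hγ (by simpa using hs)
  obtain ⟨U', hU'U, hU', hU'sep, hU'max⟩ :=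
    exists_measurable_maximal_separated hfree (F * F⁻¹)
      (Finset.mem_mul.mpr ⟨f₀, hf₀, f₀⁻¹, Finset.inv_mem_inv hf₀, by group⟩)
      (fun s hs => by
        have h : s⁻¹ ∈ (F * F⁻¹)⁻¹ := Finset.inv_mem_inv hs
        simpa using h) hU
  obtain ⟨Z, -, hZ, hZsep, hZmax⟩ :=
    exists_measurable_maximal_separated hfree (L * L)
      (Finset.mem_mul.mpr ⟨1, hL1, 1, hL1, by group⟩)
      (fun s hs => by
        obtain ⟨a, ha, b, hb, rfl⟩ := Finset.mem_mul.mp hs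
        exact Finset.mem_mul.mpr ⟨b⁻¹, hLinv b hb, a⁻¹, hLinv a ha, by group⟩)
      (MeasurableSet.univ (α := X))
  have hU'F : ∀ x : X, (F.filter fun f => f • x ∈ U').card ≤ 1 := by
    intro x
    refine Finset.card_le_one.mpr fun a ha b hb => ?_
    rw [Finset.mem_filter] at ha hb
    have h := hU'sep (a • x) ha.2 (b * a⁻¹)
      (Finset.mul_mem_mul hb.1 (Finset.inv_mem_inv ha.1))
      (by rw [smul_smul, inv_mul_cancel_right]; exact hb.2)
    exact (mul_inv_eq_one.mp h).symm
  obtain ⟨c, hc, hcN⟩ := exists_measurable_coloring hfree (L * D)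
  obtain ⟨O, hO⟩ : ∃ O, O = U \ U' := ⟨_, rfl⟩
  have hOm : MeasurableSet O := hO ▸ hU.diff hU'
  have hsm : ∀ {B : Set X}, MeasurableSet B → ∀ g : G, Measurable fun x => g • x ∈ B :=
    fun hB g => measurableSet_setOfPred.mp (measurable_const_smul g hB)
  obtain ⟨p, hp, hR⟩ := exists_measurable_greedy (∅ : Finset G) hc (L * D)
    (fun x q a => x ∈ Z → ∀ δ ∈ D, ∃ v ∈ F, v • x ∈ O ∧ (v * δ) • x ∉ U' ∧
      ¬ ((v • x ∈ A ↔ v ∈ a) ↔ ((v * δ) • x ∈ A ↔ ((v * δ) • x ∈ O ∧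
        ∃ f ∈ F, (f⁻¹ * v * δ) • x ∈ Z ∧
          f ∈ if f⁻¹ * v * δ = 1 then a else q (f⁻¹ * v * δ)))))
    (by
      intro q a
      refine measurableSet_setOfPred.mpr ?_
      refine Measurable.imp (measurableSet_setOfPred.mp hZ) (Measurable.forall fun δ =>
        measurable_const.imp (Measurable.exists fun v => measurable_const.and
        ((hsm hOm v).and ((hsm hU' _).not.and (Measurable.not (Measurable.iff
          ((hsm hA v).iff measurable_const) ((hsm hA _).iff ((hsm hOm _).and
          (Measurable.exists fun f => measurable_const.and
            ((hsm hZ _).and measurable_const)))))))))))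
    (fun x q => (exists_pattern F D m hDcard hD1 U U' A Z x (hF x) hU'F q).imp
      fun a ha _ => by rwa [hO])
  obtain ⟨M, hM⟩ : ∃ M : Set X, M = {x | x ∈ O ∧ ∃ f ∈ F, f⁻¹ • x ∈ Z ∧ f ∈ p (f⁻¹ • x)} :=
    ⟨_, rfl⟩
  have hMm : MeasurableSet M := by
    have hpf : ∀ f : G, MeasurableSet {x | f ∈ p x} := by
      intro f
      have : {x | f ∈ p x} = ⋃ a : Finset G, {x | p x = a} ∩ {_x | f ∈ a} := by
        ext x; simp
      rw [this]
      exact MeasurableSet.iUnion fun a => (hp a).inter (MeasurableSet.const _)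
    rw [hM]
    refine measurableSet_setOfPred.mpr ((measurableSet_setOfPred.mp hOm).and
      (Measurable.exists fun f => measurable_const.and ((hsm hZ _).and (hsm (hpf f) _))))
  obtain ⟨A', hA'⟩ : ∃ A' : Set X, A' = {x | ¬ (x ∈ A ↔ x ∈ M)} := ⟨_, rfl⟩
  have hkey : ∀ z ∈ Z, ∀ δ ∈ D,
      (∀ l ∈ L, (l * δ) • z ∈ Z → l * δ = 1 ∨ c ((l * δ) • z) < c z) →
      ∃ v ∈ F, v • z ∉ U' ∧ (v * δ) • z ∉ U' ∧ ¬ (v • z ∈ A' ↔ (v * δ) • z ∈ A') := by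
    intro z hz δ hδ hcol
    obtain ⟨v, hv, hvO, hvU, hne⟩ := hR z hz δ hδ
    refine ⟨v, hv, (hO ▸ hvO : v • z ∈ U \ U').2, hvU, ?_⟩
    have h1 : v • z ∈ M ↔ v ∈ p z := by
      simp only [hM, mem_ofPred_eq, smul_smul]
      constructor
      · rintro ⟨-, f, hf, hfZ, hfp⟩
        have h := hZsep z hz (f⁻¹ * v)
          (Finset.mem_mul.mpr ⟨_, hLmem f hf v hv, 1, hL1, mul_one _⟩) hfZ
        rw [h, one_smul] at hfp
        rwa [← inv_mul_eq_one.mp h]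
      · intro h
        exact ⟨hvO, v, hv, by simpa using hz, by simpa using h⟩
    have h2 : (v * δ) • z ∈ M ↔ ((v * δ) • z ∈ O ∧
        ∃ f ∈ F, (f⁻¹ * v * δ) • z ∈ Z ∧
          f ∈ if f⁻¹ * v * δ = 1 then p z else
            if f⁻¹ * v * δ ∈ L * D ∧ c ((f⁻¹ * v * δ) • z) < c z then
              p ((f⁻¹ * v * δ) • z) else ∅) := by
      simp only [hM, mem_ofPred_eq, smul_smul, ← mul_assoc]
      refine and_congr_right fun _ => exists_congr fun f => and_congr_right fun hf =>
        and_congr_right fun hfZ => ?_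
      have hl := hLmem f hf v hv
      split_ifs with h3 h4
      · rw [h3, one_smul]
      · rfl
      · exact absurd ⟨Finset.mul_mem_mul hl hδ, (hcol _ hl hfZ).resolve_left h3⟩ h4
    rw [← h1, ← h2] at hne
    simp only [hA', mem_ofPred_eq]
    tauto
  refine ⟨A', U', ?_, hU', hU'U, ?_, ?_, F * (L * (L * L)), ?_⟩
  · rw [hA']
    exact (hA.iff hMm).compl
  · refine ⟨F * F⁻¹ * H, fun x => ?_⟩
    obtain ⟨h, hh, hx⟩ := hH x
    obtain ⟨s, hs, hsx⟩ := hU'max _ hx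
    exact ⟨s * h, Finset.mul_mem_mul hs hh, by rwa [mul_smul]⟩
  · intro x hx
    have hxM : x ∉ M := by
      rw [hM, hO]
      exact fun h => hx h.1.1
    simp only [hA', mem_ofPred_eq]
    tauto
  · intro A'' hA'' x
    obtain ⟨s, hs, hsZ⟩ := hZmax x (mem_univ x)
    have hsV : s ∈ L * (L * L) := Finset.mem_mul.mpr ⟨1, hL1, s, hs, one_mul s⟩
    have hδ : s * γ * s⁻¹ ∈ D := by
      rw [hD]
      exact Finset.mem_union_left _ (Finset.mem_image_of_mem _ hsV)
    by_cases hcol : ∀ l ∈ L, (l * (s * γ * s⁻¹)) • s • x ∈ Z →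
        l * (s * γ * s⁻¹) = 1 ∨ c ((l * (s * γ * s⁻¹)) • s • x) < c (s • x)
    · obtain ⟨v, hv, h1, h2, h3⟩ := hkey _ hsZ _ hδ hcol
      refine ⟨v * s, Finset.mul_mem_mul hv hsV, ?_⟩
      rw [← hA'' _ h1, ← hA'' _ h2] at h3
      have h4 : (v * (s * γ * s⁻¹)) • s • x = (v * s * γ) • x := by
        rw [smul_smul]
        congr 1
        group
      rwa [h4, smul_smul] at h3
    · push Not at hcol
      obtain ⟨l, hl, hlZ, hl1, hlc⟩ := hcol
      have hlt : c (s • x) < c ((l * (s * γ * s⁻¹)) • s • x) :=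
        lt_of_le_of_ne hlc (hcN _ _ (Finset.mul_mem_mul hl hδ) hl1).symm
      obtain ⟨z, hz⟩ : ∃ z, z = (l * (s * γ * s⁻¹)) • s • x := ⟨_, rfl⟩
      rw [← hz] at hlZ hlt
      have hzx : z = (l * s * γ) • x := by
        rw [hz, smul_smul]
        congr 1
        group
      have hlsV : l * s ∈ L * (L * L) := Finset.mul_mem_mul hl hs
      have hδ' : (l * s) * γ⁻¹ * (l * s)⁻¹ ∈ D := by
        rw [hD]
        exact Finset.mem_union_right _ (Finset.mem_image_of_mem _ hlsV)
      have hback : ∀ g : G, (g * ((l * s) * γ⁻¹ * (l * s)⁻¹)) • z = (g * l * s) • x := by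
        intro g
        rw [hzx, smul_smul]
        congr 1
        group
      obtain ⟨v, hv, h1, h2, h3⟩ := hkey z hlZ _ hδ' (by
        intro l' hl' hZ'
        right
        rw [hback, mul_smul] at hZ' ⊢
        rwa [hZsep _ hsZ _ (Finset.mul_mem_mul hl' hl) hZ', one_smul])
      refine ⟨v * (l * s), Finset.mul_mem_mul hv hlsV, ?_⟩
      rw [← hA'' _ h1, ← hA'' _ h2, hback, hzx, smul_smul] at h3
      rw [← mul_assoc v l s]
      simp only [← mul_assoc] at h3
      exact fun h => h3 h.symm

theorem exists_syndetic_measure_lt [Infinite G] [StandardBorelSpace X] [MeasurableConstSMul G X]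
    (hfree : ∀ (g : G) (x : X), g • x = x → g = 1) (μ : Measure X) [IsProbabilityMeasure μ]
    {ε : ENNReal} (hε : ε ≠ 0) :
    ∃ U : Set X, MeasurableSet U ∧ Syndetic G U ∧ μ U < ε := by
  obtain ⟨n, hn⟩ := ENNReal.exists_inv_nat_lt hε
  obtain ⟨F, hF⟩ := Infinite.exists_subset_card_eq G n
  obtain ⟨Y, -, hY, hYsep, hYmax⟩ := exists_measurable_maximal_separated hfree
    (insert 1 (F⁻¹ * F)) (Finset.mem_insert_self _ _)
    (fun s hs => by
      rcases Finset.mem_insert.mp hs with rfl | hs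
      · simp
      · have h : s⁻¹ ∈ (F⁻¹ * F)⁻¹ := Finset.inv_mem_inv hs
        refine Finset.mem_insert_of_mem ?_
        simpa using h)
    (MeasurableSet.univ (α := X))
  have hmeas : ∀ f : G, MeasurableSet ((fun x : X => f⁻¹ • x) ⁻¹' Y) := fun f =>
    measurable_const_smul f⁻¹ hY
  have hdisj : (F : Set G).PairwiseDisjoint fun f => (fun x : X => f⁻¹ • x) ⁻¹' Y := by
    intro a ha b hb hab
    refine Set.disjoint_left.mpr fun x hxa hxb => hab ?_
    have h := hYsep (a⁻¹ • x) hxa (b⁻¹ * a)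
      (Finset.mem_insert_of_mem (Finset.mul_mem_mul (Finset.inv_mem_inv hb) ha))
      (by rw [smul_smul, mul_inv_cancel_right]; exact hxb)
    exact (inv_mul_eq_one.mp h).symm
  have hex : ∃ f ∈ F, μ ((fun x : X => f⁻¹ • x) ⁻¹' Y) < ε := by
    by_contra! hcon
    have h1 : (n : ENNReal) * ε ≤ 1 := by
      calc (n : ENNReal) * ε = ∑ f ∈ F, ε := by simp [hF]
        _ ≤ ∑ f ∈ F, μ ((fun x : X => f⁻¹ • x) ⁻¹' Y) := Finset.sum_le_sum hcon
        _ = μ (⋃ f ∈ F, (fun x : X => f⁻¹ • x) ⁻¹' Y) :=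
          (measure_biUnion_finset hdisj fun f _ => hmeas f).symm
        _ ≤ 1 := prob_le_one
    have h2 : ε ≤ (n : ENNReal)⁻¹ := by
      rw [ENNReal.le_inv_iff_mul_le, mul_comm]
      exact h1
    exact absurd hn (not_lt.mpr h2)
  obtain ⟨f, -, hf⟩ := hex
  refine ⟨_, hmeas f, ⟨(insert 1 (F⁻¹ * F)).image (f * ·), fun x => ?_⟩, hf⟩
  obtain ⟨s, hs, hsx⟩ := hYmax x (mem_univ x)
  exact ⟨f * s, Finset.mem_image_of_mem _ hs, by
    simpa only [mem_preimage, smul_smul, inv_mul_cancel_left] using hsx⟩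

/-- Iterating the single-element construction over all of `G`. -/
theorem exists_measurableSet_separating [Countable G] [Infinite G] [StandardBorelSpace X]
    [MeasurableConstSMul G X] (hfree : ∀ (g : G) (x : X), g • x = x → g = 1) {B U : Set X}
    (hB : MeasurableSet B) (hU : MeasurableSet U) (hUs : Syndetic G U) :
    ∃ A : Set X, MeasurableSet A ∧ (∀ x ∉ U, x ∈ A ↔ x ∈ B) ∧
      ∀ γ : G, γ ≠ 1 → ∃ T : Finset G, ∀ x : X, ∃ t ∈ T, ¬ (t • x ∈ A ↔ (t * γ) • x ∈ A) := by
  obtain ⟨e, he⟩ := exists_surjective_nat G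
  let State := {p : Set X × Set X // MeasurableSet p.1 ∧ MeasurableSet p.2 ∧ Syndetic G p.2}
  have hstep : ∀ (γ : G) (p : State), ∃ q : State, q.1.2 ⊆ p.1.2 ∧
      (∀ x ∉ p.1.2, x ∈ q.1.1 ↔ x ∈ p.1.1) ∧
      (γ ≠ 1 → ∃ T : Finset G, ∀ A : Set X, (∀ x ∉ q.1.2, x ∈ A ↔ x ∈ q.1.1) →
        ∀ x : X, ∃ t ∈ T, ¬ (t • x ∈ A ↔ (t * γ) • x ∈ A)) := by
    rintro γ ⟨⟨A, V⟩, hA, hV, hVs⟩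
    by_cases hγ : γ = 1
    · exact ⟨⟨⟨A, V⟩, hA, hV, hVs⟩, subset_rfl, fun _ _ => Iff.rfl, fun h => absurd hγ h⟩
    · obtain ⟨A', V', h1, h2, h3, h4, h5, h6⟩ := exists_separating_modification hfree hγ hA hV hVs
      exact ⟨⟨⟨A', V'⟩, h1, h2, h4⟩, h3, h5, fun _ => h6⟩
  choose next hnext using hstep
  let st : ℕ → State := fun n => Nat.rec ⟨⟨B, U⟩, hB, hU, hUs⟩ (fun k p => next (e k) p) n
  have hanti : Antitone fun n => (st n).1.2 :=
    antitone_nat_of_succ_le fun n => (hnext (e n) (st n)).1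
  have hagree : ∀ n k, ∀ x ∉ (st n).1.2, x ∈ (st (n + k)).1.1 ↔ x ∈ (st n).1.1 := by
    intro n k x hx
    induction k with
    | zero => rfl
    | succ k ih =>
      exact ((hnext (e (n + k)) (st (n + k))).2.1 x
        fun h => hx (hanti (Nat.le_add_right n k) h)).trans ih
  let A : Set X := ⋃ n, ((st n).1.1 \ (st n).1.2)
  have hA : ∀ n, ∀ x ∉ (st n).1.2, x ∈ A ↔ x ∈ (st n).1.1 := by
    intro n x hx
    simp only [A, mem_iUnion, mem_sdiff]
    refine ⟨?_, fun h => ⟨n, h, hx⟩⟩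
    rintro ⟨k, hk, hxk⟩
    rcases le_total n k with h | h
    · obtain ⟨j, rfl⟩ := Nat.exists_eq_add_of_le h
      exact (hagree n j x hx).mp hk
    · obtain ⟨j, rfl⟩ := Nat.exists_eq_add_of_le h
      exact (hagree k j x hxk).mpr hk
  refine ⟨A, MeasurableSet.iUnion fun n => (st n).2.1.diff (st n).2.2.1, hA 0, ?_⟩
  intro γ hγ
  obtain ⟨n, rfl⟩ := he γ
  obtain ⟨T, hT⟩ := (hnext (e n) (st n)).2.2 hγ
  exact ⟨T, hT A (hA (n + 1))⟩

end Construction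

/-- For every Borel set `B ⊆ X` and every `ε > 0` there is a Borel set `A` with
`μ (A Δ B) < ε` such that the induced equivariant map `f_A : X → 2^G`,
`f_A x g = (g⁻¹ • x ∈ A)`, has `closure (f_A '' X) ⊆ Free(2^G)`.  In particular the Borel
sets `A` with `f_A (X) ⊆ Free(2^G)` are dense in the measure algebra. -/
theorem dense_sets_with_free_induced_map
    {G : Type*} [Group G] [Countable G] [Infinite G]
    {X : Type*} [MeasurableSpace X] [StandardBorelSpace X] [MulAction G X]
    (hBorel : ∀ g : G, Measurable fun x : X => g • x)
    (hfree : ∀ (g : G) (x : X), g • x = x → g = 1)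
    (μ : Measure X) [IsProbabilityMeasure μ]
    (B : Set X) (hB : MeasurableSet B) (ε : ℝ) (hε : 0 < ε) :
    ∃ A : Set X, MeasurableSet A ∧ μ (symmDiff A B) < ENNReal.ofReal ε ∧
      ∃ fA : X → (G → Bool),
        (∀ (x : X) (g : G), fA x g = true ↔ g⁻¹ • x ∈ A) ∧
        Measurable fA ∧
        (∀ (g : G) (x : X), fA (g • x) = shift g (fA x)) ∧
        closure (Set.range fA) ⊆ FreePart G := by
  classical
  have : MeasurableConstSMul G X := ⟨hBorel⟩
  obtain ⟨U, hU, hUs, hμ⟩ := exists_syndetic_measure_lt hfree μ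
    (ENNReal.ofReal_pos.mpr hε).ne'
  obtain ⟨A, hA, hAB, hsep⟩ := exists_measurableSet_separating hfree hB hU hUs
  refine ⟨A, hA, (measure_mono fun x hx => ?_).trans_lt hμ,
    fun x g => decide (g⁻¹ • x ∈ A), by simp, ?_, ?_, ?_⟩
  · by_contra hxU
    have := hAB x hxU
    rcases hx with h | h
    · exact h.2 (this.mp h.1)
    · exact h.2 (this.mpr h.1)
  · refine measurable_pi_lambda _ fun g => measurable_to_bool ?_
    have : (fun x : X => decide (g⁻¹ • x ∈ A)) ⁻¹' {true} = (fun x : X => g⁻¹ • x) ⁻¹' A := by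
      ext x; simp
    rw [this]
    exact hBorel _ hA
  · intro g x
    funext h
    simp [shift, smul_smul]
  · intro w hw γ hγ hfix
    obtain ⟨T, hT⟩ := hsep γ hγ
    have hclosed : IsClosed (⋃ t ∈ T, {w : G → Bool | w t⁻¹ ≠ w (γ⁻¹ * t⁻¹)}) := by
      refine T.finite_toSet.isClosed_biUnion fun t _ => ?_
      have hcont : Continuous fun w : G → Bool => (w t⁻¹, w (γ⁻¹ * t⁻¹)) :=
        (continuous_apply t⁻¹).prodMk (continuous_apply (γ⁻¹ * t⁻¹))
      exact (isClosed_discrete {b : Bool × Bool | b.1 ≠ b.2}).preimage hcont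
    have hsub : closure (Set.range fun (x : X) (g : G) => decide (g⁻¹ • x ∈ A)) ⊆
        ⋃ t ∈ T, {w : G → Bool | w t⁻¹ ≠ w (γ⁻¹ * t⁻¹)} := by
      refine closure_minimal ?_ hclosed
      rintro _ ⟨x, rfl⟩
      obtain ⟨t, ht, hne⟩ := hT x
      simp only [mem_iUnion, mem_ofPred_eq]
      refine ⟨t, ht, fun h => hne ?_⟩
      simpa using h
    obtain ⟨t, -, ht⟩ := mem_iUnion₂.mp (hsub hw)
    exact ht (congrFun hfix t⁻¹).symm
end

section
/- Let G be a countably infinite discrete group, let L be a countable relational language, and let K be a class of countable L-structures closed under isomorphism. Let F(G,2) denote the orbit equivalence relation generated by the shift action G ↷ Free(2^G). If F(G,2) is Borel K-structurable, then the orbit equivalence relation of every free Borel action of G on a standard Borel space is Borel K-structurable. -/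
open MeasureTheory Set

universe u

/-- `E` is Borel `K`-structurable for the countable relational language with relation
symbols indexed by `I`, of arities `n i`. -/
def BorelStructurable {I : Type} (n : I → ℕ)
    (K : (α : Type u) → ((i : I) → (Fin (n i) → α) → Prop) → Prop)
    {X : Type u} [MeasurableSpace X] (E : X → X → Prop) : Prop :=
  ∃ Q : (i : I) → Set (Fin (n i) → X),
    (∀ i, MeasurableSet (Q i)) ∧
    (∀ i, ∀ t ∈ Q i, ∀ j k, E (t j) (t k)) ∧
    ∀ x : X, K {y : X // E x y} (fun i t => (fun j => ((t j : X))) ∈ Q i)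

open scoped Pointwise

theorem exists_measurable_fixedPoint {X V : Type*} [MeasurableSpace X] [MeasurableSpace V]
    [Inhabited V] {c : X → ℕ} (hc : Measurable c) (R : (X → V) → X → V)
    (hR : ∀ φ, Measurable φ → Measurable (R φ))
    (hloc : ∀ φ ψ x, (∀ y, c y < c x → φ y = ψ y) → R φ x = R ψ x) :
    ∃ φ, Measurable φ ∧ ∀ x, φ x = R φ x := by
  let Φ : ℕ → X → V := fun n => R^[n] fun _ => default
  have hΦ : ∀ n, Φ (n + 1) = R (Φ n) := fun n => Function.iterate_succ_apply' R n _
  have hstab : ∀ n x k, c x = n → n < k → Φ k x = Φ (n + 1) x := by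
    intro n
    induction n using Nat.strong_induction_on with
    | _ n ih =>
      intro x k hx hk
      obtain ⟨k, rfl⟩ : ∃ j, k = j + 1 := ⟨k - 1, by omega⟩
      rw [hΦ, hΦ]
      refine hloc _ _ _ fun y hy => ?_
      rw [ih (c y) (by omega) y k rfl (by omega), ih (c y) (by omega) y n rfl (by omega)]
  have hmeas : ∀ n, Measurable (Φ n) := by
    intro n
    induction n with
    | zero => exact measurable_const
    | succ n ih => rw [hΦ]; exact hR _ ih
  refine ⟨fun x => Φ (c x + 1) x, ?_, fun x => ?_⟩
  · have : Measurable fun p : X × ℕ => Φ (p.2 + 1) p.1 :=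
      measurable_from_prod_countable_left fun n => hmeas (n + 1)
    exact this.comp (measurable_id.prodMk hc)
  · show Φ (c x + 1) x = _
    rw [hΦ]
    refine hloc _ _ _ fun y hy => ?_
    exact hstab _ y _ rfl hy

theorem exists_measurable_separating_coloring {G X : Type*} [Group G] [Countable G] [MeasurableSpace X]
    [StandardBorelSpace X] [MulAction G X] (hBorel : ∀ g : G, Measurable fun x : X => g • x)
    (hfree : ∀ (g : G) (x : X), g • x = x → g = 1) (F : Finset G) :
    ∃ c : X → ℕ, Measurable c ∧ ∀ x, ∀ s ∈ F, s ≠ 1 → c (s • x) ≠ c x := by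
  classical
  obtain ⟨e, he, hinj⟩ := MeasurableSpace.measurable_injection_nat_bool_of_countablySeparated X
  obtain ⟨d, hd⟩ := exists_surjective_nat (Finset ℕ × Finset ℕ)
  let A : ℕ → Set X := fun j => {y | ∀ i ∈ (d j).1, (e y i = true ↔ i ∈ (d j).2)}
  have hA : ∀ j, MeasurableSet (A j) := by
    intro j
    refine measurableSet_setOfPred.2 ?_
    refine Measurable.forall fun i => Measurable.imp measurable_const ?_
    refine Measurable.iff ?_ measurable_const
    exact measurableSet_setOfPred.1 (((measurable_pi_apply i).comp he) (measurableSet_singleton true))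
  have hex : ∀ x, ∃ j, x ∈ A j ∧ ∀ s ∈ F, s ≠ 1 → s • x ∉ A j := by
    intro x
    have : ∀ s : G, ∃ i, s ≠ 1 → e (s • x) i ≠ e x i := by
      intro s
      by_cases hs : s = 1
      · exact ⟨0, fun h => (h hs).elim⟩
      · have : e (s • x) ≠ e x := fun h => hs (hfree s x (hinj h))
        obtain ⟨i, hi⟩ := Function.ne_iff.1 this
        exact ⟨i, fun _ => hi⟩
    choose i hi using this
    obtain ⟨j, hj⟩ := hd (F.image i, (F.image i).filter fun n => e x n = true)
    refine ⟨j, ?_, fun s hs hs1 hmem => ?_⟩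
    · intro n hn
      rw [hj] at hn ⊢
      simp only [Finset.mem_filter]
      exact ⟨fun h => ⟨hn, h⟩, fun h => h.2⟩
    · have hsi : i s ∈ F.image i := Finset.mem_image_of_mem i hs
      have h := hmem (i s) (by rw [hj]; exact hsi)
      rw [hj] at h
      simp only [Finset.mem_filter, hsi, true_and] at h
      exact hi s hs1 (Bool.eq_iff_iff.2 h)
  refine ⟨fun x => Nat.find (hex x), measurable_find hex fun j => ?_, fun x s hs hs1 heq => ?_⟩
  · refine measurableSet_setOfPred.2 (Measurable.and (measurableSet_setOfPred.1 (hA j)) ?_)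
    refine Measurable.forall fun s => Measurable.imp measurable_const ?_
    refine Measurable.imp measurable_const ?_
    exact measurableSet_setOfPred.1 (hBorel s (hA j)).compl
  · have h1 := Nat.find_spec (hex x)
    have h2 := Nat.find_spec (hex (s • x))
    rw [show Nat.find (hex (s • x)) = Nat.find (hex x) from heq] at h2
    exact h1.2 s hs hs1 h2.1

theorem exists_measurable_maximal_discrete {G X : Type*} [Group G] [Countable G] [MeasurableSpace X]
    [StandardBorelSpace X] [MulAction G X] (hBorel : ∀ g : G, Measurable fun x : X => g • x)
    (hfree : ∀ (g : G) (x : X), g • x = x → g = 1) (F : Finset G) (hF : ∀ s ∈ F, s⁻¹ ∈ F)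
    (hF1 : 1 ∈ F) {A : Set X} (hA : MeasurableSet A) :
    ∃ M ⊆ A, MeasurableSet M ∧ (∀ m ∈ M, ∀ s ∈ F, s • m ∈ M → s • m = m) ∧
      ∀ a ∈ A, ∃ s ∈ F, s • a ∈ M := by
  obtain ⟨c, hc, hcF⟩ := exists_measurable_separating_coloring hBorel hfree F
  obtain ⟨M, hM, hfix⟩ := exists_measurable_fixedPoint (V := Prop) hc
    (fun M x => x ∈ A ∧ ∀ s ∈ F, c (s • x) < c x → ¬ M (s • x)) (by
      intro M hM
      refine Measurable.and (measurableSet_setOfPred.1 hA) ?_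
      refine Measurable.forall fun s => Measurable.imp measurable_const ?_
      refine Measurable.imp ?_ (Measurable.not (hM.comp (hBorel s)))
      exact measurableSet_setOfPred.1 (measurableSet_lt (hc.comp (hBorel s)) hc)) (by
      intro φ ψ x h
      refine propext (and_congr_right fun _ => forall₂_congr fun s _ => ?_)
      exact imp_congr_right fun hs => by rw [h _ hs])
  refine ⟨{x | M x}, fun x hx => ((hfix x).mp hx).1, measurableSet_setOfPred.2 hM, ?_, ?_⟩
  · intro m hm s hs hsm
    by_contra hne
    have hs1 : s ≠ 1 := fun h => hne (by rw [h, one_smul])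
    rcases lt_trichotomy (c (s • m)) (c m) with h | h | h
    · exact ((hfix m).mp hm).2 s hs h hsm
    · exact hcF m s hs hs1 h
    · have := ((hfix _).mp hsm).2 s⁻¹ (hF s hs)
      rw [inv_smul_smul] at this
      exact this h hm
  · intro a ha
    by_contra! hcon
    have h1 := hcon 1 hF1
    rw [one_smul] at h1
    refine h1 ((hfix a).mpr ⟨ha, fun s hs _ h => hcon s hs h⟩)

theorem card_filter_powerset_mul_two_pow_le {α : Type*} [DecidableEq α] {B Q : Finset α}
    (hQ : Q ⊆ B) {l : ℕ} (hl : l ≤ Q.card) (p : Finset α → Prop) [DecidablePred p]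
    (h : ∀ v w, p v → p w → v \ Q = w \ Q → v = w) :
    (B.powerset.filter p).card * 2 ^ l ≤ 2 ^ B.card := by
  have h1 : (B.powerset.filter p).card ≤ (B \ Q).powerset.card := by
    refine Finset.card_le_card_of_injOn (fun v => v \ Q) ?_ ?_
    · intro v hv
      simp only [Finset.coe_filter, Finset.mem_powerset, mem_ofPred_eq] at hv
      exact Finset.mem_coe.2 (Finset.mem_powerset.2 (Finset.sdiff_subset_sdiff hv.1 (le_refl Q)))
    · intro v hv w hw hvw
      simp only [Finset.coe_filter, mem_ofPred_eq] at hv hw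
      exact h v w hv.2 hw.2 hvw
  rw [Finset.card_powerset, Finset.card_sdiff_of_subset hQ] at h1
  calc _ ≤ 2 ^ (B.card - Q.card) * 2 ^ Q.card :=
        Nat.mul_le_mul h1 (Nat.pow_le_pow_right (by norm_num) hl)
    _ = 2 ^ B.card := by rw [← pow_add, Nat.sub_add_cancel (Finset.card_le_card hQ)]

theorem exists_subset_mul_right_notMem {G : Type*} [Group G] {γ : G} (hγ : γ ≠ 1)
    (S : Finset G) : ∃ Q ⊆ S, S.card ≤ 3 * Q.card ∧ ∀ g ∈ Q, g * γ ∉ Q := by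
  classical
  obtain ⟨Q, hQ, hmax⟩ := Finset.exists_max_image
    (S.powerset.filter fun Q => ∀ g ∈ Q, g * γ ∉ Q) Finset.card ⟨∅, by simp⟩
  simp only [Finset.mem_filter, Finset.mem_powerset] at hQ hmax
  refine ⟨Q, hQ.1, ?_, hQ.2⟩
  have hsub : S ⊆ Q ∪ Q.image (· * γ) ∪ Q.image (· * γ⁻¹) := by
    intro p hp
    by_contra hcon
    simp only [Finset.mem_union, Finset.mem_image, not_or, not_exists, not_and] at hcon
    obtain ⟨⟨h1, h2⟩, h3⟩ := hcon
    have := hmax (insert p Q) ⟨Finset.insert_subset hp hQ.1, ?_⟩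
    · rw [Finset.card_insert_of_notMem h1] at this
      omega
    · intro g hg hgγ
      rw [Finset.mem_insert] at hg hgγ
      rcases hg with rfl | hg <;> rcases hgγ with h | h
      · exact hγ (by simpa using h)
      · exact h3 _ h (by simp)
      · exact h2 _ hg h
      · exact hQ.2 g hg h
  have := Finset.card_le_card hsub
  have h1 := Finset.card_union_le (Q ∪ Q.image (· * γ)) (Q.image (· * γ⁻¹))
  have h2 := Finset.card_union_le Q (Q.image (· * γ))
  have h3 : (Q.image (· * γ)).card ≤ Q.card := Finset.card_image_le
  have h4 : (Q.image (· * γ⁻¹)).card ≤ Q.card := Finset.card_image_le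
  omega

theorem exists_finset_many_returns {G X : Type*} [Group G] [Infinite G] [MulAction G X]
    {U : Set X} [DecidablePred (· ∈ U)] (T : Finset G) (hT : ∀ x : X, ∃ t ∈ T, t • x ∈ U) (k : ℕ) :
    ∃ B : Finset G, B.card ≤ k * T.card ∧ ∀ x : X, k ≤ (B.filter fun f => f • x ∈ U).card := by
  classical
  induction k with
  | zero => exact ⟨∅, by simp, by simp⟩
  | succ k ih =>
    obtain ⟨B, hB, hk⟩ := ih
    obtain ⟨a, ha⟩ := Infinite.exists_notMem_finset (T⁻¹ * B)
    refine ⟨B ∪ T.image (· * a), ?_, fun x => ?_⟩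
    · have h1 := Finset.card_union_le B (T.image (· * a))
      have h2 : (T.image (· * a)).card ≤ T.card := Finset.card_image_le
      rw [add_mul]
      omega
    · obtain ⟨t, ht, htx⟩ := hT (a • x)
      have hnot : t * a ∉ B := fun h =>
        ha (Finset.mem_mul.2 ⟨t⁻¹, Finset.inv_mem_inv ht, t * a, h, by simp⟩)
      have hsub : insert (t * a) (B.filter fun f => f • x ∈ U) ⊆
          (B ∪ T.image (· * a)).filter fun f => f • x ∈ U := by
        intro f hf
        rcases Finset.mem_insert.1 hf with rfl | hf
        · refine Finset.mem_filter.2 ⟨Finset.mem_union_right _ (Finset.mem_image_of_mem _ ht), ?_⟩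
          rwa [mul_smul]
        · rw [Finset.mem_filter] at hf ⊢
          exact ⟨Finset.mem_union_left _ hf.1, hf.2⟩
      have := Finset.card_le_card hsub
      rw [Finset.card_insert_of_notMem (fun h => hnot (Finset.mem_filter.1 h).1)] at this
      have := hk x
      omega

theorem exists_mul_pow_lt_two_pow (t : ℕ) : ∃ l : ℕ, 2 * ((4 * l + 2) * t) ^ 6 < 2 ^ l := by
  have h := tendsto_pow_const_div_const_pow_of_one_lt 6 (show (1 : ℝ) < 2 by norm_num)
  have hpos : (0 : ℝ) < 1 / (2 * (6 * t) ^ 6 + 1) := by positivity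
  obtain ⟨l, hl, hl1⟩ := ((h.eventually (gt_mem_nhds hpos)).and
    (Filter.eventually_ge_atTop 1)).exists
  refine ⟨l, ?_⟩
  rw [div_lt_div_iff₀ (by positivity) (by positivity), one_mul] at hl
  have h1 : 2 * ((4 * l + 2) * t) ^ 6 ≤ 2 * ((6 * l) * t) ^ 6 := by gcongr; omega
  refine lt_of_le_of_lt h1 ?_
  have h2 : (2 * (6 * l * t) ^ 6 : ℝ) < 2 ^ l := by
    have : (0 : ℝ) ≤ (l : ℝ) ^ 6 := by positivity
    nlinarith
  exact_mod_cast h2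

/-- The data of one extension step: `χ` labels the points outside `U`, the points of `U'` are to
stay unlabelled, and the remaining points of `U` are labelled around each marker `m ∈ M`, inside
the window `B • m`, in the order given by `c`. -/
structure MarkerData (G X : Type*) where
  /-- the shape of the windows -/
  B : Finset G
  /-- the unlabelled points before the step -/
  U : Set X
  /-- the points that stay unlabelled -/
  U' : Set X
  /-- the markers -/
  M : Set X
  /-- the labelling before the step -/
  χ : Set X
  /-- the order in which the markers are processed -/
  c : X → ℕ

namespace MarkerData

variable {G X : Type*} [Group G] [MulAction G X] (D : MarkerData G X)

/-- The label of `g • x` if the marker `x` uses the pattern `v` and earlier markers use `φ`. -/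
def TrialLabel (φ : X → Finset G) (v : Finset G) (x : X) (g : G) : Prop :=
  (g • x ∈ D.U ∧ ∃ f ∈ D.B, (f⁻¹ * g) • x ∈ D.M ∧
    (f = g ∧ g ∈ v ∨ D.c ((f⁻¹ * g) • x) < D.c x ∧ f ∈ φ ((f⁻¹ * g) • x))) ∨
  (g • x ∉ D.U ∧ g • x ∈ D.χ)

/-- The label of `g • x` is final once the marker `x` has been processed. -/
def IsDecided (x : X) (g : G) : Prop :=
  g • x ∉ D.U' ∧ (g • x ∈ D.U → ∀ f ∈ D.B, (f⁻¹ * g) • x ∈ D.M →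
    f = g ∨ D.c ((f⁻¹ * g) • x) < D.c x)

/-- The pattern `v` at `x` creates a visible difference between `d.1 • x` and `d.2 • x`. -/
def Distinguishes (φ : X → Finset G) (v : Finset G) (x : X) (d : G × G) : Prop :=
  ∃ f ∈ D.B, D.IsDecided x (f * d.1) ∧ D.IsDecided x (f * d.2) ∧
    ¬ (D.TrialLabel φ v x (f * d.1) ↔ D.TrialLabel φ v x (f * d.2))

open Classical in
/-- At most a fraction `2 ^ (-l)` of the patterns at `x` fails to distinguish `d`. -/
def Handles (φ : X → Finset G) (l : ℕ) (x : X) (d : G × G) : Prop :=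
  (D.B.powerset.filter fun v => ¬ D.Distinguishes φ v x d).card * 2 ^ l ≤ 2 ^ D.B.card

/-- The pattern `v` at `x` distinguishes all pairs in `Δ` that `x` handles. -/
def Admissible (Δ : Finset (G × G)) (l : ℕ) (φ : X → Finset G) (v : Finset G) (x : X) : Prop :=
  ∀ d ∈ Δ, D.Handles φ l x d → D.Distinguishes φ v x d

/-- The labelling obtained from patterns `φ` at all markers. -/
def glue (φ : X → Finset G) : Set X :=
  {u | (u ∈ D.U ∧ ∃ f ∈ D.B, f⁻¹ • u ∈ D.M ∧ f ∈ φ (f⁻¹ • u)) ∨ (u ∉ D.U ∧ u ∈ D.χ)}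

theorem trialLabel_iff_mem_glue {φ : X → Finset G} {x : X} {g : G} (h : D.IsDecided x g) :
    D.TrialLabel φ (φ x) x g ↔ g • x ∈ D.glue φ := by
  unfold TrialLabel glue
  simp only [mem_ofPred_eq, smul_smul]
  refine or_congr (and_congr_right fun hU => exists_congr fun f => and_congr_right fun hf =>
    and_congr_right fun hM => ?_) Iff.rfl
  rcases h.2 hU f hf hM with rfl | hlt
  · simp
  · constructor
    · rintro (⟨rfl, hg⟩ | h)
      · simpa using hg
      · exact h.2
    · exact fun h => Or.inr ⟨hlt, h⟩

theorem trialLabel_congr {φ ψ : X → Finset G} {x : X} (h : ∀ y, D.c y < D.c x → φ y = ψ y)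
    (v : Finset G) :
    D.TrialLabel φ v x = D.TrialLabel ψ v x := by
  funext g
  unfold TrialLabel
  refine propext (or_congr (and_congr_right fun hU => exists_congr fun f =>
    and_congr_right fun hf => and_congr_right fun hM => or_congr Iff.rfl
      (and_congr_right fun hlt => by rw [h _ hlt])) Iff.rfl)

theorem admissible_congr {φ ψ : X → Finset G} {x : X} (h : ∀ y, D.c y < D.c x → φ y = ψ y)
    (Δ : Finset (G × G)) (l : ℕ) (v : Finset G) :
    D.Admissible Δ l φ v x ↔ D.Admissible Δ l ψ v x := by
  have hdist : ∀ v d, D.Distinguishes φ v x d ↔ D.Distinguishes ψ v x d := by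
    simp only [Distinguishes, D.trialLabel_congr h, implies_true]
  have hhandles : ∀ d, D.Handles φ l x d ↔ D.Handles ψ l x d := by
    intro d
    unfold Handles
    congr! 4 with v
    rw [hdist]
  simp only [Admissible, hdist, hhandles]

theorem exists_admissible {Δ : Finset (G × G)} {l : ℕ} (hΔ : Δ.card < 2 ^ l)
    (φ : X → Finset G) (x : X) : ∃ v, D.Admissible Δ l φ v x := by
  classical
  by_contra! hcon
  let bad : G × G → Finset (Finset G) := fun d =>
    D.B.powerset.filter fun v => ¬ D.Distinguishes φ v x d
  have hsub : D.B.powerset ⊆ (Δ.filter fun d => D.Handles φ l x d).biUnion bad := by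
    intro v hv
    have := hcon v
    simp only [Admissible, not_forall] at this
    obtain ⟨d, hd, hh, hn⟩ := this
    exact Finset.mem_biUnion.2 ⟨d, Finset.mem_filter.2 ⟨hd, hh⟩, Finset.mem_filter.2 ⟨hv, hn⟩⟩
  have h1 := (Finset.card_le_card hsub).trans Finset.card_biUnion_le
  rw [Finset.card_powerset] at h1
  have h2 : 2 ^ D.B.card * 2 ^ l ≤ Δ.card * 2 ^ D.B.card := by
    calc 2 ^ D.B.card * 2 ^ l
        ≤ (∑ d ∈ Δ.filter fun d => D.Handles φ l x d, (bad d).card) * 2 ^ l :=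
          Nat.mul_le_mul_right _ h1
      _ = ∑ d ∈ Δ.filter fun d => D.Handles φ l x d, (bad d).card * 2 ^ l :=
          Finset.sum_mul _ _ _
      _ ≤ ∑ d ∈ Δ.filter fun d => D.Handles φ l x d, 2 ^ D.B.card := by
          refine Finset.sum_le_sum fun d hd => ?_
          have := (Finset.mem_filter.1 hd).2
          unfold Handles at this
          convert this
      _ ≤ Δ.card * 2 ^ D.B.card := by
          rw [Finset.sum_const, smul_eq_mul]
          exact Nat.mul_le_mul_right _ (Finset.card_filter_le _ _)
  have h3 : Δ.card * 2 ^ D.B.card < 2 ^ l * 2 ^ D.B.card :=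
    Nat.mul_lt_mul_of_pos_right hΔ (by positivity)
  rw [mul_comm (2 ^ l)] at h3
  omega

section Measurable

variable [Countable G] [MeasurableSpace X] (hBorel : ∀ g : G, Measurable fun x : X => g • x)
  (hU : MeasurableSet D.U) (hU' : MeasurableSet D.U') (hM : MeasurableSet D.M)
  (hχ : MeasurableSet D.χ) (hc : Measurable D.c)

include hBorel hU hM hχ hc in
theorem measurable_trialLabel (e : ℕ → Finset G) {ν : X → ℕ} (hν : Measurable ν)
    (v : Finset G) (g : G) : Measurable fun x => D.TrialLabel (fun x => e (ν x)) v x g := by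
  have hs : ∀ {A : Set X} (g : G), MeasurableSet A → Measurable fun x => g • x ∈ A :=
    fun g hA => measurableSet_setOfPred.1 (hBorel g hA)
  unfold TrialLabel
  refine Measurable.or (Measurable.and (hs g hU) (Measurable.exists fun f =>
    Measurable.and measurable_const (Measurable.and (hs _ hM) (Measurable.or measurable_const
      (Measurable.and ?_ ?_))))) (Measurable.and (Measurable.not (hs g hU)) (hs g hχ))
  · exact measurableSet_setOfPred.1 (measurableSet_lt (hc.comp (hBorel _)) hc)
  · exact (measurable_from_top (f := fun n => f ∈ e n)).comp (hν.comp (hBorel (f⁻¹ * g)))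

include hBorel hU hU' hM hc in
theorem measurable_isDecided (g : G) : Measurable fun x => D.IsDecided x g := by
  have hs : ∀ {A : Set X} (g : G), MeasurableSet A → Measurable fun x => g • x ∈ A :=
    fun g hA => measurableSet_setOfPred.1 (hBorel g hA)
  unfold IsDecided
  refine Measurable.and (Measurable.not (hs g hU')) (Measurable.imp (hs g hU)
    (Measurable.forall fun f => Measurable.imp measurable_const (Measurable.imp (hs _ hM)
      (Measurable.or measurable_const ?_))))
  exact measurableSet_setOfPred.1 (measurableSet_lt (hc.comp (hBorel _)) hc)

include hBorel hU hU' hM hχ hc in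
theorem measurable_distinguishes (e : ℕ → Finset G) {ν : X → ℕ} (hν : Measurable ν)
    (v : Finset G) (d : G × G) :
    Measurable fun x => D.Distinguishes (fun x => e (ν x)) v x d := by
  have h1 := D.measurable_isDecided hBorel hU hU' hM hc
  have h2 := D.measurable_trialLabel hBorel hU hM hχ hc e hν v
  exact Measurable.exists fun f => Measurable.and measurable_const (Measurable.and (h1 _)
    (Measurable.and (h1 _) (Measurable.not (Measurable.iff (h2 _) (h2 _)))))

include hBorel hU hU' hM hχ hc in
theorem measurable_admissible (Δ : Finset (G × G)) (l : ℕ) (e : ℕ → Finset G) {ν : X → ℕ}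
    (hν : Measurable ν) (v : Finset G) :
    Measurable fun x => D.Admissible Δ l (fun x => e (ν x)) v x := by
  classical
  have h := D.measurable_distinguishes hBorel hU hU' hM hχ hc e hν
  refine Measurable.forall fun d => Measurable.imp measurable_const
    (Measurable.imp ?_ (h v d))
  have hcard : Measurable fun x =>
      ∑ v ∈ D.B.powerset, if ¬ D.Distinguishes (fun x => e (ν x)) v x d then 1 else 0 := by
    refine Finset.measurable_sum _ fun v _ => Measurable.ite ?_ measurable_const measurable_const
    exact measurableSet_setOfPred.2 (Measurable.not (h v d))
  have := (measurable_from_top (f := fun n : ℕ => n * 2 ^ l ≤ 2 ^ D.B.card)).comp hcard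
  convert this using 2 with x
  unfold Handles
  rw [Function.comp_apply, ← Finset.card_filter]

include hBorel hU hU' hM hχ hc in
theorem exists_measurable_admissible {Δ : Finset (G × G)} {l : ℕ} (hΔ : Δ.card < 2 ^ l) :
    ∃ φ : X → Finset G, (∀ f, MeasurableSet {x | f ∈ φ x}) ∧
      ∀ x, D.Admissible Δ l φ (φ x) x := by
  classical
  obtain ⟨e, he⟩ := exists_surjective_nat (Finset G)
  have hex : ∀ (ν : X → ℕ) x, ∃ j, D.Admissible Δ l (fun x => e (ν x)) (e j) x := by
    intro ν x
    obtain ⟨v, hv⟩ := D.exists_admissible hΔ (fun x => e (ν x)) x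
    obtain ⟨j, rfl⟩ := he v
    exact ⟨j, hv⟩
  obtain ⟨ν, hν, hfix⟩ := exists_measurable_fixedPoint hc
    (fun ν x => Nat.find (hex ν x))
    (fun ν hν => measurable_find (hex ν) fun j => measurableSet_setOfPred.2
      (D.measurable_admissible hBorel hU hU' hM hχ hc Δ l e hν (e j)))
    (fun ν μ x h => Nat.find_congr' fun {j} => D.admissible_congr
      (fun y hy => congrArg e (h y hy)) Δ l (e j))
  refine ⟨fun x => e (ν x), fun f => ?_, fun x => ?_⟩
  · exact measurableSet_setOfPred.2 ((measurable_from_top (f := fun n => f ∈ e n)).comp hν)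
  · have := Nat.find_spec (hex ν x)
    rw [← hfix x] at this
    exact this

include hBorel hU hM hχ in
theorem measurableSet_glue {φ : X → Finset G} (hφ : ∀ f, MeasurableSet {x | f ∈ φ x}) :
    MeasurableSet (D.glue φ) := by
  have hs : ∀ {A : Set X} (g : G), MeasurableSet A → Measurable fun x => g • x ∈ A :=
    fun g hA => measurableSet_setOfPred.1 (hBorel g hA)
  refine measurableSet_setOfPred.2 (Measurable.or (Measurable.and (measurableSet_setOfPred.1 hU)
    (Measurable.exists fun f => Measurable.and measurable_const (Measurable.and (hs _ hM)
      (hs f⁻¹ (hφ f))))) (Measurable.and (Measurable.not (measurableSet_setOfPred.1 hU))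
        (measurableSet_setOfPred.1 hχ)))

end Measurable

section Counting

variable [DecidableEq G]
  (hfree : ∀ (g : G) (x : X), g • x = x → g = 1)
  (hdisc : ∀ m ∈ D.M, ∀ s ∈ D.B⁻¹ * D.B * (D.B⁻¹ * D.B), s • m ∈ D.M → s • m = m)

include hdisc in
theorem eq_of_smul_eq {m m' : X} (hm : m ∈ D.M) (hm' : m' ∈ D.M) {f f' : G} (hf : f ∈ D.B)
    (hf' : f' ∈ D.B) (h : f • m = f' • m') : m' = m := by
  have hs : (f'⁻¹ * f) • m = m' := by rw [mul_smul, h, inv_smul_smul]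
  rw [← hs]
  refine hdisc m hm _ ?_ (by rwa [hs])
  have h1 : f'⁻¹ * f ∈ D.B⁻¹ * D.B := Finset.mul_mem_mul (Finset.inv_mem_inv hf') hf
  have h2 : f⁻¹ * f ∈ D.B⁻¹ * D.B := Finset.mul_mem_mul (Finset.inv_mem_inv hf) hf
  simpa using Finset.mul_mem_mul h1 h2

include hfree hdisc in
theorem eq_of_mem_window {x : X} (hx : x ∈ D.M) {f g : G} (hg : g ∈ D.B) (hf : f ∈ D.B)
    (h : (f⁻¹ * g) • x ∈ D.M) : f = g := by
  have := D.eq_of_smul_eq hdisc hx h hg hf (by rw [smul_smul, mul_inv_cancel_left])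
  exact inv_mul_eq_one.1 (hfree _ _ this)

include hfree hdisc in
theorem handles_of_subset {φ : X → Finset G} {l : ℕ} {x : X} (hx : x ∈ D.M) {p q : G}
    {Q : Finset G} (hQB : Q ⊆ D.B) (hl : l ≤ Q.card)
    (hQ : ∀ g ∈ Q, g • x ∈ D.U ∧ g • x ∉ D.U')
    (hpartner : ∀ g ∈ Q, ∃ r ∉ Q, D.IsDecided x r ∧
      ∃ f ∈ D.B, (f * p = g ∧ f * q = r) ∨ (f * p = r ∧ f * q = g)) :
    D.Handles φ l x (p, q) := by
  classical
  have hdec : ∀ g ∈ Q, D.IsDecided x g := fun g hg =>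
    ⟨(hQ g hg).2, fun _ f hf hM => Or.inl (D.eq_of_mem_window hfree hdisc hx (hQB hg) hf hM)⟩
  have hlab : ∀ v, ∀ g ∈ Q, (D.TrialLabel φ v x g ↔ g ∈ v) := by
    intro v g hg
    constructor
    · rintro (⟨-, f, hf, hM, h⟩ | h)
      · obtain rfl := D.eq_of_mem_window hfree hdisc hx (hQB hg) hf hM
        simpa using h
      · exact (h.1 (hQ g hg).1).elim
    · exact fun h => Or.inl ⟨(hQ g hg).1, g, hQB hg, by simpa using hx, Or.inl ⟨rfl, h⟩⟩
  have hviol : ∀ g ∈ Q, ∃ r ∉ Q,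
      ∀ w, ¬ D.Distinguishes φ w x (p, q) → (g ∈ w ↔ D.TrialLabel φ w x r) := by
    intro g hg
    obtain ⟨r, hr, hrd, f, hf, h⟩ := hpartner g hg
    refine ⟨r, hr, fun w hw => ?_⟩
    rw [← hlab w g hg]
    by_contra hne
    rcases h with ⟨rfl, rfl⟩ | ⟨rfl, rfl⟩
    · exact hw ⟨f, hf, hdec _ hg, hrd, hne⟩
    · exact hw ⟨f, hf, hrd, hdec _ hg, fun h => hne h.symm⟩
  have := card_filter_powerset_mul_two_pow_le hQB hl
    (fun v => ¬ D.Distinguishes φ v x (p, q)) (by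
      intro v w hv hw hvw
      have hout : ∀ r ∉ Q, (r ∈ v ↔ r ∈ w) := by
        intro r hr
        simpa [hr] using Finset.ext_iff.1 hvw r
      ext g
      by_cases hg : g ∈ Q
      · obtain ⟨r, hr, h⟩ := hviol g hg
        rw [h v hv, h w hw]
        simp only [TrialLabel, hout r hr]
      · exact hout g hg)
  unfold Handles
  convert this

include hfree hdisc in
/-- The pair `(z, γ • z)` is handled either by `z` itself or by the unique marker whose window
meets `B • γ • z`. -/
theorem handles_or_exists_handles {φ : X → Finset G} {l : ℕ} (hl : 0 < l) {z : X}
    (hz : z ∈ D.M) {γ : G} (hγ : γ ≠ 1)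
    (hcol : ∀ x, ∀ s ∈ D.B⁻¹ * D.B, γ⁻¹ * s ≠ 1 → D.c ((γ⁻¹ * s) • x) ≠ D.c x)
    {S : Finset G} (hSB : S ⊆ D.B) (hS : 4 * l ≤ S.card)
    (hSU : ∀ f ∈ S, f • z ∈ D.U ∧ f • z ∉ D.U' ∧ (f * γ) • z ∉ D.U') :
    D.Handles φ l z (1, γ) ∨ ∃ s ∈ D.B⁻¹ * D.B, ∃ m ∈ D.M, (γ⁻¹ * s) • m = z ∧
      D.Handles φ l m (γ⁻¹ * s, s) := by
  classical
  by_cases hbig : 3 * l ≤ (S.filter fun f => D.IsDecided z (f * γ)).card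
  · left
    obtain ⟨Q, hQS, hQ3, hQ⟩ := exists_subset_mul_right_notMem hγ
      (S.filter fun f => D.IsDecided z (f * γ))
    have hQS' : ∀ g ∈ Q, g ∈ S ∧ D.IsDecided z (g * γ) := fun g hg =>
      Finset.mem_filter.1 (hQS hg)
    refine D.handles_of_subset hfree hdisc hz (fun g hg => hSB (hQS' g hg).1) (by omega)
      (fun g hg => ⟨(hSU g (hQS' g hg).1).1, (hSU g (hQS' g hg).1).2.1⟩) fun g hg => ?_
    exact ⟨g * γ, hQ g hg, (hQS' g hg).2, g, hSB (hQS' g hg).1, Or.inl ⟨mul_one g, rfl⟩⟩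
  · right
    have hcard : l ≤ (S.filter fun f => ¬ D.IsDecided z (f * γ)).card := by
      have := Finset.card_filter_add_card_filter_not (s := S)
        (fun f => D.IsDecided z (f * γ))
      omega
    have hlate : ∀ f ∈ S, ¬ D.IsDecided z (f * γ) → (f * γ) • z ∈ D.U ∧ ∃ f' ∈ D.B,
        (f'⁻¹ * (f * γ)) • z ∈ D.M ∧ f' ≠ f * γ ∧
        D.c z ≤ D.c ((f'⁻¹ * (f * γ)) • z) := by
      intro f hf hnd
      unfold IsDecided at hnd
      push Not at hnd
      exact hnd (hSU f hf).2.2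
    obtain ⟨f₀, hf₀⟩ := Finset.card_pos.1 (hl.trans_le hcard)
    obtain ⟨hf₀S, hf₀d⟩ := Finset.mem_filter.1 hf₀
    obtain ⟨-, f₁, hf₁, hmM, hne, hle⟩ := hlate f₀ hf₀S hf₀d
    obtain ⟨m, hm⟩ : ∃ m, m = (f₁⁻¹ * (f₀ * γ)) • z := ⟨_, rfl⟩
    rw [← hm] at hmM hle
    have hsmem : f₀⁻¹ * f₁ ∈ D.B⁻¹ * D.B :=
      Finset.mul_mem_mul (Finset.inv_mem_inv (hSB hf₀S)) hf₁
    obtain ⟨s, hs⟩ : ∃ s, s = f₀⁻¹ * f₁ := ⟨_, rfl⟩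
    rw [← hs] at hsmem
    have hmz : (γ⁻¹ * s) • m = z := by
      rw [hm, hs, smul_smul]
      convert one_smul G z
      group
    have hp1 : γ⁻¹ * s ≠ 1 := by
      rw [hs]
      intro h
      apply hne
      rw [inv_mul_eq_one] at h
      rw [h, mul_inv_cancel_left]
    have hlt : D.c z < D.c m := lt_of_le_of_ne hle (by rw [← hmz]; exact hcol m s hsmem hp1)
    have hzm : z ≠ m := fun h => by rw [h] at hlt; exact lt_irrefl _ hlt
    have hsm : s • m = γ • z := by rw [← hmz, smul_smul, mul_inv_cancel_left]
    have hwin : ∀ f ∈ S, ¬ D.IsDecided z (f * γ) → f * s ∈ D.B := by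
      intro f hf hnd
      obtain ⟨-, f', hf', hM', -, -⟩ := hlate f hf hnd
      have heq : (f'⁻¹ * (f * s)) • m = (f'⁻¹ * (f * γ)) • z := by
        simp only [mul_smul, hsm]
      have hmem : f'⁻¹ * (f * s) ∈ D.B⁻¹ * D.B * (D.B⁻¹ * D.B) := by
        rw [hs]
        have h1 : f'⁻¹ * f ∈ D.B⁻¹ * D.B :=
          Finset.mul_mem_mul (Finset.inv_mem_inv hf') (hSB hf)
        have h2 := Finset.mul_mem_mul h1 (hs ▸ hsmem)
        rwa [mul_assoc f'⁻¹ f] at h2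
      have := hfree _ _ (hdisc m hmM _ hmem (by rwa [heq]))
      rw [inv_mul_eq_one] at this
      rwa [← this]
    refine ⟨s, hsmem, m, hmM, hmz, ?_⟩
    refine D.handles_of_subset hfree hdisc hmM
      (Q := (S.filter fun f => ¬ D.IsDecided z (f * γ)).image (· * s)) ?_ ?_ ?_ ?_
    · intro g hg
      obtain ⟨f, hf, rfl⟩ := Finset.mem_image.1 hg
      exact hwin f (Finset.mem_filter.1 hf).1 (Finset.mem_filter.1 hf).2
    · rwa [Finset.card_image_of_injective _ (mul_left_injective s)]
    · intro g hg
      obtain ⟨f, hf, rfl⟩ := Finset.mem_image.1 hg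
      obtain ⟨hfS, hnd⟩ := Finset.mem_filter.1 hf
      have heq : (f * s) • m = (f * γ) • z := by simp only [mul_smul, hsm]
      rw [heq]
      exact ⟨(hlate f hfS hnd).1, (hSU f hfS).2.2⟩
    · intro g hg
      obtain ⟨f, hf, rfl⟩ := Finset.mem_image.1 hg
      obtain ⟨hfS, hnd⟩ := Finset.mem_filter.1 hf
      have hfz : (f * (γ⁻¹ * s)) • m = f • z := by rw [mul_smul, hmz]
      refine ⟨f * (γ⁻¹ * s), fun hmem => ?_, ⟨?_, fun _ f' hf' hM' => Or.inr ?_⟩,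
        f, hSB hfS, Or.inr ⟨rfl, rfl⟩⟩
      · obtain ⟨f', hf', hff'⟩ := Finset.mem_image.1 hmem
        have hB' := hwin f' (Finset.mem_filter.1 hf').1 (Finset.mem_filter.1 hf').2
        refine hzm (D.eq_of_smul_eq hdisc hmM hz hB' (hSB hfS) ?_)
        rw [show f' * s = f * (γ⁻¹ * s) from hff', hfz]
      · rw [hfz]
        exact (hSU f hfS).2.1
      · have : (f'⁻¹ * (f * (γ⁻¹ * s))) • m = z :=
          D.eq_of_smul_eq hdisc hz hM' (hSB hfS) hf' (by rw [smul_smul, mul_inv_cancel_left, hfz])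
        rw [this]
        exact hlt

end Counting

end MarkerData

/-- A set that meets every `T`-window for some finite `T`. -/
def IsSyndeticSet (G : Type*) {X : Type*} [SMul G X] (U : Set X) : Prop :=
  ∃ T : Finset G, ∀ x : X, ∃ t ∈ T, t • x ∈ U

section FreeAction

variable {G X : Type*} [Group G] [Countable G] [MeasurableSpace X]
  [StandardBorelSpace X] [MulAction G X] (hBorel : ∀ g : G, Measurable fun x : X => g • x)
  (hfree : ∀ (g : G) (x : X), g • x = x → g = 1)

include hBorel hfree in
theorem exists_sparse_syndetic_subset (B : Finset G) (hB : B.Nonempty) {U : Set X}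
    (hU : MeasurableSet U) (hUsyn : IsSyndeticSet G U) :
    ∃ U' ⊆ U, MeasurableSet U' ∧ IsSyndeticSet G U' ∧
      ∀ x : X, ∀ f ∈ B, ∀ f' ∈ B, f • x ∈ U' → f' • x ∈ U' → f = f' := by
  classical
  obtain ⟨b, hb⟩ := hB
  obtain ⟨T, hT⟩ := hUsyn
  obtain ⟨U', hsub, hU', hdisc, hmax⟩ := exists_measurable_maximal_discrete hBorel hfree
    (B * B⁻¹) (fun s hs => by
      obtain ⟨a, ha, c, hc, rfl⟩ := Finset.mem_mul.1 hs
      rw [mul_inv_rev]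
      exact Finset.mul_mem_mul (Finset.mem_inv'.1 hc) (Finset.inv_mem_inv ha))
    (by simpa using Finset.mul_mem_mul hb (Finset.inv_mem_inv hb)) hU
  refine ⟨U', hsub, hU', ⟨B * B⁻¹ * T, fun x => ?_⟩, fun x f hf f' hf' h h' => ?_⟩
  · obtain ⟨t, ht, htx⟩ := hT x
    obtain ⟨s, hs, hsx⟩ := hmax _ htx
    exact ⟨s * t, Finset.mul_mem_mul hs ht, by rwa [mul_smul]⟩
  · have heq : (f * f'⁻¹) • f' • x = f • x := by rw [smul_smul, inv_mul_cancel_right]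
    have := hdisc _ h' (f * f'⁻¹) (Finset.mul_mem_mul hf (Finset.inv_mem_inv hf'))
      (by rwa [heq])
    exact mul_inv_eq_one.1 (hfree _ _ this)

variable [Infinite G]

include hBorel hfree in
/-- A partial labelling with syndetic complement `U` extends to one, still with syndetic
complement, that distinguishes `x` from `g • x` for every `x`. -/
theorem exists_distinguishing_extension {g : G} (hg : g ≠ 1) {U χ : Set X}
    (hU : MeasurableSet U) (hχ : MeasurableSet χ) (hUsyn : IsSyndeticSet G U) :
    ∃ U' χ' : Set X, MeasurableSet U' ∧ MeasurableSet χ' ∧ U' ⊆ U ∧ IsSyndeticSet G U' ∧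
      (∀ u ∉ U, (u ∈ χ' ↔ u ∈ χ)) ∧
      ∀ x : X, ∃ k : G, k • x ∉ U' ∧ (k * g) • x ∉ U' ∧
        ¬ (k • x ∈ χ' ↔ (k * g) • x ∈ χ') := by
  classical
  rcases isEmpty_or_nonempty X with hX | ⟨⟨x₀⟩⟩
  · exact ⟨U, χ, hU, hχ, subset_rfl, hUsyn, fun _ _ => Iff.rfl, fun x => (hX.false x).elim⟩
  obtain ⟨T, hT⟩ := hUsyn
  obtain ⟨l', hl'⟩ := exists_mul_pow_lt_two_pow T.card
  obtain ⟨l, hl0, hl⟩ : ∃ l, 0 < l ∧ 2 * ((4 * l + 2) * T.card) ^ 6 < 2 ^ l := by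
    refine ⟨l', Nat.pos_of_ne_zero ?_, hl'⟩
    rintro rfl
    obtain ⟨t, ht, -⟩ := hT x₀
    have : 0 < T.card := Finset.card_pos.2 ⟨t, ht⟩
    have : 1 ≤ ((4 * 0 + 2) * T.card) ^ 6 := Nat.one_le_pow _ _ (by omega)
    omega
  obtain ⟨B, hBcard, hBret⟩ := exists_finset_many_returns T hT (4 * l + 2)
  have hBpos : 0 < B.card := by
    have := hBret x₀
    have := Finset.card_filter_le B fun f => f • x₀ ∈ U
    omega
  obtain ⟨b, hb⟩ := Finset.card_pos.1 hBpos
  obtain ⟨U', hU'U, hU', hU'syn, hsparse⟩ :=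
    exists_sparse_syndetic_subset hBorel hfree B ⟨b, hb⟩ hU ⟨T, hT⟩
  obtain ⟨W, hW⟩ : ∃ W, W = B⁻¹ * B * (B⁻¹ * B) := ⟨_, rfl⟩
  have h1B : (1 : G) ∈ B⁻¹ * B := by
    simpa using Finset.mul_mem_mul (Finset.inv_mem_inv hb) hb
  have hBinv : (B⁻¹ * B)⁻¹ = B⁻¹ * B := by rw [mul_inv_rev, inv_inv]
  obtain ⟨M, -, hM, hdisc, hmax⟩ := exists_measurable_maximal_discrete hBorel hfree W
    (fun s hs => by
      rw [← Finset.mem_inv', hW, mul_inv_rev, hBinv, ← hW]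
      exact hs)
    (by simpa [hW] using Finset.mul_mem_mul h1B h1B) (MeasurableSet.univ (α := X))
  let γ : G → G := fun h => h * g * h⁻¹
  obtain ⟨Δ, hΔ⟩ : ∃ Δ : Finset (G × G), Δ = W.image (fun h => (1, γ h)) ∪
    (W ×ˢ (B⁻¹ * B)).image fun p => ((γ p.1)⁻¹ * p.2, p.2) := ⟨_, rfl⟩
  have hΔcard : Δ.card < 2 ^ l := by
    have h1 : (B⁻¹ * B).card ≤ B.card ^ 2 := by
      have := Finset.card_mul_le (s := B⁻¹) (t := B)
      rwa [Finset.card_inv, ← sq] at this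
    have h2 : W.card ≤ B.card ^ 4 := by
      have := Finset.card_mul_le (s := B⁻¹ * B) (t := B⁻¹ * B)
      rw [← hW] at this
      calc W.card ≤ _ := this
        _ ≤ B.card ^ 2 * B.card ^ 2 := Nat.mul_le_mul h1 h1
        _ = B.card ^ 4 := by ring
    have h3 : Δ.card ≤ W.card + W.card * (B⁻¹ * B).card := by
      rw [hΔ, ← Finset.card_product]
      exact (Finset.card_union_le _ _).trans
        (Nat.add_le_add Finset.card_image_le Finset.card_image_le)
    calc Δ.card ≤ B.card ^ 4 + B.card ^ 4 * B.card ^ 2 :=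
          h3.trans (Nat.add_le_add h2 (Nat.mul_le_mul h2 h1))
      _ ≤ B.card ^ 6 + B.card ^ 6 := by
          refine Nat.add_le_add (Nat.pow_le_pow_right hBpos (by norm_num)) ?_
          rw [← pow_add]
      _ = 2 * B.card ^ 6 := by ring
      _ ≤ 2 * ((4 * l + 2) * T.card) ^ 6 := by gcongr
      _ < 2 ^ l := hl
  obtain ⟨c, hc, hcol⟩ :=
    exists_measurable_separating_coloring hBorel hfree (Δ.image Prod.fst)
  let D : MarkerData G X := ⟨B, U, U', M, χ, c⟩
  obtain ⟨φ, hφ, hadm⟩ :=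
    D.exists_measurable_admissible hBorel hU hU' hM hχ hc hΔcard
  refine ⟨U', D.glue φ, hU', D.measurableSet_glue hBorel hU hM hχ hφ, hU'U, hU'syn, ?_, ?_⟩
  · intro u hu
    have hu' : u ∉ D.U := hu
    simp [MarkerData.glue, hu', D]
  · intro x
    obtain ⟨h, hh, hz⟩ := hmax x (mem_univ x)
    obtain ⟨z, hzdef⟩ : ∃ z, z = h • x := ⟨_, rfl⟩
    rw [← hzdef] at hz
    have hγ : γ h ≠ 1 := fun h1 => hg (by simpa [γ] using h1)
    suffices hsuff : ∃ f ∈ B, f • z ∉ U' ∧ (f * γ h) • z ∉ U' ∧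
        ¬ (f • z ∈ D.glue φ ↔ (f * γ h) • z ∈ D.glue φ) by
      obtain ⟨f, -, hf⟩ := hsuff
      have h1 : f • z = (f * h) • x := by rw [hzdef, smul_smul]
      have h2 : (f * γ h) • z = (f * h * g) • x := by
        rw [hzdef, smul_smul]
        simp only [γ]
        congr 1
        group
      rw [h1, h2] at hf
      exact ⟨f * h, hf⟩
    have key : ∀ y p q, (p, q) ∈ Δ → D.Handles φ l y (p, q) → p • y = z → q • y = γ h • z →
        ∃ f ∈ B, f • z ∉ U' ∧ (f * γ h) • z ∉ U' ∧
          ¬ (f • z ∈ D.glue φ ↔ (f * γ h) • z ∈ D.glue φ) := by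
      intro y p q hpq hhand hp hq
      obtain ⟨f, hf, hd1, hd2, hne⟩ := hadm y _ hpq hhand
      rw [D.trialLabel_iff_mem_glue hd1, D.trialLabel_iff_mem_glue hd2] at hne
      have h1 : (f * p) • y = f • z := by rw [mul_smul, hp]
      have h2 : (f * q) • y = (f * γ h) • z := by rw [mul_smul, hq, mul_smul f (γ h) z]
      have hd1' := hd1.1
      have hd2' := hd2.1
      simp only [h1, h2] at hne hd1' hd2'
      exact ⟨f, hf, hd1', hd2', hne⟩
    have hpair : ∀ s ∈ B⁻¹ * B, ((γ h)⁻¹ * s, s) ∈ Δ := fun s hs => by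
      rw [hΔ]
      exact Finset.mem_union_right _
        (Finset.mem_image.2 ⟨(h, s), Finset.mem_product.2 ⟨hh, hs⟩, rfl⟩)
    let S : Finset G := B.filter fun f => f • z ∈ U ∧ f • z ∉ U' ∧ (f * γ h) • z ∉ U'
    have hS : 4 * l ≤ S.card := by
      have hsub : (B.filter fun f => f • z ∈ U) ⊆
          S ∪ (B.filter fun f => f • z ∈ U') ∪ (B.filter fun f => f • γ h • z ∈ U') := by
        intro f hf
        simp only [S, Finset.mem_union, Finset.mem_filter, mul_smul] at hf ⊢
        tauto
      have hone : ∀ y : X, (B.filter fun f => f • y ∈ U').card ≤ 1 := by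
        intro y
        refine Finset.card_le_one.2 fun f hf f' hf' => ?_
        rw [Finset.mem_filter] at hf hf'
        exact hsparse y f hf.1 f' hf'.1 hf.2 hf'.2
      have h1 := Finset.card_le_card hsub
      have h2 := Finset.card_union_le (S ∪ (B.filter fun f => f • z ∈ U'))
        (B.filter fun f => f • γ h • z ∈ U')
      have h3 := Finset.card_union_le S (B.filter fun f => f • z ∈ U')
      have h4 := hone z
      have h5 := hone (γ h • z)
      have h6 := hBret z
      omega
    rcases D.handles_or_exists_handles (φ := φ) hfree (by rw [hW] at hdisc; exact hdisc) hl0 hz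
      hγ (fun y s hs hne => hcol y _ (Finset.mem_image.2 ⟨_, hpair s hs, rfl⟩) hne)
      (Finset.filter_subset _ _) hS (fun f hf => (Finset.mem_filter.1 hf).2) with
      hhand | ⟨s, hs, m, -, hmz, hhand⟩
    · refine key z 1 (γ h) ?_ hhand (one_smul G z) rfl
      rw [hΔ]
      exact Finset.mem_union_left _ (Finset.mem_image_of_mem (fun h => (1, γ h)) hh)
    · refine key m _ s (hpair s hs) hhand hmz ?_
      rw [← hmz, smul_smul, mul_inv_cancel_left]

include hBorel hfree in
/-- There is a Borel set separating any two distinct points of an orbit by a translation. -/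
theorem exists_measurable_orbit_separating_set :
    ∃ A : Set X, MeasurableSet A ∧ ∀ g : G, g ≠ 1 → ∀ x : X, ∃ k : G,
      ¬ (k • x ∈ A ↔ (k * g) • x ∈ A) := by
  let State := {p : Set X × Set X //
    MeasurableSet p.1 ∧ MeasurableSet p.2 ∧ IsSyndeticSet G p.1}
  have hstep : ∀ (g : G) (p : State), ∃ q : State, q.1.1 ⊆ p.1.1 ∧
      (∀ u ∉ p.1.1, (u ∈ q.1.2 ↔ u ∈ p.1.2)) ∧ (g ≠ 1 → ∀ x : X, ∃ k : G,
        k • x ∉ q.1.1 ∧ (k * g) • x ∉ q.1.1 ∧ ¬ (k • x ∈ q.1.2 ↔ (k * g) • x ∈ q.1.2)) := by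
    intro g p
    by_cases hg : g = 1
    · exact ⟨p, subset_rfl, fun _ _ => Iff.rfl, fun h => (h hg).elim⟩
    · obtain ⟨U', χ', hU', hχ', hsub, hsyn, hagree, hdist⟩ :=
        exists_distinguishing_extension hBorel hfree hg p.2.1 p.2.2.1 p.2.2.2
      exact ⟨⟨(U', χ'), hU', hχ', hsyn⟩, hsub, hagree, fun _ => hdist⟩
  choose next hsub hagree hdist using hstep
  obtain ⟨e, he⟩ := exists_surjective_nat G
  let start : State := ⟨(univ, ∅), MeasurableSet.univ, MeasurableSet.empty,
    {1}, fun x => ⟨1, by simp, mem_univ _⟩⟩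
  let s : ℕ → State := fun n => Nat.rec start (fun n p => next (e n) p) n
  have hs : ∀ n, s (n + 1) = next (e n) (s n) := fun n => rfl
  have hmono : ∀ m n, m ≤ n → ∀ u ∉ (s m).1.1, u ∉ (s n).1.1 ∧
      (u ∈ (s n).1.2 ↔ u ∈ (s m).1.2) := by
    intro m n hmn u hu
    induction n, hmn using Nat.le_induction with
    | base => exact ⟨hu, Iff.rfl⟩
    | succ n _ ih =>
      rw [hs]
      exact ⟨fun h => ih.1 (hsub _ _ h), (hagree _ _ u ih.1).trans ih.2⟩
  have hlim : ∀ n, ∀ u ∉ (s n).1.1, (u ∈ ⋃ m, (s m).1.2 \ (s m).1.1) ↔ u ∈ (s n).1.2 := by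
    intro n u hu
    refine mem_iUnion.trans ⟨fun ⟨m, hm, hmU⟩ => ?_, fun h => ⟨n, h, hu⟩⟩
    rcases le_total m n with h | h
    · exact (hmono m n h u hmU).2.2 hm
    · exact (hmono n m h u hu).2.1 hm
  refine ⟨⋃ m, (s m).1.2 \ (s m).1.1,
    MeasurableSet.iUnion fun m => (s m).2.2.1.diff (s m).2.1, fun g hg x => ?_⟩
  obtain ⟨n, rfl⟩ := he g
  obtain ⟨k, h1, h2, h3⟩ := hdist (e n) (s n) hg x
  exact ⟨k, by rwa [hlim (n + 1) _ h1, hlim (n + 1) _ h2]⟩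

include hBorel hfree in
/-- Every free Borel action of `G` admits an equivariant Borel map to the free part of the
2-shift. -/
theorem exists_measurable_equivariant_freePart :
    ∃ f : X → (FreePart G : Set (G → Bool)), Measurable f ∧
      ∀ (g : G) (x : X), (f (g • x) : G → Bool) = shift g (f x) := by
  classical
  obtain ⟨A, hA, hsep⟩ := exists_measurable_orbit_separating_set hBorel hfree
  have hmem : ∀ x : X, (fun h : G => decide (h⁻¹ • x ∈ A)) ∈ FreePart G := by
    intro x g hg heq
    obtain ⟨k, hk⟩ := hsep g hg x
    have := congrFun heq k⁻¹
    simp only [shift, mul_inv_rev, inv_inv, decide_eq_decide] at this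
    exact hk this.symm
  refine ⟨fun x => ⟨_, hmem x⟩, Measurable.subtype_mk (measurable_pi_iff.2 fun h => ?_),
    fun g x => funext fun h => ?_⟩
  · exact measurable_to_bool (by
      convert hBorel h⁻¹ hA using 1
      ext x
      simp)
  · simp [shift, mul_smul]

end FreeAction

/-- Corollary 2.3: if the orbit equivalence relation `F(G,2)` of `G ↷ Free(2^G)` is Borel
`K`-structurable, then so is the orbit equivalence relation of every free Borel action of
`G` on a standard Borel space. -/
theorem structurable_of_structurable_shift
    {G : Type u} [Group G] [Countable G] [Infinite G]
    {I : Type} [Countable I] (n : I → ℕ)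
    (K : (α : Type u) → ((i : I) → (Fin (n i) → α) → Prop) → Prop)
    (hKiso : ∀ (α β : Type u)
      (Rα : (i : I) → (Fin (n i) → α) → Prop) (Rβ : (i : I) → (Fin (n i) → β) → Prop)
      (e : α ≃ β), (∀ i t, Rα i t ↔ Rβ i (fun j => e (t j))) → (K α Rα ↔ K β Rβ))
    (hF2 : BorelStructurable n K
      (fun w z : (FreePart G : Set (G → Bool)) => ∃ g : G, shift g (w : G → Bool) = z))
    {X : Type u} [MeasurableSpace X] [StandardBorelSpace X] [MulAction G X]
    (hBorel : ∀ g : G, Measurable fun x : X => g • x)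
    (hfree : ∀ (g : G) (x : X), g • x = x → g = 1) :
    BorelStructurable n K (fun x x' : X => ∃ g : G, g • x = x') := by
  obtain ⟨f, hf, hequiv⟩ := exists_measurable_equivariant_freePart hBorel hfree
  obtain ⟨Q, hQ, -, hK⟩ := hF2
  refine ⟨fun i => {t | (∀ j k, ∃ g : G, g • t j = t k) ∧ (fun j => f (t j)) ∈ Q i},
    fun i => ?_, fun i t ht => ht.1, fun x => ?_⟩
  · refine measurableSet_setOfPred.2 (Measurable.and ?_ ?_)
    · refine Measurable.forall fun j => Measurable.forall fun k => Measurable.exists fun g => ?_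
      exact measurableSet_setOfPred.1 (measurableSet_eq_fun
        ((hBorel g).comp (measurable_pi_apply j)) (measurable_pi_apply k))
    · have : Measurable fun (t : Fin (n i) → X) j => f (t j) :=
        measurable_pi_iff.2 fun j => hf.comp (measurable_pi_apply j)
      exact measurableSet_setOfPred.1 (this (hQ i))
  · have hinj : ∀ g h : G, f (g • x) = f (h • x) → g • x = h • x := by
      intro g h heq
      by_contra hne
      have hgh : h⁻¹ * g ≠ 1 := fun h1 => hne (by rw [inv_mul_eq_one.1 h1])
      refine (f x).2 _ hgh ?_
      rw [← hequiv, mul_smul, hequiv, heq, ← hequiv, inv_smul_smul]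
    let e : {y : X // ∃ g : G, g • x = y} ≃
        {w : (FreePart G : Set (G → Bool)) // ∃ g : G, shift g (f x : G → Bool) = w} :=
      Equiv.ofBijective
        (fun y => ⟨f y, y.2.imp fun g hg => by rw [← hg, hequiv]⟩) (by
          constructor
          · rintro ⟨_, g, rfl⟩ ⟨_, h, rfl⟩ heq
            exact Subtype.ext (hinj g h (congrArg Subtype.val heq))
          · rintro ⟨w, g, hg⟩
            exact ⟨⟨g • x, g, rfl⟩, Subtype.ext (Subtype.ext ((hequiv g x).trans hg))⟩)
    refine (hKiso _ _ _ _ e fun i t => ?_).2 (hK (f x))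
    refine and_iff_right fun j k => ?_
    obtain ⟨g, hg⟩ := (t j).2
    obtain ⟨h, hh⟩ := (t k).2
    refine ⟨h * g⁻¹, ?_⟩
    dsimp only
    rw [← hg, ← hh, smul_smul, inv_mul_cancel_right]
end

section
/- Let G be a countably infinite discrete group and let I be an ideal on Free(2^G). Assume that every nonempty perfect set P ⊆ K(Free(2^G)) consisting of pairwise disjoint G-invariant compact subsets of Free(2^G) satisfies P ∩ I ≠ ∅. Then there exists a compact G-invariant set K ⊆ Free(2^G) with K ∈ I such that for every free Borel action G ↷ X on a standard Borel space there exists a G-equivariant class-bijective Borel map f : X → K. -/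
open MeasureTheory Set TopologicalSpace Metric

universe v

/-- A (compatible) metric on `Bool`, inducing its (discrete) topology. -/
noncomputable instance : MetricSpace Bool := by
  classical
  let m : MetricSpace Bool := MetricSpace.induced (fun b : Bool => (cond b 1 0 : ℝ))
    (fun a b h => by cases a <;> cases b <;> simp_all) inferInstance
  refine m.replaceTopology ?_
  rw [(inferInstance : DiscreteTopology Bool).eq_bot]
  refine (eq_bot_of_singletons_open fun b => ?_).symm
  rw [@Metric.isOpen_singleton_iff Bool m.toPseudoMetricSpace b]
  refine ⟨1/2, by norm_num, fun y hy => ?_⟩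
  have : dist (cond y 1 0 : ℝ) (cond b 1 0 : ℝ) < 1/2 := hy
  cases b <;> cases y <;> simp_all [Real.dist_eq] <;> norm_num at this

/-- A metric on `2^G` compatible with the product topology, so that the hyperspace
`K(Free(2^G))` of compact subsets of the free part carries the Vietoris (= Hausdorff
metric) topology. -/
noncomputable instance piBoolMetric {G : Type*} [Encodable G] : MetricSpace (G → Bool) :=
  (PiCountable.metricSpace : MetricSpace (G → Bool))

section PerfectFamily

open Filter Topology

theorem exists_ne_mem_of_mem_nhds_cantor (a : ℕ → Bool) {U : Set (ℕ → Bool)} (hU : U ∈ 𝓝 a) :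
    ∃ b ∈ U, b ≠ a := by
  have h : Tendsto (fun n => Function.update a n (!a n)) atTop (𝓝 a) := by
    rw [tendsto_pi_nhds]
    intro i
    refine tendsto_const_nhds.congr' ?_
    filter_upwards [eventually_gt_atTop i] with n hn
    rw [Function.update_of_ne hn.ne]
  obtain ⟨n, hn⟩ := (h.eventually hU).exists
  refine ⟨_, hn, fun he => ?_⟩
  simpa using congrFun he n

theorem perfect_range_of_continuous_injective {Y : Type*} [TopologicalSpace Y] [T2Space Y]
    {f : (ℕ → Bool) → Y} (hf : Continuous f) (hinj : Function.Injective f) :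
    Perfect (range f) := by
  refine ⟨(isCompact_range hf).isClosed, preperfect_iff_nhds.2 ?_⟩
  rintro _ ⟨a, rfl⟩ U hU
  obtain ⟨b, hb, hne⟩ := exists_ne_mem_of_mem_nhds_cantor a (hf.continuousAt hU)
  exact ⟨f b, ⟨hb, b, rfl⟩, hinj.ne hne⟩

/-- An injective Borel map from the Cantor space to a second countable Hausdorff space has a
nonempty perfect set inside its range. -/
theorem exists_perfect_subset_range_of_measurable {Y : Type*} [TopologicalSpace Y] [T2Space Y]
    [SecondCountableTopology Y] [MeasurableSpace Y] [OpensMeasurableSpace Y]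
    {f : (ℕ → Bool) → Y} (hf : Measurable f) (hinj : Function.Injective f) :
    ∃ P : Set Y, P.Nonempty ∧ Perfect P ∧ P ⊆ range f := by
  obtain ⟨t', -, hcont, hpol⟩ := hf.exists_continuous
  have hunc : ¬ (univ : Set (ℕ → Bool)).Countable := by
    rw [countable_univ_iff, ← Cardinal.mk_le_aleph0_iff, not_le]
    simpa using Cardinal.cantor Cardinal.aleph0
  obtain ⟨γ, -, hγ, hγi⟩ :=
    @IsClosed.exists_nat_bool_injection_of_not_countable _ t' hpol univ
      (@isClosed_univ _ t') hunc
  have hc : @Continuous _ _ Pi.topologicalSpace _ (f ∘ γ) :=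
    @Continuous.comp _ _ _ Pi.topologicalSpace t' _ γ f hcont hγ
  exact ⟨range (f ∘ γ), range_nonempty _,
    perfect_range_of_continuous_injective hc (hinj.comp hγi), range_comp_subset_range _ _⟩

/-- A closed family of nonempty pairwise disjoint sections over the Cantor space contains a
perfect set of sections in the hyperspace. -/
theorem exists_perfect_subset_sections {Z : Type*} [TopologicalSpace Z] [CompactSpace Z]
    [MetrizableSpace Z] (A : Set Z) (E : (ℕ → Bool) → Set Z)
    (hne : ∀ α, (E α).Nonempty) (hA : ∀ α, E α ⊆ A)
    (hcl : IsClosed {p : (ℕ → Bool) × Z | p.2 ∈ E p.1})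
    (hdisj : ∀ α β, α ≠ β → Disjoint (E α) (E β)) :
    ∃ P : Set (NonemptyCompacts A), P.Nonempty ∧ Perfect P ∧
      ∀ C ∈ P, ∃ α, Subtype.val '' (C : Set A) = E α := by
  let := metrizableSpaceMetric Z
  have hcomp : ∀ α, IsCompact (E α) := fun α =>
    (hcl.preimage (f := fun z => (α, z)) (by fun_prop)).isCompact
  have hval : ∀ α, Subtype.val '' (Subtype.val ⁻¹' E α : Set A) = E α := fun α => by
    rw [Subtype.image_preimage_coe, inter_eq_right]
    exact hA α
  let S : (ℕ → Bool) → NonemptyCompacts A := fun α =>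
    { carrier := Subtype.val ⁻¹' E α
      isCompact' := by rw [Subtype.isCompact_iff, hval]; exact hcomp α
      nonempty' := by
        obtain ⟨z, hz⟩ := hne α
        exact ⟨⟨z, hA α hz⟩, hz⟩ }
  have hS : ∀ α, (S α : Set A) = Subtype.val ⁻¹' E α := fun α => rfl
  have hinj : Function.Injective S := by
    intro α β h
    by_contra hab
    obtain ⟨z, hz⟩ := hne α
    have h1 : E α = E β := by rw [← hval α, ← hval β, ← hS, ← hS, h]
    exact (hdisj α β hab).le_bot ⟨hz, h1 ▸ hz⟩
  have hhit : ∀ F : Set Z, IsClosed F → IsClosed {α | (E α ∩ F).Nonempty} := by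
    intro F hF
    have : {α | (E α ∩ F).Nonempty} =
        Prod.fst '' ({p : (ℕ → Bool) × Z | p.2 ∈ E p.1} ∩ Prod.snd ⁻¹' F) := by
      ext α
      constructor
      · rintro ⟨z, hz⟩
        exact ⟨(α, z), hz, rfl⟩
      · rintro ⟨⟨_, z⟩, hz, rfl⟩
        exact ⟨z, hz⟩
    rw [this]
    exact ((hcl.inter (hF.preimage continuous_snd)).isCompact.image continuous_fst).isClosed
  let : MeasurableSpace (NonemptyCompacts A) := borel _
  have : BorelSpace (NonemptyCompacts A) := ⟨rfl⟩
  have hmeas : Measurable S := by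
    have hb : (NonemptyCompacts.topology : TopologicalSpace (NonemptyCompacts A)) =
        .induced (fun C => (C : Set A)) (.vietoris A) := rfl
    rw [TopologicalSpace.vietoris, induced_generateFrom_eq] at hb
    have hgen := borel_eq_generateFrom_of_subbasis hb
    have : @Measurable _ _ _ (borel (NonemptyCompacts A)) S := by
      rw [hgen]
      refine measurable_generateFrom ?_
      rintro _ ⟨_, ⟨U, hU, rfl⟩ | ⟨U, hU, rfl⟩, rfl⟩
      · obtain ⟨V, hV, rfl⟩ := isOpen_induced_iff.1 hU
        have : S ⁻¹' ((fun C : NonemptyCompacts A => (C : Set A)) ⁻¹'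
            (Subtype.val ⁻¹' V).powerset) = {α | (E α ∩ Vᶜ).Nonempty}ᶜ := by
          ext α
          simp only [mem_preimage, mem_powerset_iff, hS, mem_compl_iff, mem_ofPred_eq,
            not_nonempty_iff_eq_empty, ← disjoint_iff_inter_eq_empty,
            disjoint_compl_right_iff_subset]
          constructor
          · intro h z hz
            exact h (a := ⟨z, hA α hz⟩) hz
          · intro h z hz
            exact h hz
        exact this ▸ (hhit _ hV.isClosed_compl).measurableSet.compl
      · obtain ⟨V, hV, rfl⟩ := isOpen_induced_iff.1 hU
        obtain ⟨F, hF, -, hFV, -⟩ := hV.exists_iUnion_isClosed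
        have : S ⁻¹' ((fun C : NonemptyCompacts A => (C : Set A)) ⁻¹'
            {s | (s ∩ (Subtype.val ⁻¹' V)).Nonempty}) = ⋃ n, {α | (E α ∩ F n).Nonempty} := by
          ext α
          simp only [mem_preimage, mem_ofPred_eq, hS, mem_iUnion, ← hFV]
          constructor
          · rintro ⟨z, hz, hz'⟩
            obtain ⟨n, hn⟩ := mem_iUnion.1 hz'
            exact ⟨n, z, hz, hn⟩
          · rintro ⟨n, z, hz, hn⟩
            exact ⟨⟨z, hA α hz⟩, hz, mem_iUnion.2 ⟨n, hn⟩⟩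
        exact this ▸ MeasurableSet.iUnion fun n => (hhit _ (hF n)).measurableSet
    exact this
  have : SecondCountableTopology Z := inferInstance
  obtain ⟨P, hP, hPp, hPS⟩ := exists_perfect_subset_range_of_measurable hmeas hinj
  refine ⟨P, hP, hPp, fun C hC => ?_⟩
  obtain ⟨α, rfl⟩ := hPS hC
  exact ⟨α, hval α⟩

end PerfectFamily

section BorelMarkers

variable {G : Type*} [Group G] {X : Type*} [MeasurableSpace X] [StandardBorelSpace X]
  [MulAction G X]

theorem exists_measurable_cover_of_free (hm : ∀ g : G, Measurable fun x : X => g • x)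
    (hfree : ∀ (g : G) (x : X), g • x = x → g = 1) (Q : Finset G) :
    ∃ A : ℕ → Set X, (∀ n, MeasurableSet (A n)) ∧ (∀ x, ∃ n, x ∈ A n) ∧
      ∀ n, ∀ x ∈ A n, ∀ q ∈ Q, q ≠ 1 → q • x ∉ A n := by
  obtain ⟨f, hf, hinj⟩ := MeasurableSpace.measurable_injection_nat_bool_of_countablySeparated X
  obtain ⟨e, he⟩ := exists_surjective_nat (Q → ℕ × Bool)
  have hco : ∀ n : ℕ, Measurable fun x => f x n := fun n => (measurable_pi_apply n).comp hf
  refine ⟨fun n => {x | ∀ q : Q, (q : G) ≠ 1 →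
    f x (e n q).1 = (e n q).2 ∧ f ((q : G) • x) (e n q).1 ≠ (e n q).2},
    fun n => ?_, fun x => ?_, ?_⟩
  · have : {x | ∀ q : Q, (q : G) ≠ 1 →
        f x (e n q).1 = (e n q).2 ∧ f ((q : G) • x) (e n q).1 ≠ (e n q).2} =
        ⋂ q : Q, ⋂ _ : (q : G) ≠ 1, (fun x => f x (e n q).1) ⁻¹' {(e n q).2} ∩
          (fun x => f ((q : G) • x) (e n q).1) ⁻¹' {(e n q).2}ᶜ := by
      ext x
      simp only [mem_iInter, mem_inter_iff, mem_preimage, mem_singleton_iff, mem_compl_iff,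
        mem_ofPred_eq, ne_eq]
    beta_reduce
    rw [this]
    exact MeasurableSet.iInter fun q => MeasurableSet.iInter fun _ =>
      (hco _ (measurableSet_singleton _)).inter
        (((hco _).comp (hm q)) (measurableSet_singleton _).compl)
  · have hex : ∀ q : Q, ∃ p : ℕ × Bool, (q : G) ≠ 1 →
        f x p.1 = p.2 ∧ f ((q : G) • x) p.1 ≠ p.2 := by
      intro q
      by_cases hq : (q : G) = 1
      · exact ⟨(0, true), fun h => absurd hq h⟩
      · have hne : f ((q : G) • x) ≠ f x := fun h => hq (hfree _ _ (hinj h))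
        obtain ⟨n, hn⟩ := Function.ne_iff.1 hne
        exact ⟨(n, f x n), fun _ => ⟨rfl, hn⟩⟩
    choose u hu using hex
    obtain ⟨n, rfl⟩ := he u
    exact ⟨n, hu⟩
  · intro n x hx q hq h1 hqx
    exact (hx ⟨q, hq⟩ h1).2 (hqx ⟨q, hq⟩ h1).1

/-- `Z` contains no two distinct points of the same orbit that differ by an element of `Q`. -/
def IsSep (Q : Finset G) (Z : Set X) : Prop :=
  ∀ z ∈ Z, ∀ q ∈ Q, q • z ∈ Z → q = 1

theorem exists_maximal_isSep (hm : ∀ g : G, Measurable fun x : X => g • x)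
    (hfree : ∀ (g : G) (x : X), g • x = x → g = 1) (Q : Finset G) (hQ : ∀ q ∈ Q, q⁻¹ ∈ Q)
    (Y : Set X) (hY : MeasurableSet Y) :
    ∃ Z ⊆ Y, MeasurableSet Z ∧ IsSep Q Z ∧ ∀ y ∈ Y, y ∈ Z ∨ ∃ q ∈ Q, q • y ∈ Z := by
  obtain ⟨A, hAm, hcov, hA⟩ := exists_measurable_cover_of_free hm hfree Q
  let step : ℕ → Set X → Set X := fun n S => S ∪ {x | x ∈ Y ∩ A n ∧ ∀ q ∈ Q, q • x ∉ S}
  let Z : ℕ → Set X := fun n => Nat.rec ∅ step n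
  have hZs : ∀ n, Z (n + 1) = Z n ∪ {x | x ∈ Y ∩ A n ∧ ∀ q ∈ Q, q • x ∉ Z n} := fun n => rfl
  have hmono : Monotone Z := monotone_nat_of_le_succ fun n => by
    rw [hZs]
    exact subset_union_left
  have hsub : ∀ n, Z n ⊆ Y := by
    intro n
    induction n with
    | zero => exact empty_subset _
    | succ n ih =>
      rw [hZs]
      exact union_subset ih fun x hx => hx.1.1
  have hmeas : ∀ n, MeasurableSet (Z n) := by
    intro n
    induction n with
    | zero => exact MeasurableSet.empty
    | succ n ih =>
      rw [hZs]
      refine ih.union ?_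
      have : {x | x ∈ Y ∩ A n ∧ ∀ q ∈ Q, q • x ∉ Z n} =
          (Y ∩ A n) ∩ ⋂ q ∈ Q, (fun x => q • x) ⁻¹' (Z n)ᶜ := by
        ext x
        simp only [mem_ofPred_eq, mem_inter_iff, mem_iInter, mem_preimage, mem_compl_iff]
      rw [this]
      exact (hY.inter (hAm n)).inter
        (Finset.measurableSet_biInter _ fun q _ => hm q ih.compl)
  have hsep : ∀ n, IsSep Q (Z n) := by
    intro n
    induction n with
    | zero => exact fun z hz => absurd hz (notMem_empty z)
    | succ n ih =>
      rw [hZs]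
      rintro z (hz | hz) q hq (hqz | hqz)
      · exact ih z hz q hq hqz
      · exact absurd hz (by simpa using hqz.2 q⁻¹ (hQ q hq))
      · exact absurd hqz (hz.2 q hq)
      · by_contra h1
        exact hA n z hz.1.2 q hq h1 hqz.1.2
  refine ⟨⋃ n, Z n, iUnion_subset hsub, MeasurableSet.iUnion hmeas, ?_, fun y hy => ?_⟩
  · intro z hz q hq hqz
    obtain ⟨m, hm⟩ := mem_iUnion.1 hz
    obtain ⟨n, hn⟩ := mem_iUnion.1 hqz
    exact hsep (max m n) z (hmono (le_max_left _ _) hm) q hq (hmono (le_max_right _ _) hn)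
  · obtain ⟨n, hn⟩ := hcov y
    rcases em (∃ q ∈ Q, q • y ∈ Z n) with h | h
    · obtain ⟨q, hq, hqy⟩ := h
      exact Or.inr ⟨q, hq, mem_iUnion.2 ⟨n, hqy⟩⟩
    · have hyZ : y ∈ Z (n + 1) := by
        rw [hZs]
        exact Or.inr ⟨⟨hy, hn⟩, fun q hq hqy => h ⟨q, hq, hqy⟩⟩
      exact Or.inl (mem_iUnion.2 ⟨n + 1, hyZ⟩)

/-- A Borel proper coloring with at most `2 ^ K` colors, given by the bits of the color. -/
theorem exists_coloring_bits (hm : ∀ g : G, Measurable fun x : X => g • x)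
    (hfree : ∀ (g : G) (x : X), g • x = x → g = 1) (Q : Finset G) (hQ : ∀ q ∈ Q, q⁻¹ ∈ Q)
    (h1 : 1 ∈ Q) (K : ℕ) (hK : Q.card ≤ 2 ^ K) :
    ∃ C : ℕ → Set X, (∀ j, MeasurableSet (C j)) ∧
      ∀ x, ∀ q ∈ Q, q ≠ 1 → ∃ j < K, ¬(x ∈ C j ↔ q • x ∈ C j) := by
  classical
  have hex := exists_maximal_isSep hm hfree Q hQ
  choose! Zf hZsub hZm hZsep hZmax using hex
  let U : ℕ → Set X := fun n => Nat.rec univ (fun _ S => S \ Zf S) n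
  have hUs : ∀ n, U (n + 1) = U n \ Zf (U n) := fun n => rfl
  have hUm : ∀ n, MeasurableSet (U n) := by
    intro n
    induction n with
    | zero => exact MeasurableSet.univ
    | succ n ih => rw [hUs]; exact ih.diff (hZm _ ih)
  have hanti : Antitone U := antitone_nat_of_succ_le fun n => by rw [hUs]; exact sdiff_subset
  have huniq : ∀ m n x, x ∈ Zf (U m) → x ∈ Zf (U n) → m = n := by
    have key : ∀ m n x, m < n → x ∈ Zf (U m) → x ∉ Zf (U n) := by
      intro m n x hmn hx hx'
      have : x ∈ U (m + 1) := hanti hmn (hZsub _ (hUm n) hx')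
      rw [hUs] at this
      exact this.2 hx
    intro m n x hx hx'
    rcases lt_trichotomy m n with h | h | h
    · exact absurd hx' (key m n x h hx)
    · exact h
    · exact absurd hx (key n m x h hx')
  have hcol : ∀ x, ∃ n < Q.card, x ∈ Zf (U n) := by
    intro x
    by_contra! hx
    have hxU : ∀ n ≤ Q.card, x ∈ U n := by
      intro n
      induction n with
      | zero => exact fun _ => mem_univ x
      | succ n ih =>
        intro hn
        rw [hUs]
        exact ⟨ih (by omega), hx n (by omega)⟩
    have hq : ∀ n, ∃ q, n < Q.card → q ∈ Q.erase 1 ∧ q • x ∈ Zf (U n) := by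
      intro n
      by_cases hn : n < Q.card
      · rcases hZmax _ (hUm n) x (hxU n hn.le) with h | ⟨q, hq, hqx⟩
        · exact absurd h (hx n hn)
        · refine ⟨q, fun _ => ⟨Finset.mem_erase.2 ⟨?_, hq⟩, hqx⟩⟩
          rintro rfl
          rw [one_smul] at hqx
          exact hx n hn hqx
      · exact ⟨1, fun h => absurd h hn⟩
    choose q hq using hq
    obtain ⟨m, hmr, n, hnr, hmn, he⟩ := Finset.exists_ne_map_eq_of_card_lt_of_maps_to
      (s := Finset.range Q.card) (t := Q.erase 1) (f := q)
      (by rw [Finset.card_range]; exact Finset.card_erase_lt_of_mem h1)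
      (fun n hn => (hq n (Finset.mem_range.1 hn)).1)
    rw [Finset.mem_range] at hmr hnr
    exact hmn (huniq m n (q m • x) (hq m hmr).2 (he ▸ (hq n hnr).2))
  choose c hc hcZ using hcol
  have hcC : ∀ x j, (∃ n : ℕ, n.testBit j = true ∧ x ∈ Zf (U n)) ↔ (c x).testBit j = true := by
    intro x j
    constructor
    · rintro ⟨n, hn, hx⟩
      rwa [huniq _ _ x (hcZ x) hx]
    · exact fun h => ⟨c x, h, hcZ x⟩
  refine ⟨fun j => {x | ∃ n : ℕ, n.testBit j = true ∧ x ∈ Zf (U n)}, fun j => ?_, ?_⟩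
  · have : {x | ∃ n : ℕ, n.testBit j = true ∧ x ∈ Zf (U n)} =
        ⋃ n : ℕ, ⋃ _ : n.testBit j = true, Zf (U n) := by
      ext x
      simp
    beta_reduce
    rw [this]
    exact MeasurableSet.iUnion fun n => MeasurableSet.iUnion fun _ => hZm _ (hUm n)
  · intro x q hq hq1
    by_contra! h
    have hcc : c x = c (q • x) := by
      refine Nat.eq_of_testBit_eq fun j => ?_
      by_cases hj : j < K
      · have := h j hj
        simp only [mem_ofPred_eq, hcC] at this
        exact Bool.eq_iff_iff.2 this
      · have hb : ∀ y, (c y).testBit j = false := fun y =>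
          Nat.testBit_lt_two_pow (((hc y).trans_le hK).trans_le
            (Nat.pow_le_pow_right two_pos (not_lt.1 hj)))
        rw [hb, hb]
    exact hq1 (hZsep _ (hUm _) x (hcZ x) q hq (hcc ▸ hcZ (q • x)))

end BorelMarkers

section CodingParameters

open scoped Pointwise

/-- Finite parameters that steer the coding of a nested sequence of markers in an action of `G`:
at level `n` the marker sets are syndetic for `V n`, separated for `Q n` at the next level, and
the positions `k n i` with `i < 3 + K n` store the bits of the next level. -/
structure CodingParams (G : Type*) [Group G] [Encodable G] where
  (a b c d : G)
  Q₀ : Finset G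
  (Q V H : ℕ → Finset G)
  k : ℕ → ℕ → G
  K : ℕ → ℕ
  eq_one_of_mem : ∀ h ∈ ({1, a, b, c, d} : Set G), a * h ∈ ({1, a, b, c, d} : Set G) →
    b * h ∈ ({1, a, b, c, d} : Set G) → h = 1
  c_notMem : c ∉ ({1, a, b, d} : Set G)
  d_notMem : d ∉ ({1, a, b, c} : Set G)
  inv_mem_Q₀ : ∀ q ∈ Q₀, q⁻¹ ∈ Q₀
  mem_Q₀ : ∀ s ∈ ({1, a, b, c, d} : Set G), ∀ s' ∈ ({1, a, b, c, d} : Set G),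
    ∀ p ∈ ({1, a, b} : Set G), s⁻¹ * p * s' ∈ Q₀
  Q₀_subset : Q₀ ⊆ V 0
  one_mem_V : ∀ n, 1 ∈ V n
  index_eq : ∀ n, ∀ v ∈ V n, ∀ v' ∈ V n, ∀ i j, v * k n i = v' * k n j → i = j
  inv_mem_Q : ∀ n, ∀ q ∈ Q n, q⁻¹ ∈ Q n
  mem_Q : ∀ n, ∀ v ∈ V n, ∀ v' ∈ V n, ∀ i < 3 + K n, ∀ j < 3 + K n,
    (v * k n i)⁻¹ * (v' * k n j) ∈ Q n
  V_subset : ∀ n, V n ⊆ V (n + 1)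
  mul_mem_V : ∀ n, ∀ q ∈ Q n, ∀ v ∈ V n, q * v ∈ V (n + 1)
  one_mem_H : ∀ n, 1 ∈ H n
  inv_mem_H : ∀ n, ∀ h ∈ H n, h⁻¹ ∈ H n
  card_H : ∀ n, (H n).card ≤ 2 ^ K n
  conj_mem_H : ∀ (g : G), ∃ n, ∀ t ∈ V (n + 1), t * g * t⁻¹ ∈ H n

theorem exists_coding_generators (G : Type*) [Group G] [Infinite G] :
    ∃ a b c d : G, (∀ h ∈ ({1, a, b, c, d} : Set G), a * h ∈ ({1, a, b, c, d} : Set G) →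
      b * h ∈ ({1, a, b, c, d} : Set G) → h = 1) ∧
      c ∉ ({1, a, b, d} : Set G) ∧ d ∉ ({1, a, b, c} : Set G) := by
  classical
  obtain ⟨a, ha⟩ := Infinite.exists_notMem_finset ({1} : Finset G)
  obtain ⟨b, hb⟩ := Infinite.exists_notMem_finset ({1, a, a⁻¹} : Finset G)
  obtain ⟨c, hc⟩ := Infinite.exists_notMem_finset
    ({1, a, b, a⁻¹, a * b, b * a, a⁻¹ * b} : Finset G)
  obtain ⟨d, hd⟩ := Infinite.exists_notMem_finset
    ({1, a, b, c, a⁻¹, a * b, b * a, a⁻¹ * b, a * c, a⁻¹ * c} : Finset G)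
  simp only [Finset.mem_insert, Finset.mem_singleton, not_or] at ha hb hc hd
  obtain ⟨hb1, hba, hbi⟩ := hb
  obtain ⟨hc1, hca, hcb, hci, hcab, hcba, hcib⟩ := hc
  obtain ⟨hd1, hda, hdb, hdc, hdi, hdab, hdba, hdib, hdac, hdic⟩ := hd
  refine ⟨a, b, c, d, ?_, by simp [*, Ne.symm hdc], by simp [*]⟩
  have e1 : ∀ x y : G, a * x = y ↔ x = a⁻¹ * y := fun x y => eq_inv_mul_iff_mul_eq.symm
  intro h hh h1 h2
  simp only [mem_insert_iff, mem_singleton_iff] at hh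
  rcases hh with rfl | rfl | rfl | rfl | rfl
  · rfl
  · exfalso
    simp only [mem_insert_iff, mem_singleton_iff, mul_eq_right, mul_eq_left] at h2
    rcases h2 with h | h | h | h | h
    · exact hbi (eq_inv_of_mul_eq_one_left h)
    all_goals simp_all
  · exfalso
    simp only [mem_insert_iff, mem_singleton_iff, mul_eq_right, mul_eq_left] at h1
    rcases h1 with h | h | h | h | h
    · exact hbi (eq_inv_of_mul_eq_one_right h)
    all_goals simp_all
  · exfalso
    simp only [mem_insert_iff, mem_singleton_iff, e1] at h1
    simp_all
  · exfalso
    simp only [mem_insert_iff, mem_singleton_iff, e1] at h1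
    simp_all

theorem exists_card_bound (m : ℕ) : ∃ K, 1 + 2 * (((3 + K) * m * ((3 + K) * m)) * m) ≤ 2 ^ K := by
  obtain ⟨c, hc⟩ : ∃ c, 1 + 32 * (m * m * m) ≤ 2 ^ c := ⟨_, Nat.lt_two_pow_self.le⟩
  refine ⟨4 * (c + 2), ?_⟩
  have h1 : c + 3 ≤ 2 ^ (c + 2) := Nat.lt_two_pow_self (n := c + 2)
  have h2 : 3 + 4 * (c + 2) ≤ 4 * 2 ^ (c + 2) := by omega
  calc 1 + 2 * (((3 + 4 * (c + 2)) * m * ((3 + 4 * (c + 2)) * m)) * m)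
      ≤ 1 + 2 * (((4 * 2 ^ (c + 2)) * m * ((4 * 2 ^ (c + 2)) * m)) * m) := by gcongr
    _ = 1 + (2 ^ (c + 2)) ^ 2 * (32 * (m * m * m)) := by ring
    _ ≤ (2 ^ (c + 2)) ^ 2 * (1 + 32 * (m * m * m)) := by
      have : 1 ≤ (2 ^ (c + 2)) ^ 2 := Nat.one_le_pow _ _ (by positivity)
      nlinarith
    _ ≤ (2 ^ (c + 2)) ^ 2 * 2 ^ (2 * (c + 2)) := by
      gcongr
      exact hc.trans (Nat.pow_le_pow_right two_pos (by omega))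
    _ = 2 ^ (4 * (c + 2)) := by rw [← pow_mul, ← pow_add]; congr 1; ring

theorem exists_coding_level {G : Type*} [Group G] [Infinite G] (V : Finset G) (hV : 1 ∈ V)
    (g : G) : ∃ (k : ℕ → G) (K : ℕ) (Q V' H : Finset G),
      (∀ v ∈ V, ∀ v' ∈ V, ∀ i j, v * k i = v' * k j → i = j) ∧
      (∀ q ∈ Q, q⁻¹ ∈ Q) ∧
      (∀ v ∈ V, ∀ v' ∈ V, ∀ i < 3 + K, ∀ j < 3 + K, (v * k i)⁻¹ * (v' * k j) ∈ Q) ∧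
      V ⊆ V' ∧ (∀ q ∈ Q, ∀ v ∈ V, q * v ∈ V') ∧ 1 ∈ H ∧ (∀ h ∈ H, h⁻¹ ∈ H) ∧
      H.card ≤ 2 ^ K ∧ ∀ t ∈ V', t * g * t⁻¹ ∈ H := by
  classical
  let r : G → G → Prop := fun x y => ∀ v ∈ V, ∀ v' ∈ V, v * x ≠ v' * y
  have hr : Std.Symm r := ⟨fun x y h v hv v' hv' => (h v' hv' v hv).symm⟩
  obtain ⟨k, -, hk⟩ := exists_seq_of_forall_finset_exists' (fun _ => True) r fun s _ => by
    obtain ⟨y, hy⟩ := Infinite.exists_notMem_finset (V⁻¹ * V * s)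
    refine ⟨y, trivial, fun x hx v hv v' hv' h => hy ?_⟩
    rw [show y = v'⁻¹ * v * x by rw [mul_assoc, h, inv_mul_cancel_left]]
    exact Finset.mul_mem_mul (Finset.mul_mem_mul (Finset.inv_mem_inv hv') hv) hx
  obtain ⟨K, hK⟩ := exists_card_bound V.card
  let W : Finset G := V * (Finset.range (3 + K)).image k
  have hWc : W.card ≤ (3 + K) * V.card := by
    refine Finset.card_mul_le.trans ?_
    rw [mul_comm]
    gcongr
    exact Finset.card_image_le.trans_eq (Finset.card_range _)
  have hW : ∀ v ∈ V, ∀ i < 3 + K, v * k i ∈ W := fun v hv i hi =>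
    Finset.mul_mem_mul hv (Finset.mem_image_of_mem _ (Finset.mem_range.2 hi))
  let V' : Finset G := W⁻¹ * W * V
  let T : Finset G := V'.image fun t => t * g * t⁻¹
  have hVc : V'.card ≤ ((3 + K) * V.card * ((3 + K) * V.card)) * V.card := by
    refine Finset.card_mul_le.trans ?_
    gcongr
    refine Finset.card_mul_le.trans ?_
    rw [Finset.card_inv]
    gcongr
  have h1 : (1 : G) ∈ W⁻¹ * W := by
    have := hW 1 hV 0 (by omega)
    rw [← inv_mul_cancel (1 * k 0)]
    exact Finset.mul_mem_mul (Finset.inv_mem_inv this) this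
  refine ⟨k, K, W⁻¹ * W, V', insert 1 (T ∪ T⁻¹), ?_, ?_, ?_, ?_, ?_, ?_, ?_, ?_, ?_⟩
  · intro v hv v' hv' i j h
    by_contra hij
    exact hk hij v hv v' hv' h
  · intro q hq
    have : (W⁻¹ * W)⁻¹ = W⁻¹ * W := by rw [mul_inv_rev, inv_inv]
    rw [← this]
    exact Finset.inv_mem_inv hq
  · exact fun v hv v' hv' i hi j hj =>
      Finset.mul_mem_mul (Finset.inv_mem_inv (hW v hv i hi)) (hW v' hv' j hj)
  · intro v hv
    rw [← one_mul v]
    exact Finset.mul_mem_mul h1 hv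
  · exact fun q hq v hv => Finset.mul_mem_mul hq hv
  · exact Finset.mem_insert_self _ _
  · intro h hh
    simp only [Finset.mem_insert, Finset.mem_union, Finset.mem_inv'] at hh ⊢
    rw [inv_inv, inv_eq_one]
    tauto
  · refine (Finset.card_insert_le _ _).trans ?_
    have h2 := Finset.card_union_le T T⁻¹
    rw [Finset.card_inv] at h2
    have h3 : T.card ≤ V'.card := Finset.card_image_le
    omega
  · exact fun t ht => Finset.mem_insert_of_mem (Finset.mem_union_left _
      (Finset.mem_image_of_mem _ ht))

theorem nonempty_codingParams (G : Type*) [Group G] [Encodable G] [Infinite G] :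
    Nonempty (CodingParams G) := by
  classical
  obtain ⟨a, b, c, d, h₁, hc, hd⟩ := exists_coding_generators G
  let S : Finset G := {1, a, b, c, d}
  have hS : ∀ s ∈ ({1, a, b, c, d} : Set G), s ∈ S := fun s hs => by simpa [S] using hs
  let R : Finset G := S⁻¹ * {1, a, b} * S
  let Q₀ : Finset G := R ∪ R⁻¹
  have hR : ∀ s ∈ ({1, a, b, c, d} : Set G), ∀ s' ∈ ({1, a, b, c, d} : Set G),
      ∀ p ∈ ({1, a, b} : Set G), s⁻¹ * p * s' ∈ Q₀ := fun s hs s' hs' p hp =>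
    Finset.mem_union_left _ (Finset.mul_mem_mul (Finset.mul_mem_mul (Finset.inv_mem_inv (hS s hs))
      (by simpa using hp)) (hS s' hs'))
  have h1Q : (1 : G) ∈ Q₀ := by
    simpa using hR 1 (by simp) 1 (by simp) 1 (by simp)
  choose! k K Q V' H hk hQi hQ hVV' hQV h1H hHi hHc hH using
    fun V hV => exists_coding_level (G := G) V hV
  let e : ℕ → G := fun n => (Encodable.decode n).getD 1
  let V : ℕ → Finset G := fun n => Nat.rec Q₀ (fun n V => V' V (e n)) n
  have hV : ∀ n, 1 ∈ V n := by
    intro n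
    induction n with
    | zero => exact h1Q
    | succ n ih => exact hVV' _ ih _ ih
  exact ⟨{
    a := a, b := b, c := c, d := d, Q₀ := Q₀, V := V
    k := fun n => k (V n) (e n)
    K := fun n => K (V n) (e n)
    Q := fun n => Q (V n) (e n)
    H := fun n => H (V n) (e n)
    eq_one_of_mem := h₁
    c_notMem := hc
    d_notMem := hd
    inv_mem_Q₀ := fun q hq => by
      simp only [Q₀, Finset.mem_union, Finset.mem_inv', inv_inv] at hq ⊢
      exact hq.symm
    mem_Q₀ := hR
    Q₀_subset := Finset.Subset.refl _
    one_mem_V := hV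
    index_eq := fun n => hk _ (hV n) _
    inv_mem_Q := fun n => hQi _ (hV n) _
    mem_Q := fun n => hQ _ (hV n) _
    V_subset := fun n => hVV' _ (hV n) _
    mul_mem_V := fun n => hQV _ (hV n) _
    one_mem_H := fun n => h1H _ (hV n) _
    inv_mem_H := fun n => hHi _ (hV n) _
    card_H := fun n => hHc _ (hV n) _
    conj_mem_H := fun g => ⟨Encodable.encode g, fun t ht => by
      have h2 := hH _ (hV (Encodable.encode g)) (e (Encodable.encode g)) t ht
      have h3 : e (Encodable.encode g) = g := by simp [e]
      rwa [h3] at h2 ⊢⟩ }⟩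

end CodingParameters

section Decoding

/-- A marker set `Y` together with the next marker set `M` and the set `P` of points that carry
the data of the next level. -/
structure MarkerState (X : Type*) where
  (Y M P : Set X)

namespace CodingParams

variable {G : Type*} [Group G] [Encodable G] (p : CodingParams G) {X : Type*} [MulAction G X]

/-- The state at level `0` that is encoded in a single set `Φ`. -/
def initState (Φ : Set X) : MarkerState X where
  Y := {x | x ∈ Φ ∧ p.a • x ∈ Φ ∧ p.b • x ∈ Φ}
  M := {x | (x ∈ Φ ∧ p.a • x ∈ Φ ∧ p.b • x ∈ Φ) ∧ p.c • x ∈ Φ}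
  P := {x | (x ∈ Φ ∧ p.a • x ∈ Φ ∧ p.b • x ∈ Φ) ∧ p.d • x ∈ Φ}

/-- The `i`-th bit of data stored at a point by the set `P` on level `n`. -/
def readBit (n : ℕ) (P : Set X) (i : ℕ) : Set X :=
  {x | ∃ v ∈ p.V n, (v * p.k n i) • x ∈ P}

/-- The state at level `n + 1` that is encoded in a state at level `n`. -/
def nextState (n : ℕ) (s : MarkerState X) : MarkerState X where
  Y := s.M
  M := s.M ∩ p.readBit n s.P 0
  P := s.M ∩ p.readBit n s.P 1

/-- The sequence of states that is encoded in a single set `Φ`. -/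
def stateSeq (Φ : Set X) : ℕ → MarkerState X
  | 0 => p.initState Φ
  | n + 1 => p.nextState n (stateSeq Φ n)

/-- The points at which the states `s` on level `n` and `t` on level `n + 1` look as desired: the
marker set of `s` is syndetic, and on the markers of `t` the bits stored by `s` consist of the
constant `b` and of the bits of a proper coloring. -/
def goodSet (n : ℕ) (b : Bool) (s t : MarkerState X) : Set X :=
  {x | (∃ v ∈ p.V n, v • x ∈ s.Y) ∧
    (x ∈ t.Y → (x ∈ p.readBit n s.P 2 ↔ b = true)) ∧
    (x ∈ t.Y → ∀ h ∈ p.H n, h ≠ 1 → h • x ∈ t.Y →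
      ∃ j < p.K n, ¬(x ∈ p.readBit n s.P (3 + j) ↔ h • x ∈ p.readBit n s.P (3 + j)))}

variable {X' : Type*} [MulAction G X'] {f : X → X'}

/-- The preimage of a state. -/
def _root_.MarkerState.comap (f : X → X') (s : MarkerState X') : MarkerState X :=
  ⟨f ⁻¹' s.Y, f ⁻¹' s.M, f ⁻¹' s.P⟩

theorem readBit_preimage (hf : ∀ (g : G) x, f (g • x) = g • f x) (n : ℕ) (P : Set X') (i : ℕ) :
    p.readBit n (f ⁻¹' P) i = f ⁻¹' p.readBit n P i := by
  ext x
  simp only [readBit, mem_ofPred_eq, mem_preimage, hf]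

theorem stateSeq_preimage (hf : ∀ (g : G) x, f (g • x) = g • f x) (Φ : Set X') (n : ℕ) :
    p.stateSeq (f ⁻¹' Φ) n = (p.stateSeq Φ n).comap f := by
  induction n with
  | zero => simp only [stateSeq, initState, MarkerState.comap, mem_preimage, hf]; rfl
  | succ n ih =>
    simp only [stateSeq, nextState, ih, MarkerState.comap, p.readBit_preimage hf, preimage_inter]

theorem goodSet_comap (hf : ∀ (g : G) x, f (g • x) = g • f x) (n : ℕ) (b : Bool)
    (s t : MarkerState X') : p.goodSet n b (s.comap f) (t.comap f) = f ⁻¹' p.goodSet n b s t := by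
  ext x
  simp only [goodSet, MarkerState.comap, p.readBit_preimage hf, mem_ofPred_eq, mem_preimage, hf]

end CodingParams

end Decoding

section CodeSet

/-- The left shift as an action. -/
abbrev shiftAction (G : Type*) [Group G] : MulAction G (G → Bool) where
  smul := shift
  one_smul w := by
    funext h
    change w (1⁻¹ * h) = w h
    simp
  mul_smul g g' w := by
    funext h
    change w ((g * g')⁻¹ * h) = w (g'⁻¹ * (g⁻¹ * h))
    rw [mul_inv_rev, mul_assoc]

attribute [local instance] shiftAction

theorem continuous_shift {G : Type*} [Group G] (g : G) : Continuous (shift g) :=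
  continuous_pi fun h => continuous_apply (g⁻¹ * h)

theorem isClopen_smul_mem {G : Type*} [Group G] {A : Set (G → Bool)} (hA : IsClopen A) (g : G) :
    IsClopen {w | g • w ∈ A} :=
  hA.preimage (continuous_shift g)

theorem isClopen_setOf_imp {T : Type*} [TopologicalSpace T] {A B : T → Prop}
    (hA : IsClopen {x | A x}) (hB : IsClopen {x | B x}) : IsClopen {x | A x → B x} := by
  have : {x | A x → B x} = {x | A x}ᶜ ∪ {x | B x} := by
    ext x
    simp only [mem_ofPred_eq, mem_union, mem_compl_iff]
    tauto
  rw [this]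
  exact hA.compl.union hB

theorem isClopen_setOf_iff {T : Type*} [TopologicalSpace T] {A B : T → Prop}
    (hA : IsClopen {x | A x}) (hB : IsClopen {x | B x}) : IsClopen {x | A x ↔ B x} := by
  have : {x | A x ↔ B x} = {x | A x → B x} ∩ {x | B x → A x} := by
    ext x
    exact iff_def
  rw [this]
  exact (isClopen_setOf_imp hA hB).inter (isClopen_setOf_imp hB hA)

theorem isClopen_exists_mem {T ι : Type*} [TopologicalSpace T] (s : Finset ι) {A : ι → T → Prop}
    (hA : ∀ i ∈ s, IsClopen {x | A i x}) : IsClopen {x | ∃ i ∈ s, A i x} := by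
  have : {x | ∃ i ∈ s, A i x} = ⋃ i ∈ s, {x | A i x} := by
    ext x
    simp
  rw [this]
  exact isClopen_biUnion_finset hA

theorem isClopen_forall_mem {T ι : Type*} [TopologicalSpace T] (s : Finset ι) {A : ι → T → Prop}
    (hA : ∀ i ∈ s, IsClopen {x | A i x}) : IsClopen {x | ∀ i ∈ s, A i x} := by
  have : {x | ∀ i ∈ s, A i x} = ⋂ i ∈ s, {x | A i x} := by
    ext x
    simp
  rw [this]
  exact isClopen_biInter_finset hA

namespace CodingParams

variable {G : Type*} [Group G] [Encodable G] (p : CodingParams G)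

/-- The states that are encoded in the points of the shift. -/
def shiftState (n : ℕ) : MarkerState (G → Bool) :=
  p.stateSeq {w | w 1 = true} n

theorem isClopen_readBit {n : ℕ} {P : Set (G → Bool)} (hP : IsClopen P) (i : ℕ) :
    IsClopen (p.readBit n P i) :=
  isClopen_exists_mem _ fun _ _ => isClopen_smul_mem hP _

theorem isClopen_shiftState (n : ℕ) :
    IsClopen (p.shiftState n).Y ∧ IsClopen (p.shiftState n).M ∧ IsClopen (p.shiftState n).P := by
  induction n with
  | zero =>
    have h0 : IsClopen {w : G → Bool | w 1 = true} :=
      (isClopen_discrete {true}).preimage (continuous_apply 1)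
    have h1 : IsClopen {w : G → Bool | w ∈ {w : G → Bool | w 1 = true} ∧
        p.a • w ∈ {w : G → Bool | w 1 = true} ∧ p.b • w ∈ {w : G → Bool | w 1 = true}} :=
      h0.inter ((isClopen_smul_mem h0 _).inter (isClopen_smul_mem h0 _))
    exact ⟨h1, h1.inter (isClopen_smul_mem h0 _), h1.inter (isClopen_smul_mem h0 _)⟩
  | succ n ih =>
    exact ⟨ih.2.1, ih.2.1.inter (p.isClopen_readBit ih.2.2 _),
      ih.2.1.inter (p.isClopen_readBit ih.2.2 _)⟩

/-- The points of the shift that encode good states on all levels, with data `α`. -/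
def codeSet (α : ℕ → Bool) : Set (G → Bool) :=
  {w | ∀ (n : ℕ) (g : G),
    shift g w ∈ p.goodSet n (α n) (p.shiftState n) (p.shiftState (n + 1))}

theorem isClosed_setOf_mem_goodSet (n : ℕ) :
    IsClosed {q : (ℕ → Bool) × (G → Bool) |
      q.2 ∈ p.goodSet n (q.1 n) (p.shiftState n) (p.shiftState (n + 1))} := by
  have hs : ∀ {A : Set (G → Bool)}, IsClopen A →
      IsClopen {q : (ℕ → Bool) × (G → Bool) | q.2 ∈ A} := fun hA => hA.preimage continuous_snd
  obtain ⟨hY, -, hP⟩ := p.isClopen_shiftState n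
  obtain ⟨hY', -, -⟩ := p.isClopen_shiftState (n + 1)
  have hα : IsClopen {q : (ℕ → Bool) × (G → Bool) | q.1 n = true} :=
    (isClopen_discrete {true}).preimage ((continuous_apply n).comp continuous_fst)
  refine IsClopen.isClosed (IsClopen.inter ?_ (IsClopen.inter ?_ ?_))
  · exact isClopen_exists_mem _ fun v _ => hs (isClopen_smul_mem hY v)
  · exact isClopen_setOf_imp (hs hY') (isClopen_setOf_iff (hs (p.isClopen_readBit hP 2)) hα)
  · refine isClopen_setOf_imp (hs hY') (isClopen_forall_mem _ fun h _ => ?_)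
    by_cases h1 : h = 1
    · simpa [h1] using isClopen_univ
    refine isClopen_setOf_imp (A := fun _ => h ≠ 1) (by simpa [h1] using isClopen_univ)
      (isClopen_setOf_imp (hs (isClopen_smul_mem hY' h)) ?_)
    have := isClopen_exists_mem (Finset.range (p.K n))
      (A := fun j (q : (ℕ → Bool) × (G → Bool)) =>
        ¬(q.2 ∈ p.readBit n (p.shiftState n).P (3 + j) ↔
          h • q.2 ∈ p.readBit n (p.shiftState n).P (3 + j))) fun j _ =>
        (isClopen_setOf_iff (hs (p.isClopen_readBit hP _))
          (hs (isClopen_smul_mem (p.isClopen_readBit hP _) h))).compl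
    simpa only [Finset.mem_range] using this

theorem isClosed_setOf_mem_codeSet :
    IsClosed {q : (ℕ → Bool) × (G → Bool) | q.2 ∈ p.codeSet q.1} := by
  have : {q : (ℕ → Bool) × (G → Bool) | q.2 ∈ p.codeSet q.1} =
      ⋂ (n : ℕ) (g : G), (fun q : (ℕ → Bool) × (G → Bool) => (q.1, shift g q.2)) ⁻¹'
        {q | q.2 ∈ p.goodSet n (q.1 n) (p.shiftState n) (p.shiftState (n + 1))} := by
    ext q
    simp only [codeSet, mem_ofPred_eq, mem_iInter, mem_preimage]
  rw [this]
  exact isClosed_iInter fun n => isClosed_iInter fun g => (p.isClosed_setOf_mem_goodSet n).preimage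
    (continuous_fst.prodMk ((continuous_shift g).comp continuous_snd))

theorem isClosed_goodSet (n : ℕ) (b : Bool) :
    IsClosed (p.goodSet n b (p.shiftState n) (p.shiftState (n + 1))) :=
  (p.isClosed_setOf_mem_goodSet n).preimage
    (f := fun w : G → Bool => ((fun _ => b : ℕ → Bool), w)) (by fun_prop)

theorem isClosed_codeSet (α : ℕ → Bool) : IsClosed (p.codeSet α) :=
  p.isClosed_setOf_mem_codeSet.preimage (f := fun w : G → Bool => (α, w)) (by fun_prop)

theorem shift_mem_codeSet {α : ℕ → Bool} {w : G → Bool} (hw : w ∈ p.codeSet α) (g : G) :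
    shift g w ∈ p.codeSet α := by
  intro n g'
  have : shift g' (shift g w) = shift (g' * g) w := (mul_smul g' g w).symm
  rw [this]
  exact hw n _

theorem shift_image_codeSet (α : ℕ → Bool) (g : G) : shift g '' p.codeSet α = p.codeSet α := by
  refine Subset.antisymm (image_subset_iff.2 fun w hw => p.shift_mem_codeSet hw g) fun w hw => ?_
  exact ⟨shift g⁻¹ w, p.shift_mem_codeSet hw _, smul_inv_smul g w⟩

theorem codeSet_subset_freePart (α : ℕ → Bool) : p.codeSet α ⊆ FreePart G := by
  intro w hw g hg hgw
  obtain ⟨n, hn⟩ := p.conj_mem_H g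
  have h1 := hw (n + 1) 1
  rw [show shift 1 w = w from one_smul G w] at h1
  obtain ⟨t, ht, hty⟩ := h1.1
  have hh1 : t * g * t⁻¹ ≠ 1 := fun h => hg (conj_eq_one_iff.1 h)
  have hfix : (t * g * t⁻¹) • t • w = t • w := by
    rw [smul_smul, inv_mul_cancel_right, mul_smul]
    exact congrArg (shift t) hgw
  obtain ⟨j, -, hj⟩ := (hw n t).2.2 hty _ (hn t ht) hh1 (by
    rw [← hfix] at hty
    exact hty)
  refine hj ?_
  change t • w ∈ _ ↔ (t * g * t⁻¹) • t • w ∈ _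
  rw [hfix]

theorem disjoint_codeSet {α β : ℕ → Bool} (h : α ≠ β) : Disjoint (p.codeSet α) (p.codeSet β) := by
  rw [Set.disjoint_left]
  intro w hα hβ
  refine h (funext fun n => Bool.eq_iff_iff.2 ?_)
  have h1 := hα (n + 1) 1
  rw [show shift 1 w = w from one_smul G w] at h1
  obtain ⟨t, -, hty⟩ := h1.1
  exact ((hα n t).2.1 hty).symm.trans ((hβ n t).2.1 hty)

end CodingParams

end CodeSet

section Encoding

/-- A decreasing sequence of separated, syndetic marker sets in an action together with proper
colorings that are given by the bits of the colors. -/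
structure MarkerSystem {G : Type*} [Group G] [Encodable G] (p : CodingParams G) (X : Type*)
    [MulAction G X] where
  Y : ℕ → Set X
  C : ℕ → ℕ → Set X
  isSep_zero : IsSep p.Q₀ (Y 0)
  subset : ∀ n, Y (n + 1) ⊆ Y n
  isSep_succ : ∀ n, IsSep (p.Q n) (Y (n + 1))
  exists_smul_mem : ∀ n x, ∃ v ∈ p.V n, v • x ∈ Y n
  coloring : ∀ n x, ∀ h ∈ p.H n, h ≠ 1 → ∃ j < p.K n, ¬(x ∈ C n j ↔ h • x ∈ C n j)

theorem exists_measurable_markerSystem {G : Type*} [Group G] [Encodable G] (p : CodingParams G)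
    {X : Type*} [MeasurableSpace X] [StandardBorelSpace X] [MulAction G X]
    (hm : ∀ g : G, Measurable fun x : X => g • x)
    (hfree : ∀ (g : G) (x : X), g • x = x → g = 1) :
    ∃ S : MarkerSystem p X, (∀ n, MeasurableSet (S.Y n)) ∧ ∀ n j, MeasurableSet (S.C n j) := by
  obtain ⟨Z, -, hZm, hZs, hZ⟩ := exists_maximal_isSep hm hfree p.Q₀ p.inv_mem_Q₀ univ
    MeasurableSet.univ
  choose! F hFsub hFm hFs hF using fun n => exists_maximal_isSep hm hfree (p.Q n) (p.inv_mem_Q n)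
  choose C hCm hC using fun n => exists_coloring_bits hm hfree (p.H n) (p.inv_mem_H n)
    (p.one_mem_H n) (p.K n) (p.card_H n)
  let Y : ℕ → Set X := fun n => Nat.rec Z (fun n S => F n S) n
  have hYm : ∀ n, MeasurableSet (Y n) := by
    intro n
    induction n with
    | zero => exact hZm
    | succ n ih => exact hFm n _ ih
  refine ⟨⟨Y, C, hZs, fun n => hFsub n _ (hYm n), fun n => hFs n _ (hYm n), fun n => ?_, hC⟩,
    hYm, hCm⟩
  induction n with
  | zero =>
    intro x
    rcases hZ x (mem_univ x) with h | ⟨q, hq, h⟩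
    · exact ⟨1, p.one_mem_V 0, by rwa [one_smul]⟩
    · exact ⟨q, p.Q₀_subset hq, h⟩
  | succ n ih =>
    intro x
    obtain ⟨v, hv, hvx⟩ := ih x
    rcases hF n _ (hYm n) _ hvx with h | ⟨q, hq, h⟩
    · exact ⟨v, p.V_subset n hv, h⟩
    · exact ⟨q * v, p.mul_mem_V n q hq v hv, by rwa [mul_smul]⟩

namespace MarkerSystem

variable {G : Type*} [Group G] [Encodable G] {p : CodingParams G} {X : Type*} [MulAction G X]
  (S : MarkerSystem p X)

/-- A subset of the markers of level `n` that stores, at each marker of level `n + 1`, whether it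
lies in the sets `B i`. -/
def encodeBits (n : ℕ) (B : ℕ → Set X) : Set X :=
  {y | y ∈ S.Y n ∧ ∃ i < 3 + p.K n, ∃ v ∈ p.V n, (v * p.k n i)⁻¹ • y ∈ S.Y (n + 1) ∩ B i}

theorem mem_readBit_encodeBits {n : ℕ} (B : ℕ → Set X) {x : X} (hx : x ∈ S.Y (n + 1)) {i : ℕ}
    (hi : i < 3 + p.K n) : x ∈ p.readBit n (S.encodeBits n B) i ↔ x ∈ B i := by
  constructor
  · rintro ⟨v, hv, -, i', hi', v', hv', hY, hB⟩
    rw [smul_smul] at hY hB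
    have h1 := S.isSep_succ n x hx _ (p.mem_Q n v' hv' v hv i' hi' i hi) hY
    rw [h1, one_smul] at hB
    rwa [p.index_eq n v' hv' v hv i' i (inv_mul_eq_one.1 h1)] at hB
  · intro hB
    obtain ⟨v, hv, hvx⟩ := S.exists_smul_mem n (p.k n i • x)
    rw [smul_smul] at hvx
    exact ⟨v, hv, hvx, i, hi, v, hv, by rw [inv_smul_smul]; exact ⟨hx, hB⟩⟩

/-- The sets that are stored at level `n`. -/
def storedBit (α : ℕ → Bool) (n : ℕ) (s : MarkerState X) : ℕ → Set X
  | 0 => s.M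
  | 1 => s.P
  | 2 => {_x | α n = true}
  | j + 3 => S.C n j

/-- The state at level `n` that encodes the next `m` levels. -/
def encState (α : ℕ → Bool) : ℕ → ℕ → MarkerState X
  | 0, n => ⟨S.Y n, ∅, ∅⟩
  | m + 1, n => ⟨S.Y n, S.Y (n + 1), S.encodeBits n (S.storedBit α n (encState α m (n + 1)))⟩

variable (α : ℕ → Bool)

theorem encState_Y (m n : ℕ) : (S.encState α m n).Y = S.Y n := by
  cases m <;> rfl

theorem encState_M_subset (m n : ℕ) : (S.encState α m n).M ⊆ S.Y n := by
  cases m with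
  | zero => exact empty_subset _
  | succ m => exact S.subset n

theorem encState_P_subset (m n : ℕ) : (S.encState α m n).P ⊆ S.Y n := by
  cases m with
  | zero => exact empty_subset _
  | succ m => exact fun y hy => hy.1

theorem nextState_encState (m n : ℕ) :
    p.nextState n (S.encState α (m + 1) n) = S.encState α m (n + 1) := by
  have hM : S.Y (n + 1) ∩ p.readBit n (S.encState α (m + 1) n).P 0 =
      (S.encState α m (n + 1)).M := by
    ext x
    constructor
    · exact fun h => (S.mem_readBit_encodeBits _ h.1 (by omega)).1 h.2
    · intro h
      have hx := S.encState_M_subset α m (n + 1) h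
      exact ⟨hx, (S.mem_readBit_encodeBits _ hx (by omega)).2 h⟩
  have hP : S.Y (n + 1) ∩ p.readBit n (S.encState α (m + 1) n).P 1 =
      (S.encState α m (n + 1)).P := by
    ext x
    constructor
    · exact fun h => (S.mem_readBit_encodeBits _ h.1 (by omega)).1 h.2
    · intro h
      have hx := S.encState_P_subset α m (n + 1) h
      exact ⟨hx, (S.mem_readBit_encodeBits _ hx (by omega)).2 h⟩
  change MarkerState.mk (S.Y (n + 1)) (S.Y (n + 1) ∩ p.readBit n (S.encState α (m + 1) n).P 0)
    (S.Y (n + 1) ∩ p.readBit n (S.encState α (m + 1) n).P 1) = _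
  rw [hM, hP, ← S.encState_Y α m (n + 1)]

/-- The set that encodes `N` levels. -/
def encSet (N : ℕ) : Set X :=
  {x | x ∈ S.Y 0 ∨ p.a⁻¹ • x ∈ S.Y 0 ∨ p.b⁻¹ • x ∈ S.Y 0 ∨ p.c⁻¹ • x ∈ (S.encState α N 0).M ∨
    p.d⁻¹ • x ∈ (S.encState α N 0).P}

theorem exists_of_mem_encSet {N : ℕ} {x : X} (hx : x ∈ S.encSet α N) :
    ∃ s ∈ ({1, p.a, p.b, p.c, p.d} : Set G), ∃ y ∈ S.Y 0, x = s • y ∧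
      (s = p.c → s ∉ ({1, p.a, p.b, p.d} : Set G) → y ∈ (S.encState α N 0).M) ∧
      (s = p.d → s ∉ ({1, p.a, p.b, p.c} : Set G) → y ∈ (S.encState α N 0).P) := by
  rcases hx with h | h | h | h | h
  · exact ⟨1, by simp, x, h, by simp, by simp, by simp⟩
  · exact ⟨p.a, by simp, _, h, by simp, by simp, by simp⟩
  · exact ⟨p.b, by simp, _, h, by simp, by simp, by simp⟩
  · exact ⟨p.c, by simp, _, S.encState_M_subset α N 0 h, by simp, fun _ _ => h, by simp⟩
  · exact ⟨p.d, by simp, _, S.encState_P_subset α N 0 h, by simp, by simp, fun _ _ => h⟩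

theorem eq_of_smul_eq_smul {s s' g : G} (hs : s ∈ ({1, p.a, p.b, p.c, p.d} : Set G))
    (hs' : s' ∈ ({1, p.a, p.b, p.c, p.d} : Set G)) (hg : g ∈ ({1, p.a, p.b} : Set G)) {y y' : X}
    (hy : y ∈ S.Y 0) (hy' : y' ∈ S.Y 0) (h : g • s • y = s' • y') : s' = g * s ∧ y = y' := by
  have hyy : y' = (s'⁻¹ * g * s) • y := by
    rw [mul_smul, mul_smul, h, inv_smul_smul]
  have h1 := S.isSep_zero y hy _ (p.mem_Q₀ s' hs' s hs g hg) (hyy ▸ hy')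
  rw [h1, one_smul] at hyy
  rw [mul_assoc] at h1
  exact ⟨inv_mul_eq_one.1 h1, hyy.symm⟩

theorem initState_encSet (N : ℕ) : p.initState (S.encSet α N) = S.encState α N 0 := by
  have hY : ∀ x, x ∈ S.encSet α N ∧ p.a • x ∈ S.encSet α N ∧ p.b • x ∈ S.encSet α N ↔
      x ∈ S.Y 0 := by
    refine fun x => ⟨fun ⟨h, ha, hb⟩ => ?_, fun h => ⟨Or.inl h, Or.inr (Or.inl ?_),
      Or.inr (Or.inr (Or.inl ?_))⟩⟩
    · obtain ⟨s, hs, y, hy, rfl, -⟩ := S.exists_of_mem_encSet α h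
      obtain ⟨s₁, hs₁, y₁, hy₁, h₁, -⟩ := S.exists_of_mem_encSet α ha
      obtain ⟨s₂, hs₂, y₂, hy₂, h₂, -⟩ := S.exists_of_mem_encSet α hb
      have e₁ := (S.eq_of_smul_eq_smul hs hs₁ (by simp) hy hy₁ h₁).1
      have e₂ := (S.eq_of_smul_eq_smul hs hs₂ (by simp) hy hy₂ h₂).1
      rw [p.eq_one_of_mem s hs (e₁ ▸ hs₁) (e₂ ▸ hs₂), one_smul]
      exact hy
    · rwa [inv_smul_smul]
    · rwa [inv_smul_smul]
  have hM : ∀ x ∈ S.Y 0, (p.c • x ∈ S.encSet α N ↔ x ∈ (S.encState α N 0).M) := by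
    refine fun x hx => ⟨fun h => ?_, fun h => Or.inr (Or.inr (Or.inr (Or.inl ?_)))⟩
    · obtain ⟨s, hs, y, hy, h₁, h₂, -⟩ := S.exists_of_mem_encSet α h
      obtain ⟨rfl, rfl⟩ := S.eq_of_smul_eq_smul (s := p.c) (g := 1) (by simp) hs (by simp) hx hy
        (by rw [one_smul, h₁])
      rw [one_mul] at h₂
      exact h₂ rfl p.c_notMem
    · rwa [inv_smul_smul]
  have hP : ∀ x ∈ S.Y 0, (p.d • x ∈ S.encSet α N ↔ x ∈ (S.encState α N 0).P) := by
    refine fun x hx => ⟨fun h => ?_, fun h => Or.inr (Or.inr (Or.inr (Or.inr ?_)))⟩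
    · obtain ⟨s, hs, y, hy, h₁, -, h₂⟩ := S.exists_of_mem_encSet α h
      obtain ⟨rfl, rfl⟩ := S.eq_of_smul_eq_smul (s := p.d) (g := 1) (by simp) hs (by simp) hx hy
        (by rw [one_smul, h₁])
      rw [one_mul] at h₂
      exact h₂ rfl p.d_notMem
    · rwa [inv_smul_smul]
  have h₁ : (p.initState (S.encSet α N)).Y = (S.encState α N 0).Y := by
    rw [S.encState_Y]
    exact Set.ext hY
  have h₂ : (p.initState (S.encSet α N)).M = (S.encState α N 0).M := by
    ext x
    constructor
    · rintro ⟨h, h'⟩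
      exact (hM x ((hY x).1 h)).1 h'
    · intro h
      have hx := S.encState_M_subset α N 0 h
      exact ⟨(hY x).2 hx, (hM x hx).2 h⟩
  have h₃ : (p.initState (S.encSet α N)).P = (S.encState α N 0).P := by
    ext x
    constructor
    · rintro ⟨h, h'⟩
      exact (hP x ((hY x).1 h)).1 h'
    · intro h
      have hx := S.encState_P_subset α N 0 h
      exact ⟨(hY x).2 hx, (hP x hx).2 h⟩
  cases h : S.encState α N 0
  simp only [h] at h₁ h₂ h₃
  rw [← h₁, ← h₂, ← h₃]

theorem stateSeq_encSet (n m : ℕ) :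
    p.stateSeq (S.encSet α (n + m)) n = S.encState α m n := by
  induction n generalizing m with
  | zero => rw [zero_add]; exact S.initState_encSet α m
  | succ n ih =>
    rw [show n + 1 + m = n + (m + 1) by omega, ← S.nextState_encState α m n, ← ih]
    rfl

theorem mem_goodSet_encSet {n N : ℕ} (h : n < N) (x : X) :
    x ∈ p.goodSet n (α n) (p.stateSeq (S.encSet α N) n) (p.stateSeq (S.encSet α N) (n + 1)) := by
  obtain ⟨m, rfl⟩ : ∃ m, N = n + 1 + m := ⟨N - (n + 1), by omega⟩
  rw [S.stateSeq_encSet α (n + 1) m, show n + 1 + m = n + (m + 1) by omega, S.stateSeq_encSet]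
  refine ⟨?_, fun hx => ?_, fun hx g hg hg1 hgx => ?_⟩
  · rw [S.encState_Y]
    exact S.exists_smul_mem n x
  · rw [S.encState_Y] at hx
    exact S.mem_readBit_encodeBits _ hx (by omega)
  · rw [S.encState_Y] at hx hgx
    obtain ⟨j, hj, hC⟩ := S.coloring n x g hg hg1
    have hb : ∀ y ∈ S.Y (n + 1), (y ∈ p.readBit n (S.encState α (m + 1) n).P (3 + j) ↔
        y ∈ S.C n j) := fun y hy => by
      refine (S.mem_readBit_encodeBits _ hy (by omega)).trans ?_
      rw [add_comm 3 j]
      rfl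
    exact ⟨j, hj, by rwa [hb x hx, hb _ hgx]⟩

theorem encState_mono (m n : ℕ) : (S.encState α m n).M ⊆ (S.encState α (m + 1) n).M ∧
    (S.encState α m n).P ⊆ (S.encState α (m + 1) n).P := by
  induction m generalizing n with
  | zero => exact ⟨empty_subset _, empty_subset _⟩
  | succ m ih =>
    refine ⟨Subset.rfl, ?_⟩
    rintro y ⟨hy, i, hi, v, hv, hyY, hyB⟩
    refine ⟨hy, i, hi, v, hv, hyY, ?_⟩
    match i with
    | 0 => exact (ih (n + 1)).1 hyB
    | 1 => exact (ih (n + 1)).2 hyB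
    | 2 => exact hyB
    | j + 3 => exact hyB

theorem monotone_encSet : Monotone (S.encSet α) := by
  refine monotone_nat_of_le_succ fun N x hx => ?_
  rcases hx with h | h | h | h | h
  · exact Or.inl h
  · exact Or.inr (Or.inl h)
  · exact Or.inr (Or.inr (Or.inl h))
  · exact Or.inr (Or.inr (Or.inr (Or.inl ((S.encState_mono α N 0).1 h))))
  · exact Or.inr (Or.inr (Or.inr (Or.inr ((S.encState_mono α N 0).2 h))))

theorem measurableSet_encState [MeasurableSpace X] (hm : ∀ g : G, Measurable fun x : X => g • x)
    (hY : ∀ n, MeasurableSet (S.Y n)) (hC : ∀ n j, MeasurableSet (S.C n j)) (m n : ℕ) :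
    MeasurableSet (S.encState α m n).M ∧ MeasurableSet (S.encState α m n).P := by
  induction m generalizing n with
  | zero => exact ⟨MeasurableSet.empty, MeasurableSet.empty⟩
  | succ m ih =>
    have hB : ∀ i, MeasurableSet (S.storedBit α n (S.encState α m (n + 1)) i) := fun i =>
      match i with
      | 0 => (ih (n + 1)).1
      | 1 => (ih (n + 1)).2
      | 2 => MeasurableSet.const _
      | j + 3 => hC n j
    refine ⟨hY (n + 1), ?_⟩
    have : (S.encState α (m + 1) n).P = S.Y n ∩ ⋃ (i : ℕ) (_ : i < 3 + p.K n), ⋃ v ∈ p.V n,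
        (fun x : X => (v * p.k n i)⁻¹ • x) ⁻¹'
          (S.Y (n + 1) ∩ S.storedBit α n (S.encState α m (n + 1)) i) := by
      ext x
      simp only [encState, encodeBits, mem_ofPred_eq, mem_inter_iff, mem_iUnion, mem_preimage,
        exists_prop]
    rw [this]
    exact (hY n).inter (MeasurableSet.iUnion fun i => MeasurableSet.iUnion fun _ =>
      Finset.measurableSet_biUnion _ fun v _ => hm _ ((hY (n + 1)).inter (hB i)))

theorem measurableSet_encSet [MeasurableSpace X] (hm : ∀ g : G, Measurable fun x : X => g • x)
    (hY : ∀ n, MeasurableSet (S.Y n)) (hC : ∀ n j, MeasurableSet (S.C n j)) (N : ℕ) :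
    MeasurableSet (S.encSet α N) := by
  obtain ⟨hM, hP⟩ := S.measurableSet_encState α hm hY hC N 0
  exact (hY 0).union ((hm _ (hY 0)).union ((hm _ (hY 0)).union ((hm _ hM).union (hm _ hP))))

end MarkerSystem

end Encoding

section Universality

attribute [local instance] shiftAction

open Classical in
/-- The map to the shift that records the visits of an orbit to `Φ`. -/
noncomputable def itinerary (G : Type*) [Group G] {X : Type*} [MulAction G X] (Φ : Set X) (x : X) :
    G → Bool :=
  fun h => decide (h⁻¹ • x ∈ Φ)

theorem itinerary_smul {G : Type*} [Group G] {X : Type*} [MulAction G X] (Φ : Set X) (g : G)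
    (x : X) : itinerary G Φ (g • x) = shift g (itinerary G Φ x) := by
  funext h
  have h1 : h⁻¹ • g • x = (g⁻¹ * h)⁻¹ • x := by rw [smul_smul, mul_inv_rev, inv_inv]
  exact decide_eq_decide.2 (by rw [h1])

theorem measurable_itinerary {G : Type*} [Group G] {X : Type*} [MeasurableSpace X]
    [MulAction G X] (hm : ∀ g : G, Measurable fun x : X => g • x) {Φ : Set X}
    (hΦ : MeasurableSet Φ) : Measurable (itinerary G Φ) := by
  refine measurable_pi_lambda _ fun h => measurable_to_bool ?_
  have : (fun x : X => itinerary G Φ x h) ⁻¹' {true} = (fun x : X => h⁻¹ • x) ⁻¹' Φ := by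
    ext x
    simp [itinerary]
  rw [this]
  exact hm h⁻¹ hΦ

theorem CodingParams.exists_equivariant_map {G : Type*} [Group G] [Encodable G]
    (p : CodingParams G) (α : ℕ → Bool) {X : Type*} [MeasurableSpace X] [StandardBorelSpace X]
    [MulAction G X] (hm : ∀ g : G, Measurable fun x : X => g • x)
    (hfree : ∀ (g : G) (x : X), g • x = x → g = 1) :
    ∃ f : X → G → Bool, Measurable f ∧ (∀ (g : G) (x : X), f (g • x) = shift g (f x)) ∧
      range f ⊆ p.codeSet α := by
  obtain ⟨S, hY, hC⟩ := exists_measurable_markerSystem p hm hfree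
  refine ⟨itinerary G (⋃ N, S.encSet α N), measurable_itinerary hm
    (MeasurableSet.iUnion (S.measurableSet_encSet α hm hY hC)), itinerary_smul _, ?_⟩
  have hlim : ∀ x : X, Filter.Tendsto (fun N => itinerary G (S.encSet α N) x) Filter.atTop
      (nhds (itinerary G (⋃ N, S.encSet α N) x)) := by
    refine fun x => tendsto_pi_nhds.2 fun h => tendsto_const_nhds.congr' ?_
    by_cases hx : h⁻¹ • x ∈ ⋃ N, S.encSet α N
    · obtain ⟨N, hN⟩ := mem_iUnion.1 hx
      filter_upwards [Filter.eventually_ge_atTop N] with M hM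
      simp only [itinerary, hx, S.monotone_encSet α hM hN]
    · refine Filter.Eventually.of_forall fun N => ?_
      have hN : h⁻¹ • x ∉ S.encSet α N := fun hN => hx (mem_iUnion.2 ⟨N, hN⟩)
      simp only [itinerary, hx, hN]
  have hgood : ∀ (x : X) n, itinerary G (⋃ N, S.encSet α N) x ∈
      p.goodSet n (α n) (p.shiftState n) (p.shiftState (n + 1)) := by
    refine fun x n => (p.isClosed_goodSet n (α n)).mem_of_tendsto (hlim x) ?_
    filter_upwards [Filter.eventually_gt_atTop n] with N hN
    have hpre : itinerary G (S.encSet α N) ⁻¹' {w : G → Bool | w 1 = true} = S.encSet α N := by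
      ext y
      simp [itinerary]
    have h := S.mem_goodSet_encSet α hN x
    rw [← hpre, p.stateSeq_preimage (itinerary_smul _), p.stateSeq_preimage (itinerary_smul _),
      p.goodSet_comap (itinerary_smul _)] at h
    exact h
  rintro _ ⟨x, rfl⟩ n g
  rw [← itinerary_smul]
  exact hgood _ n

end Universality

section Assembly

theorem CodingParams.nonempty_codeSet {G : Type*} [Group G] [Encodable G] (p : CodingParams G)
    (α : ℕ → Bool) : (p.codeSet α).Nonempty := by
  let m : MeasurableSpace G := ⊤
  have : DiscreteMeasurableSpace G := ⟨fun _ => MeasurableSpace.measurableSet_top⟩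
  obtain ⟨f, -, -, hf⟩ := p.exists_equivariant_map α (X := G)
    (fun _ => Measurable.of_discrete) fun g x h => by simpa using h
  exact ⟨f 1, hf (mem_range_self 1)⟩

theorem bijOn_orbit_of_equivariant {G X : Type*} [Group G] [MulAction G X] {f : X → G → Bool}
    (hf : ∀ (g : G) (x : X), f (g • x) = shift g (f x)) (hfree : range f ⊆ FreePart G) (x : X) :
    BijOn f {x' | ∃ g : G, g • x = x'} {w | ∃ g : G, shift g (f x) = w} := by
  refine ⟨?_, ?_, ?_⟩
  · rintro _ ⟨g, rfl⟩
    exact ⟨g, (hf g x).symm⟩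
  · rintro _ ⟨g, rfl⟩ _ ⟨g', rfl⟩ h
    have h1 : shift (g * g'⁻¹) (f (g' • x)) = f (g' • x) := by
      rw [← hf, smul_smul, inv_mul_cancel_right, h]
    have h2 : g * g'⁻¹ = 1 := by
      by_contra hne
      exact hfree (mem_range_self _) _ hne h1
    rw [mul_inv_eq_one.1 h2]
  · rintro _ ⟨g, rfl⟩
    exact ⟨g • x, ⟨g, rfl⟩, hf g x⟩

end Assembly

/-- If `I` is an ideal on `Free(2^G)` such that every nonempty perfect subset `P` of the
hyperspace `K(Free(2^G))` consisting of pairwise disjoint `G`-invariant compact sets meets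
`I`, then there is a compact `G`-invariant set `K ⊆ Free(2^G)` belonging to `I` which admits
a `G`-equivariant class-bijective Borel map from every free Borel action of `G` on a
standard Borel space. -/
theorem exists_small_compact_invariant_target
    {G : Type} [Group G] [Encodable G] [Infinite G]
    (I : Set (Set (G → Bool)))
    (hIsub : ∀ A ∈ I, A ⊆ FreePart G)
    (hIdown : ∀ A ∈ I, ∀ B : Set (G → Bool), B ⊆ A → B ∈ I)
    (hIunion : ∀ A ∈ I, ∀ B ∈ I, A ∪ B ∈ I)
    (hperf : ∀ P : Set (NonemptyCompacts (FreePart G : Set (G → Bool))),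
      P.Nonempty → Perfect P →
      (∀ C ∈ P, ∀ g : G,
        shift g '' (Subtype.val '' (C : Set (FreePart G : Set (G → Bool)))) =
          Subtype.val '' (C : Set (FreePart G : Set (G → Bool)))) →
      (∀ C ∈ P, ∀ D ∈ P, C ≠ D →
        Disjoint (C : Set (FreePart G : Set (G → Bool)))
          (D : Set (FreePart G : Set (G → Bool)))) →
      ∃ C ∈ P, Subtype.val '' (C : Set (FreePart G : Set (G → Bool))) ∈ I) :
    ∃ K : Set (G → Bool), IsCompact K ∧ K ⊆ FreePart G ∧
      (∀ g : G, shift g '' K = K) ∧ K ∈ I ∧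
      ∀ (X : Type v) (_ : MeasurableSpace X), StandardBorelSpace X →
        ∀ (_ : MulAction G X),
        (∀ g : G, Measurable fun x : X => g • x) →
        (∀ (g : G) (x : X), g • x = x → g = 1) →
        ∃ f : X → (G → Bool),
          Measurable f ∧
          (∀ (g : G) (x : X), f (g • x) = shift g (f x)) ∧
          Set.range f ⊆ K ∧
          ∀ x : X, Set.BijOn f {x' | ∃ g : G, g • x = x'}
            {w | ∃ g : G, shift g (f x) = w} := by
  obtain ⟨p⟩ := nonempty_codingParams G
  obtain ⟨P, hPne, hP, hPE⟩ := exists_perfect_subset_sections (FreePart G) p.codeSet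
    p.nonempty_codeSet p.codeSet_subset_freePart p.isClosed_setOf_mem_codeSet
    fun α β h => p.disjoint_codeSet h
  obtain ⟨C, hC, hCI⟩ := hperf P hPne hP
    (fun C hC g => by
      obtain ⟨α, hα⟩ := hPE C hC
      rw [hα, p.shift_image_codeSet])
    (fun C hC D hD hCD => by
      obtain ⟨α, hα⟩ := hPE C hC
      obtain ⟨β, hβ⟩ := hPE D hD
      have hne : α ≠ β := by
        rintro rfl
        exact hCD (SetLike.coe_injective (Subtype.val_injective.image_injective (hα.trans hβ.symm)))
      rw [← disjoint_image_iff Subtype.val_injective, hα, hβ]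
      exact p.disjoint_codeSet hne)
  obtain ⟨α, hα⟩ := hPE C hC
  rw [hα] at hCI
  refine ⟨p.codeSet α, (p.isClosed_codeSet α).isCompact, p.codeSet_subset_freePart α,
    p.shift_image_codeSet α, hCI, ?_⟩
  intro X _ hX _ hm hfree
  obtain ⟨f, hf, hfe, hfr⟩ := p.exists_equivariant_map α hm hfree
  exact ⟨f, hf, hfe, hfr,
    bijOn_orbit_of_equivariant hfe (hfr.trans (p.codeSet_subset_freePart α))⟩
end

section
/- Let G be a countably infinite discrete group and fix a subset S ⊆ G. Let G ↷ X be a free Borel action on a standard Borel space X. Then χ_B(𝒢_X) ≤ χ_B(𝒢_{Free(2^G)}), i.e., the Borel chromatic number of the graph 𝒢_X is at most the Borel chromatic number of the graph 𝒢_{Free(2^G)} associated to the shift action on Free(2^G). -/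
open MeasureTheory Set

open scoped Pointwise

section Selection

variable {X : Type*} [MeasurableSpace X]

/-- Measurable choice of a witness in a countable type. -/
theorem exists_measurable_selection {L : Type*} [Countable L] [Nonempty L] {P : X → L → Prop}
    (hP : ∀ l, MeasurableSet {x | P x l}) (hex : ∀ x, ∃ l, P x l) :
    ∃ φ : X → L, (∀ l, MeasurableSet {x | φ x = l}) ∧ ∀ x, P x (φ x) := by
  classical
  obtain ⟨e, he⟩ := exists_surjective_nat L
  have hex' : ∀ x, ∃ n, P x (e n) := fun x => by
    obtain ⟨l, hl⟩ := hex x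
    obtain ⟨n, rfl⟩ := he l
    exact ⟨n, hl⟩
  have hm : Measurable fun x => Nat.find (hex' x) := measurable_find hex' fun k => hP (e k)
  refine ⟨fun x => e (Nat.find (hex' x)), fun l => ?_, fun x => Nat.find_spec (hex' x)⟩
  exact hm (MeasurableSet.of_discrete (s := {n | e n = l}))

/-- Greedy construction of a measurable labelling along a measurable ranking `κ`: a requirement
on the label of `x` that only depends on the labels of the points of smaller rank, and that can
always be met, can be met everywhere by a measurable labelling. -/
theorem exists_measurable_greedy_s9 {L : Type*} [Countable L] [Nonempty L] {κ : X → ℕ}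
    (hκ : Measurable κ) (Good : X → (X → L) → L → Prop)
    (hmeas : ∀ y : X → L, (∀ l, MeasurableSet {x | y x = l}) → ∀ l, MeasurableSet {x | Good x y l})
    (hloc : ∀ x y y' l, (∀ z, κ z < κ x → y z = y' z) → Good x y l → Good x y' l)
    (hex : ∀ x y, ∃ l, Good x y l) :
    ∃ y : X → L, (∀ l, MeasurableSet {x | y x = l}) ∧ ∀ x, Good x y (y x) := by
  classical
  let Y := {y : X → L // ∀ l, MeasurableSet {x | y x = l}}
  have sel : ∀ y : Y, ∃ φ : Y, ∀ x, Good x y.1 (φ.1 x) := fun y => by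
    obtain ⟨φ, h1, h2⟩ := exists_measurable_selection (hmeas y.1 y.2) fun x => hex x y.1
    exact ⟨⟨φ, h1⟩, h2⟩
  choose F hF using sel
  let step : ℕ → Y → Y := fun k y => ⟨fun x => if κ x = k then (F y).1 x else y.1 x, fun l => by
    have : {x | (if κ x = k then (F y).1 x else y.1 x) = l} =
        ({x | κ x = k} ∩ {x | (F y).1 x = l}) ∪ ({x | κ x = k}ᶜ ∩ {x | y.1 x = l}) := by
      ext x
      by_cases h : κ x = k <;> simp [h]
    rw [this]
    have hk : MeasurableSet {x | κ x = k} := hκ (measurableSet_singleton k)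
    exact (hk.inter ((F y).2 l)).union (hk.compl.inter (y.2 l))⟩
  let seq : ℕ → Y := fun n => Nat.rec ⟨fun _ => Classical.arbitrary L, fun l => by simp⟩ step n
  have hsucc : ∀ k x, (seq (k + 1)).1 x = if κ x = k then (F (seq k)).1 x else (seq k).1 x :=
    fun k x => rfl
  have hstable : ∀ x j, κ x < j → (seq j).1 x = (seq (κ x + 1)).1 x := by
    intro x j hj
    induction j, hj using Nat.le_induction with
    | base => rfl
    | succ j hj ih => rw [hsucc, if_neg (by omega), ih]
  refine ⟨fun x => (seq (κ x + 1)).1 x, fun l => ?_, fun x => ?_⟩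
  · have : {x | (seq (κ x + 1)).1 x = l} = ⋃ k, {x | κ x = k} ∩ {x | (seq (k + 1)).1 x = l} := by
      ext x
      simp
    rw [this]
    exact MeasurableSet.iUnion fun k => (hκ (measurableSet_singleton k)).inter ((seq (k + 1)).2 l)
  · refine hloc x (seq (κ x)).1 _ _ (fun z hz => hstable z _ hz) ?_
    simpa only [hsucc, if_pos] using hF _ x

theorem measurableSet_mem_label {α : Type*} [Countable α] {y : X → Finset α}
    (hy : ∀ l, MeasurableSet {x | y x = l}) (f : α) : MeasurableSet {x | f ∈ y x} := by
  have : {x | f ∈ y x} = ⋃ l ∈ {l : Finset α | f ∈ l}, {x | y x = l} := by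
    ext x
    simp
  rw [this]
  exact MeasurableSet.biUnion (Set.to_countable _) fun l _ => hy l

end Selection

section Action

variable {G X : Type*} [Group G] [MeasurableSpace X] [MulAction G X]

/-- A measurable ranking whose values at distinct points related by a finite set are distinct. -/
theorem exists_measurable_rank [StandardBorelSpace X]
    (hBorel : ∀ g : G, Measurable fun x : X => g • x) (E : Finset G) :
    ∃ κ : X → ℕ, Measurable κ ∧ ∀ e ∈ E, ∀ x, e • x ≠ x → κ (e • x) ≠ κ x := by
  obtain ⟨f, hf, hinj⟩ := MeasurableSpace.measurable_injection_nat_bool_of_countablySeparated X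
  let P : X → (Σ n, Fin n → Bool) → Prop := fun x s =>
    (∀ i : Fin s.1, f x i = s.2 i) ∧ ∀ e ∈ E, e • x ≠ x → ∃ i : Fin s.1, f (e • x) i ≠ s.2 i
  have hfi : ∀ i b, MeasurableSet {x | f x i = b} := fun i b =>
    (measurable_pi_iff.1 hf i) (measurableSet_singleton b)
  have hPmeas : ∀ s, MeasurableSet {x | P x s} := fun s => by
    have h1 : MeasurableSet {x | ∀ i : Fin s.1, f x i = s.2 i} := by
      rw [Set.ofPred_forall]
      exact MeasurableSet.iInter fun i => hfi _ _
    have h2 : MeasurableSet {x | ∀ e ∈ E, e • x ≠ x → ∃ i : Fin s.1, f (e • x) i ≠ s.2 i} := by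
      simp only [Set.ofPred_forall]
      refine E.measurableSet_biInter fun e _ => ?_
      have h3 : MeasurableSet {x : X | e • x = x} := measurableSet_eq_fun (hBorel e) measurable_id
      have h4 : MeasurableSet {x : X | ∃ i : Fin s.1, f (e • x) i ≠ s.2 i} := by
        rw [Set.ofPred_exists]
        exact MeasurableSet.iUnion fun i => (hBorel e (hfi i (s.2 i))).compl
      convert h3.union h4 using 1
      ext x
      simp [or_iff_not_imp_left]
    exact h1.inter h2
  have hPex : ∀ x, ∃ s, P x s := fun x => by
    have hsep : ∀ e ∈ E, ∃ i, e • x ≠ x → f (e • x) i ≠ f x i := fun e _ => by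
      by_cases h : e • x = x
      · exact ⟨0, fun h' => absurd h h'⟩
      · obtain ⟨i, hi⟩ := Function.ne_iff.1 (hinj.ne h)
        exact ⟨i, fun _ => hi⟩
    choose! i hi using hsep
    refine ⟨⟨E.sup i + 1, fun j => f x j⟩, fun j => rfl, fun e he hne =>
      ⟨⟨i e, Nat.lt_succ_of_le (Finset.le_sup he)⟩, hi e he hne⟩⟩
  obtain ⟨φ, hφ, hP⟩ := exists_measurable_selection hPmeas hPex
  obtain ⟨c, hc⟩ := exists_injective_nat (Σ n, Fin n → Bool)
  refine ⟨fun x => c (φ x), measurable_to_countable' fun n => ?_, fun e he x hne heq => ?_⟩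
  · have : (fun x => c (φ x)) ⁻¹' {n} = ⋃ s ∈ {s | c s = n}, {x | φ x = s} := by
      ext x
      simp
    rw [this]
    exact MeasurableSet.biUnion (Set.to_countable _) fun s _ => hφ s
  · have heq := hc heq
    obtain ⟨i, hi⟩ := (hP x).2 e he hne
    have h1 := (hP (e • x)).1
    rw [heq] at h1
    exact hi (h1 i)

/-- A measurable maximal `D`-separated subset of a measurable set. -/
theorem exists_measurable_maximal_separated_s9 [StandardBorelSpace X]
    (hBorel : ∀ g : G, Measurable fun x : X => g • x) {D : Finset G} (h1 : 1 ∈ D)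
    (hD : ∀ d ∈ D, d⁻¹ ∈ D) {R : Set X} (hR : MeasurableSet R) :
    ∃ M ⊆ R, MeasurableSet M ∧ (∀ x ∈ M, ∀ d ∈ D, d • x ∈ M → d • x = x) ∧
      ∀ x ∈ R, ∃ d ∈ D, d • x ∈ M := by
  obtain ⟨κ, hκ, hsep⟩ := exists_measurable_rank hBorel D
  let Good : X → (X → Bool) → Bool → Prop := fun x y l =>
    l = true ↔ x ∈ R ∧ ∀ d ∈ D, κ (d • x) < κ x → ¬ y (d • x) = true
  have hmeas : ∀ y : X → Bool, (∀ l, MeasurableSet {x | y x = l}) →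
      ∀ l, MeasurableSet {x | Good x y l} := fun y hy l => by
    have h2 : MeasurableSet {x | ∀ d ∈ D, κ (d • x) < κ x → ¬ y (d • x) = true} := by
      simp only [Set.ofPred_forall]
      refine D.measurableSet_biInter fun d _ => ?_
      have h3 : MeasurableSet {x : X | κ (d • x) < κ x} :=
        measurableSet_lt (hκ.comp (hBorel d)) hκ
      convert h3.compl.union (hBorel d (hy true)).compl using 1
      ext x
      simp only [Set.mem_ofPred_eq, Set.mem_union, Set.mem_compl_iff, Set.mem_preimage]
      tauto
    cases l
    · convert (hR.inter h2).compl using 1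
      ext x
      simp [Good]
    · convert hR.inter h2 using 1
      ext x
      simp [Good]
  have hloc : ∀ x y y' l, (∀ z, κ z < κ x → y z = y' z) → Good x y l → Good x y' l := by
    intro x y y' l h hl
    refine hl.trans (and_congr_right fun _ => forall₂_congr fun d _ => ?_)
    exact imp_congr_right fun hlt => by rw [h _ hlt]
  have hex : ∀ x y, ∃ l, Good x y l := fun x y => by
    classical
    exact ⟨decide (x ∈ R ∧ ∀ d ∈ D, κ (d • x) < κ x → ¬ y (d • x) = true), by simp [Good]⟩
  obtain ⟨y, hy, hgood⟩ := exists_measurable_greedy_s9 hκ Good hmeas hloc hex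
  refine ⟨{x | y x = true}, fun x hx => ((hgood x).1 hx).1, hy true, fun x hx d hd hdx => ?_,
    fun x hx => ?_⟩
  · by_contra hne
    rcases lt_or_gt_of_ne (hsep d hd x hne) with h | h
    · exact ((hgood x).1 hx).2 d hd h hdx
    · refine ((hgood (d • x)).1 hdx).2 d⁻¹ (hD d hd) ?_ ?_
      · rwa [inv_smul_smul]
      · rwa [inv_smul_smul]
  · by_contra! hno
    have hx1 : ¬ y x = true := by simpa using hno 1 h1
    exact hx1 ((hgood x).2 ⟨hx, fun d hd _ => hno d hd⟩)

end Action

section Counting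

variable {G : Type*} [Group G]

/-- A finite set contains a third of its elements forming a set disjoint from its translate. -/
theorem exists_subset_disjoint_translate (J : Finset G) {γ : G} (hγ : γ ≠ 1) :
    ∃ I ⊆ J, (∀ f ∈ I, f * γ ∉ I) ∧ J.card ≤ 3 * I.card := by
  classical
  obtain ⟨I, hI, hmax⟩ := (J.powerset.filter fun I => ∀ f ∈ I, f * γ ∉ I).exists_max_image
    Finset.card ⟨∅, by simp⟩
  simp only [Finset.mem_filter, Finset.mem_powerset] at hI hmax
  refine ⟨I, hI.1, hI.2, ?_⟩
  have hsub : J ⊆ I ∪ I.image (· * γ) ∪ I.image (· * γ⁻¹) := by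
    intro f hf
    by_contra hno
    simp only [Finset.mem_union, Finset.mem_image, not_or, not_exists, not_and] at hno
    obtain ⟨⟨h0, h1⟩, h2⟩ := hno
    have := hmax (insert f I) ⟨Finset.insert_subset hf hI.1, fun a ha hb => ?_⟩
    · rw [Finset.card_insert_of_notMem h0] at this
      omega
    · rcases Finset.mem_insert.1 ha with rfl | ha <;> rcases Finset.mem_insert.1 hb with hb | hb
      · exact hγ (by simpa using hb)
      · exact h2 _ hb (by group)
      · exact h1 _ ha hb
      · exact hI.2 _ ha hb
  calc J.card ≤ _ := Finset.card_le_card hsub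
    _ ≤ I.card + (I.image (· * γ)).card + (I.image (· * γ⁻¹)).card :=
      (Finset.card_union_le _ _).trans (Nat.add_le_add_right (Finset.card_union_le _ _) _)
    _ ≤ I.card + I.card + I.card :=
      Nat.add_le_add (Nat.add_le_add_left Finset.card_image_le _) Finset.card_image_le
    _ = _ := by ring

/-- A word on `W` that for every `γ ∈ Γ` differs somewhere on `J γ` from a reading `c γ`, where
the reading at `f` depends on the word only through its value at `f * γ`. -/
theorem exists_word_ne_reading (W Γ : Finset G) (j : ℕ) (hcard : Γ.card < 2 ^ j)
    (hΓ : ∀ γ ∈ Γ, γ ≠ 1) (J : G → Finset G) (hJW : ∀ γ ∈ Γ, J γ ⊆ W)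
    (hJ : ∀ γ ∈ Γ, 3 * j ≤ (J γ).card) (c : G → Finset G → G → Prop)
    (hc : ∀ γ f l l', (f * γ ∈ l ↔ f * γ ∈ l') → (c γ l f ↔ c γ l' f)) :
    ∃ l : Finset G, ∀ γ ∈ Γ, ∃ f ∈ J γ, ¬ (f ∈ l ↔ c γ l f) := by
  classical
  by_contra! hno
  let Bad : G → Finset (Finset G) := fun γ =>
    W.powerset.filter fun l => ∀ f ∈ J γ, (f ∈ l ↔ c γ l f)
  have hcover : W.powerset ⊆ Γ.biUnion Bad := fun l hl => by
    obtain ⟨γ, hγ, h⟩ := hno l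
    exact Finset.mem_biUnion.2 ⟨γ, hγ, Finset.mem_filter.2 ⟨hl, h⟩⟩
  have hbad : ∀ γ ∈ Γ, (Bad γ).card * 2 ^ j ≤ 2 ^ W.card := fun γ hγ => by
    obtain ⟨I, hIJ, hI, hcardI⟩ := exists_subset_disjoint_translate (J γ) (hΓ γ hγ)
    have hIW := hIJ.trans (hJW γ hγ)
    have hj : j ≤ I.card := by have := hJ γ hγ; omega
    have hinj : (Bad γ).card ≤ (W \ I).powerset.card := by
      refine Finset.card_le_card_of_injOn (fun l => l \ I) (fun l hl => ?_) fun l hl l' hl' h => ?_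
      · simp only [Bad, Finset.coe_filter, Set.mem_ofPred_eq, Finset.mem_powerset] at hl
        exact Finset.mem_coe.2 (Finset.mem_powerset.2 (Finset.sdiff_subset_sdiff hl.1 subset_rfl))
      · simp only [Bad, Finset.coe_filter, Set.mem_ofPred_eq, Finset.mem_powerset] at hl hl'
        have hout : ∀ f ∉ I, (f ∈ l ↔ f ∈ l') := fun f hf => by
          have := Finset.ext_iff.1 h f
          simpa [hf] using this
        ext f
        by_cases hf : f ∈ I
        · rw [hl.2 f (hIJ hf), hl'.2 f (hIJ hf)]
          exact hc γ f l l' (hout _ (hI f hf))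
        · exact hout f hf
    calc (Bad γ).card * 2 ^ j ≤ 2 ^ (W.card - I.card) * 2 ^ I.card := by
          rw [Finset.card_powerset, Finset.card_sdiff_of_subset hIW] at hinj
          exact Nat.mul_le_mul hinj (Nat.pow_le_pow_right (by norm_num) hj)
      _ = 2 ^ W.card := by rw [← pow_add, Nat.sub_add_cancel (Finset.card_le_card hIW)]
  have h1 : 2 ^ W.card * 2 ^ j ≤ Γ.card * 2 ^ W.card := by
    calc 2 ^ W.card * 2 ^ j ≤ (∑ γ ∈ Γ, (Bad γ).card) * 2 ^ j := by
          rw [← Finset.card_powerset]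
          gcongr
          exact (Finset.card_le_card hcover).trans Finset.card_biUnion_le
      _ = ∑ γ ∈ Γ, (Bad γ).card * 2 ^ j := Finset.sum_mul _ _ _
      _ ≤ ∑ γ ∈ Γ, 2 ^ W.card := Finset.sum_le_sum hbad
      _ = _ := by simp
  rw [mul_comm] at h1
  exact absurd (Nat.le_of_mul_le_mul_right h1 (by positivity)) (by omega)

theorem exists_mul_pow_lt_two_pow_s9 (C a b k : ℕ) : ∃ j : ℕ, C * (a * j + b) ^ k < 2 ^ j := by
  have h := tendsto_pow_const_div_const_pow_of_one_lt (k := k) (r := 2) one_lt_two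
  have h' := h.const_mul ((C * (a + b) ^ k : ℕ) : ℝ)
  rw [mul_zero] at h'
  obtain ⟨j, hj, hj1⟩ := ((h'.eventually_lt_const zero_lt_one).and
    (Filter.eventually_ge_atTop 1)).exists
  refine ⟨j, ?_⟩
  have h2 : ((C * (a + b) ^ k : ℕ) : ℝ) * (j : ℝ) ^ k < 2 ^ j := by
    rw [← mul_div_assoc, div_lt_one (by positivity)] at hj
    exact hj
  have h3 : C * (a + b) ^ k * j ^ k < 2 ^ j := by exact_mod_cast h2
  refine lt_of_le_of_lt ?_ h3
  rw [mul_assoc, ← mul_pow]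
  gcongr
  nlinarith

/-- Finite windows of size linear in `k` meeting every syndetic set in at least `k` points. -/
theorem exists_window [Infinite G] {X : Type*} [MulAction G X] {R : Set X} {T : Finset G}
    (hT : ∀ x : X, ∃ t ∈ T, t • x ∈ R) (k : ℕ) :
    ∃ W : Finset G, W.card ≤ k * T.card ∧
      ∀ x : X, ∃ J ⊆ W, k ≤ J.card ∧ ∀ f ∈ J, f • x ∈ R := by
  classical
  induction k with
  | zero => exact ⟨∅, by simp, fun x => ⟨∅, by simp⟩⟩
  | succ k ih =>
    obtain ⟨W, hW, hx⟩ := ih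
    obtain ⟨a, ha⟩ := Infinite.exists_notMem_finset (T⁻¹ * W)
    refine ⟨W ∪ T.image (· * a), ?_, fun x => ?_⟩
    · have := Finset.card_union_le W (T.image (· * a))
      have := Finset.card_image_le (s := T) (f := (· * a))
      rw [add_mul]
      omega
    · obtain ⟨J, hJW, hJ, hJR⟩ := hx x
      obtain ⟨t, ht, htR⟩ := hT (a • x)
      have hnot : t * a ∉ J := fun h => ha (Finset.mem_mul.2
        ⟨t⁻¹, Finset.inv_mem_inv ht, t * a, hJW h, by group⟩)
      refine ⟨insert (t * a) J, ?_, ?_, ?_⟩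
      · refine Finset.insert_subset (Finset.mem_union_right _ (Finset.mem_image_of_mem _ ht)) ?_
        exact hJW.trans Finset.subset_union_left
      · rw [Finset.card_insert_of_notMem hnot]
        omega
      · intro f hf
        rcases Finset.mem_insert.1 hf with rfl | hf
        · rwa [mul_smul]
        · exact hJR f hf

end Counting

section Stage

variable {G X : Type*} [Group G] [MulAction G X]

/-- The set that agrees with `A` outside of `R`, and that on the window `W • v` of a point `v ∈ M`
is read off the word `y v`. -/
def fillWindows (R A M : Set X) (W : Finset G) (y : X → Finset G) : Set X :=
  {p | (p ∉ R ∧ p ∈ A) ∨ (p ∈ R ∧ ∃ f ∈ W, f⁻¹ • p ∈ M ∧ f ∈ y (f⁻¹ • p))}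

theorem mem_fillWindows_congr {R A M : Set X} {W : Finset G} {y y' : X → Finset G} {p : X}
    (h : ∀ f ∈ W, f⁻¹ • p ∈ M → (f ∈ y (f⁻¹ • p) ↔ f ∈ y' (f⁻¹ • p))) :
    p ∈ fillWindows R A M W y ↔ p ∈ fillWindows R A M W y' := by
  refine or_congr_right (and_congr_right fun _ => exists_congr fun f => and_congr_right fun hf => ?_)
  exact and_congr_right fun hM => h f hf hM

variable [MeasurableSpace X]

/-- Fill in the windows around a separated set `M` so that each `v ∈ M` is distinguished from
`γ • v` within its window, whenever the points of `M` near `γ • v` have smaller rank than `v`. -/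
theorem exists_fill_distinguishing [Countable G]
    (hBorel : ∀ g : G, Measurable fun x : X => g • x)
    (hfree : ∀ (g : G) (x : X), g • x = x → g = 1)
    {R A M : Set X} (hR : MeasurableSet R) (hA : MeasurableSet A) (hM : MeasurableSet M)
    {W V Γ : Finset G} {j : ℕ} (hWV : ∀ f ∈ W, ∀ f' ∈ W, f⁻¹ * f' ∈ V) (hcard : Γ.card < 2 ^ j)
    (hΓ : ∀ γ ∈ Γ, γ ≠ 1) (hVV : ∀ f ∈ W, ∀ f' ∈ W, f * f'⁻¹ ∈ V)
    (hsep : ∀ x ∈ M, ∀ v ∈ V, v • x ∈ M → v • x = x)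
    (hwin : ∀ x : X, ∃ J ⊆ W, 3 * j + 2 ≤ J.card ∧ ∀ f ∈ J, f • x ∈ R)
    {κ : X → ℕ} (hκ : Measurable κ) :
    ∃ B : Set X, MeasurableSet B ∧ (∀ x, x ∉ R → (x ∈ B ↔ x ∈ A)) ∧ ∀ v ∈ M, ∀ γ ∈ Γ,
      (∀ w ∈ V, w • γ • v ∈ M → w • γ • v = v ∨ κ (w • γ • v) < κ v) →
      ∃ f : G, f • v ∉ M ∧ f • γ • v ∉ M ∧ ¬ (f • v ∈ B ↔ f • γ • v ∈ B) := by
  classical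
  have hfree' : ∀ (a b : G) (x : X), a • x = b • x → a = b := fun a b x h => by
    have := hfree (b⁻¹ * a) x (by rw [mul_smul, h, inv_smul_smul])
    exact (inv_mul_eq_one.1 this).symm
  let Cond : G → X → Prop := fun γ x =>
    ∀ w ∈ V, w • γ • x ∈ M → w • γ • x = x ∨ κ (w • γ • x) < κ x
  let Good : X → (X → Finset G) → Finset G → Prop := fun x y l => x ∈ M → ∀ γ ∈ Γ, Cond γ x →
    ∃ f ∈ W, f • x ∈ R ∧ f • x ∉ M ∧ f • γ • x ∉ M ∧
      ¬ (f ∈ l ↔ f • γ • x ∈ fillWindows R A M W (Function.update y x l))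
  have hsm : ∀ {S : Set X}, MeasurableSet S → ∀ g : G, Measurable fun x : X => g • x ∈ S :=
    fun hS g => measurableSet_setOfPred.1 (hBorel g hS)
  have hsm2 : ∀ {S : Set X}, MeasurableSet S → ∀ g h : G, Measurable fun x : X => g • h • x ∈ S :=
    fun hS g h => measurableSet_setOfPred.1 (((hBorel g).comp (hBorel h)) hS)
  have hsm3 : ∀ {S : Set X}, MeasurableSet S → ∀ g h k : G,
      Measurable fun x : X => g • h • k • x ∈ S :=
    fun hS g h k => measurableSet_setOfPred.1 (((hBorel g).comp ((hBorel h).comp (hBorel k))) hS)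
  have hmeas : ∀ y : X → Finset G, (∀ l, MeasurableSet {x | y x = l}) →
      ∀ l, MeasurableSet {x | Good x y l} := fun y hy l => by
    have hupd : ∀ f' f γ : G,
        Measurable fun x => f' ∈ Function.update y x l (f'⁻¹ • f • γ • x) := fun f' f γ => by
      by_cases h : f'⁻¹ * f * γ = 1
      · have : ∀ x : X, f'⁻¹ • f • γ • x = x := fun x => by
          rw [smul_smul, smul_smul, h, one_smul]
        simp only [this, Function.update_self]
        exact measurable_const
      · have : ∀ x : X, f'⁻¹ • f • γ • x ≠ x := fun x hx => by
          rw [smul_smul, smul_smul] at hx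
          exact h (hfree _ x hx)
        simp only [Function.update_of_ne (this _)]
        exact hsm3 (measurableSet_mem_label hy f') f'⁻¹ f γ
    have hcond : ∀ γ, Measurable (Cond γ) := fun γ =>
      Measurable.forall fun w => measurable_const.imp <| (hsm2 hM w γ).imp <|
        (measurableSet_setOfPred.1 <| by
          by_cases h : w * γ = 1
          · simp [smul_smul, h]
          · have : ∀ x : X, w • γ • x ≠ x := fun x hx => by
              rw [smul_smul] at hx
              exact h (hfree _ x hx)
            simp [this]).or
        (measurableSet_setOfPred.1 <| measurableSet_lt
          (hκ.comp ((hBorel w).comp (hBorel γ))) hκ)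
    refine measurableSet_setOfPred.2 <| (measurableSet_setOfPred.1 hM).imp <|
      Measurable.forall fun γ =>
      measurable_const.imp <| (hcond γ).imp <| Measurable.exists fun f => measurable_const.and <|
      (hsm hR f).and <| (hsm hM f).not.and <| (hsm2 hM f γ).not.and <| Measurable.not <|
      measurable_const.iff ?_
    exact ((hsm2 hR f γ).not.and (hsm2 hA f γ)).or <| (hsm2 hR f γ).and <|
      Measurable.exists fun f' => measurable_const.and <| (hsm3 hM f'⁻¹ f γ).and (hupd f' f γ)
  have hloc : ∀ x y y' l, (∀ z, κ z < κ x → y z = y' z) → Good x y l → Good x y' l := by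
    intro x y y' l h hl hx γ hγ hcond
    obtain ⟨f, hf, h1, h2, h3, h4⟩ := hl hx γ hγ hcond
    refine ⟨f, hf, h1, h2, h3, fun h5 => h4 (h5.trans (mem_fillWindows_congr fun f' hf' hm => ?_))⟩
    by_cases hu : f'⁻¹ • f • γ • x = x
    · simp [hu]
    · rw [Function.update_of_ne hu, Function.update_of_ne hu]
      have hc := hcond (f'⁻¹ * f) (hWV _ hf' _ hf)
      rw [mul_smul] at hc
      rw [h _ ((hc hm).resolve_left hu)]
  have hex : ∀ x y, ∃ l, Good x y l := fun x y => by
    by_cases hx : x ∈ M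
    swap
    · exact ⟨∅, fun h => absurd h hx⟩
    obtain ⟨J, hJW, hJ, hJR⟩ := hwin x
    have hone : ∀ z : X, (W.filter fun f => f • z ∈ M).card ≤ 1 := fun z => by
      refine Finset.card_le_one.2 fun a ha b hb => ?_
      rw [Finset.mem_filter] at ha hb
      have hab : (a * b⁻¹) • b • z = a • z := by rw [smul_smul, inv_mul_cancel_right]
      have := hsep _ hb.2 (a * b⁻¹) (hVV a ha.1 b hb.1) (by rw [hab]; exact ha.2)
      rw [hab] at this
      exact hfree' _ _ _ this
    obtain ⟨l, hl⟩ := exists_word_ne_reading W (Γ.filter fun γ => Cond γ x) j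
      ((Finset.card_filter_le _ _).trans_lt hcard) (fun γ hγ => hΓ γ (Finset.mem_filter.1 hγ).1)
      (fun γ => W.filter fun f => f • x ∈ R ∧ f • x ∉ M ∧ f • γ • x ∉ M)
      (fun γ _ => Finset.filter_subset _ _) (fun γ _ => by
        have hsub : J ⊆ (W.filter fun f => f • x ∈ R ∧ f • x ∉ M ∧ f • γ • x ∉ M) ∪
            (W.filter fun f => f • x ∈ M) ∪ (W.filter fun f => f • γ • x ∈ M) := fun f hf => by
          have := hJW hf
          have := hJR f hf
          simp only [Finset.mem_union, Finset.mem_filter]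
          tauto
        have h1 := Finset.card_le_card hsub
        have h2 := hone x
        have h3 := hone (γ • x)
        have h4 := Finset.card_union_le ((W.filter fun f => f • x ∈ R ∧ f • x ∉ M ∧ f • γ • x ∉ M) ∪
          (W.filter fun f => f • x ∈ M)) (W.filter fun f => f • γ • x ∈ M)
        have h5 := Finset.card_union_le (W.filter fun f => f • x ∈ R ∧ f • x ∉ M ∧ f • γ • x ∉ M)
          (W.filter fun f => f • x ∈ M)
        omega)
      (fun γ l f => f • γ • x ∈ fillWindows R A M W (Function.update y x l))
      (fun γ f l l' h => mem_fillWindows_congr fun f' hf' hm => by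
        by_cases hu : f'⁻¹ • f • γ • x = x
        · have : f' = f * γ := by
            refine hfree' _ _ x ?_
            rw [inv_smul_eq_iff] at hu
            rw [← hu, mul_smul]
          simp only [hu, Function.update_self]
          rwa [this]
        · rw [Function.update_of_ne hu, Function.update_of_ne hu])
    refine ⟨l, fun _ γ hγ hcond => ?_⟩
    obtain ⟨f, hf, h⟩ := hl γ (Finset.mem_filter.2 ⟨hγ, hcond⟩)
    obtain ⟨hfW, h1, h2, h3⟩ := Finset.mem_filter.1 hf
    exact ⟨f, hfW, h1, h2, h3, h⟩
  obtain ⟨y, hy, hgood⟩ := exists_measurable_greedy_s9 hκ Good hmeas hloc hex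
  refine ⟨fillWindows R A M W y, ?_, fun x hx => by simp [fillWindows, hx], ?_⟩
  · exact measurableSet_setOfPred.2 <|
      ((measurableSet_setOfPred.1 hR).not.and (measurableSet_setOfPred.1 hA)).or <|
      (measurableSet_setOfPred.1 hR).and <| Measurable.exists fun f => measurable_const.and <|
      (hsm hM f⁻¹).and (hsm (measurableSet_mem_label hy f) f⁻¹)
  · intro v hv γ hγ hcond
    obtain ⟨f, hf, h1, h2, h3, h4⟩ := hgood v hv γ hγ hcond
    rw [Function.update_eq_self] at h4
    refine ⟨f, h2, h3, fun h5 => h4 (Iff.trans ?_ h5)⟩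
    constructor
    · exact fun hfy => Or.inr ⟨h1, f, hf, by rwa [inv_smul_smul], by rwa [inv_smul_smul]⟩
    · rintro (⟨h, -⟩ | ⟨-, f', hf', hm, hfy⟩)
      · exact absurd h1 h
      · have hu : f'⁻¹ • f • v = v := by
          have := hsep v hv (f'⁻¹ * f) (hWV _ hf' _ hf)
          rw [mul_smul] at this
          exact this hm
        rw [hu] at hfy
        rw [inv_smul_eq_iff] at hu
        rwa [hfree' _ _ _ hu]

/-- One step of the construction: given an undecided syndetic set `R`, decide all of `R` except
for a syndetic subset `M`, so that the decided points distinguish `x` from `g • x` for all `x`. -/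
theorem exists_stage [Countable G] [Infinite G] [StandardBorelSpace X]
    (hBorel : ∀ g : G, Measurable fun x : X => g • x)
    (hfree : ∀ (g : G) (x : X), g • x = x → g = 1)
    {R A : Set X} (hR : MeasurableSet R) (hA : MeasurableSet A)
    (hT : ∃ T : Finset G, ∀ x : X, ∃ t ∈ T, t • x ∈ R) {g : G} (hg : g ≠ 1) :
    ∃ M B : Set X, MeasurableSet M ∧ MeasurableSet B ∧
      (∃ T : Finset G, ∀ x : X, ∃ t ∈ T, t • x ∈ M) ∧ M ⊆ R ∧
      (∀ x, x ∉ R → (x ∈ B ↔ x ∈ A)) ∧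
      ∀ x : X, ∃ h : G, h • x ∉ M ∧ h • g • x ∉ M ∧ ¬ (h • x ∈ B ↔ h • g • x ∈ B) := by
  classical
  obtain ⟨T, hT⟩ := hT
  obtain ⟨j, hj⟩ := exists_mul_pow_lt_two_pow_s9 (2 * T.card) (6 * T.card) (4 * T.card + 1) 6
  obtain ⟨W₀, hW₀, hwin₀⟩ := exists_window hT (3 * j + 2)
  let W : Finset G := insert 1 (W₀ ∪ W₀⁻¹)
  have hWcard : W.card ≤ 6 * T.card * j + (4 * T.card + 1) := by
    have h1 : W.card ≤ (W₀ ∪ W₀⁻¹).card + 1 := Finset.card_insert_le _ _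
    have h2 := Finset.card_union_le W₀ W₀⁻¹
    rw [Finset.card_inv] at h2
    calc W.card ≤ 2 * ((3 * j + 2) * T.card) + 1 := by omega
      _ = _ := by ring
  have hW1 : (1 : G) ∈ W := Finset.mem_insert_self _ _
  have hWinv : ∀ f ∈ W, f⁻¹ ∈ W := fun f hf => by
    simp only [W, Finset.mem_insert, Finset.mem_union, Finset.mem_inv', inv_inv, inv_eq_one] at hf ⊢
    tauto
  have hwin : ∀ x : X, ∃ J ⊆ W, 3 * j + 2 ≤ J.card ∧ ∀ f ∈ J, f • x ∈ R := fun x => by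
    obtain ⟨J, hJ, h⟩ := hwin₀ x
    exact ⟨J, hJ.trans (Finset.subset_union_left.trans (Finset.subset_insert _ _)), h⟩
  let V := W * W
  have hV1 : (1 : G) ∈ V := Finset.mem_mul.2 ⟨1, hW1, 1, hW1, one_mul 1⟩
  have hVinv : ∀ v ∈ V, v⁻¹ ∈ V := fun v hv => by
    obtain ⟨a, ha, b, hb, rfl⟩ := Finset.mem_mul.1 hv
    exact Finset.mem_mul.2 ⟨b⁻¹, hWinv b hb, a⁻¹, hWinv a ha, by group⟩
  let D := V * V
  have hVD : V ⊆ D := fun v hv => Finset.mem_mul.2 ⟨1, hV1, v, hv, one_mul v⟩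
  have hDinv : ∀ v ∈ D, v⁻¹ ∈ D := fun v hv => by
    obtain ⟨a, ha, b, hb, rfl⟩ := Finset.mem_mul.1 hv
    exact Finset.mem_mul.2 ⟨b⁻¹, hVinv b hb, a⁻¹, hVinv a ha, by group⟩
  obtain ⟨M, hMR, hM, hsep, hmax⟩ :=
    exists_measurable_maximal_separated_s9 hBorel (hVD hV1) hDinv hR
  let K := V * (D * T)
  let Γ := K.image (fun k => k * g * k⁻¹) ∪ K.image (fun k => k * g⁻¹ * k⁻¹)
  have hΓ1 : ∀ γ ∈ Γ, γ ≠ 1 := fun γ hγ => by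
    rcases Finset.mem_union.1 hγ with h | h <;> obtain ⟨k, -, rfl⟩ := Finset.mem_image.1 h
    · rwa [Ne, conj_eq_one_iff]
    · rwa [Ne, conj_eq_one_iff, inv_eq_one]
  have hΓcard : Γ.card < 2 ^ j := by
    have hV : V.card ≤ W.card * W.card := Finset.card_mul_le
    have hD : D.card ≤ V.card * V.card := Finset.card_mul_le
    have hDT : (D * T).card ≤ D.card * T.card := Finset.card_mul_le
    have hK : K.card ≤ V.card * (D * T).card := Finset.card_mul_le
    calc Γ.card ≤ K.card + K.card := (Finset.card_union_le _ _).trans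
          (Nat.add_le_add Finset.card_image_le Finset.card_image_le)
      _ = 2 * K.card := by ring
      _ ≤ 2 * (V.card * (V.card * V.card * T.card)) := by
          gcongr
          exact hK.trans (Nat.mul_le_mul_left _ (hDT.trans (Nat.mul_le_mul_right _ hD)))
      _ ≤ 2 * ((W.card * W.card) * ((W.card * W.card) * (W.card * W.card) * T.card)) := by gcongr
      _ = 2 * T.card * W.card ^ 6 := by ring
      _ ≤ 2 * T.card * (6 * T.card * j + (4 * T.card + 1)) ^ 6 := by gcongr
      _ < 2 ^ j := hj
  obtain ⟨κ, hκ, hrank⟩ := exists_measurable_rank hBorel (V * Γ)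
  obtain ⟨B, hB, hBA, hdist⟩ := exists_fill_distinguishing hBorel hfree hR hA hM (V := V)
    (fun f hf f' hf' => Finset.mul_mem_mul (hWinv f hf) hf') hΓcard hΓ1
    (fun f hf f' hf' => Finset.mul_mem_mul hf (hWinv f' hf'))
    (fun x hx v hv => hsep x hx v (hVD hv)) hwin hκ
  refine ⟨M, B, hM, hB, ⟨D * T, fun x => ?_⟩, hMR, hBA, fun x => ?_⟩
  · obtain ⟨t, ht, htx⟩ := hT x
    obtain ⟨d, hd, hdx⟩ := hmax _ htx
    exact ⟨d * t, Finset.mul_mem_mul hd ht, by rwa [mul_smul]⟩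
  · obtain ⟨t, ht, htx⟩ := hT x
    obtain ⟨d, hd, hdx⟩ := hmax _ htx
    have hp : d * t ∈ D * T := Finset.mul_mem_mul hd ht
    generalize hpdef : d * t = p at hp
    rw [smul_smul, hpdef] at hdx
    have hγ : p * g * p⁻¹ ∈ Γ := Finset.mem_union_left _ (Finset.mem_image_of_mem
      (fun k => k * g * k⁻¹) (Finset.mem_mul.2 ⟨1, hV1, p, hp, one_mul p⟩))
    have hγv : (p * g * p⁻¹) • p • x = p • g • x := by simp [mul_smul]
    by_cases hcond : ∀ w ∈ V, w • (p * g * p⁻¹) • p • x ∈ M →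
        w • (p * g * p⁻¹) • p • x = p • x ∨ κ (w • (p * g * p⁻¹) • p • x) < κ (p • x)
    · obtain ⟨f, h1, h2, h3⟩ := hdist _ hdx _ hγ hcond
      rw [hγv, smul_smul] at h2 h3
      rw [smul_smul] at h1 h3
      exact ⟨f * p, h1, h2, h3⟩
    · push Not at hcond
      obtain ⟨w, hw, huM, hne, hle⟩ := hcond
      have hlt : κ (p • x) < κ (w • (p * g * p⁻¹) • p • x) := by
        refine lt_of_le_of_ne hle fun h => ?_
        refine hrank (w * (p * g * p⁻¹)) (Finset.mul_mem_mul hw hγ) (p • x) ?_ ?_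
        · rwa [mul_smul]
        · rw [mul_smul]
          exact h.symm
      rw [hγv, smul_smul] at huM hlt
      have hk : w * p ∈ K := Finset.mul_mem_mul hw hp
      have hγ' : (w * p) * g⁻¹ * (w * p)⁻¹ ∈ Γ := Finset.mem_union_right _ (Finset.mem_image_of_mem
        (fun k => k * g⁻¹ * k⁻¹) hk)
      have hγu : ((w * p) * g⁻¹ * (w * p)⁻¹) • (w * p) • g • x = w • p • x := by simp [mul_smul]
      obtain ⟨f, h1, h2, h3⟩ := hdist _ huM _ hγ' fun w' hw' hm => by
        rw [hγu] at hm ⊢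
        rw [smul_smul w' w] at hm ⊢
        rw [hsep _ hdx _ (Finset.mul_mem_mul hw' hw) hm]
        exact Or.inr hlt
      rw [hγu] at h2 h3
      exact ⟨f * (w * p), by simpa only [mul_smul] using h2, by simpa only [mul_smul] using h1,
        fun h => h3 (by simpa only [mul_smul] using h.symm)⟩

/-- A measurable set whose trace on each orbit has no symmetries. -/
theorem exists_measurableSet_distinguishing [Countable G] [Infinite G] [StandardBorelSpace X]
    (hBorel : ∀ g : G, Measurable fun x : X => g • x)
    (hfree : ∀ (g : G) (x : X), g • x = x → g = 1) :
    ∃ B : Set X, MeasurableSet B ∧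
      ∀ g : G, g ≠ 1 → ∀ x : X, ∃ h : G, ¬ (h • x ∈ B ↔ h • g • x ∈ B) := by
  classical
  let State := {p : Set X × Set X // MeasurableSet p.1 ∧ MeasurableSet p.2 ∧
    ∃ T : Finset G, ∀ x : X, ∃ t ∈ T, t • x ∈ p.1}
  have hstep : ∀ (g : G) (p : State), ∃ q : State, q.1.1 ⊆ p.1.1 ∧
      (∀ x, x ∉ p.1.1 → (x ∈ q.1.2 ↔ x ∈ p.1.2)) ∧ (g ≠ 1 → ∀ x : X, ∃ h : G,
        h • x ∉ q.1.1 ∧ h • g • x ∉ q.1.1 ∧ ¬ (h • x ∈ q.1.2 ↔ h • g • x ∈ q.1.2)) := by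
    rintro g ⟨⟨R, A⟩, hR, hA, hT⟩
    by_cases hg : g = 1
    · exact ⟨⟨(R, A), hR, hA, hT⟩, subset_rfl, fun _ _ => Iff.rfl, fun h => absurd hg h⟩
    · obtain ⟨M, B, hM, hB, hT', hMR, hBA, h⟩ := exists_stage hBorel hfree hR hA hT hg
      exact ⟨⟨(M, B), hM, hB, hT'⟩, hMR, hBA, fun _ => h⟩
  choose F hF1 hF2 hF3 using hstep
  obtain ⟨e, he⟩ := exists_surjective_nat G
  let seq : ℕ → State := fun n => Nat.rec
    ⟨(Set.univ, ∅), MeasurableSet.univ, MeasurableSet.empty, {1}, fun x => by simp⟩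
    (fun n p => F (e n) p) n
  have hanti : Antitone fun n => (seq n).1.1 := antitone_nat_of_succ_le fun n => hF1 _ _
  have hcoh : ∀ n m, n ≤ m → ∀ x, x ∉ (seq n).1.1 → (x ∈ (seq m).1.2 ↔ x ∈ (seq n).1.2) := by
    intro n m hnm x hx
    induction m, hnm using Nat.le_induction with
    | base => rfl
    | succ m hm ih => exact (hF2 (e m) (seq m) x fun h => hx (hanti hm h)).trans ih
  have hB : ∀ n x, x ∉ (seq n).1.1 →
      ((x ∈ ⋃ m, (seq m).1.2 \ (seq m).1.1) ↔ x ∈ (seq n).1.2) := by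
    intro n x hx
    simp only [Set.mem_iUnion, Set.mem_sdiff]
    refine ⟨fun ⟨m, hm, hm'⟩ => ?_, fun h => ⟨n, h, hx⟩⟩
    rcases le_total n m with h | h
    · exact (hcoh n m h x hx).1 hm
    · exact (hcoh m n h x hm').2 hm
  refine ⟨⋃ m, (seq m).1.2 \ (seq m).1.1,
    MeasurableSet.iUnion fun m => (seq m).2.2.1.diff (seq m).2.1, fun g hg x => ?_⟩
  obtain ⟨n, rfl⟩ := he g
  obtain ⟨h, h1, h2, h3⟩ := hF3 (e n) (seq n) hg x
  exact ⟨h, fun h' => h3 (((hB (n + 1) _ h1).symm.trans h').trans (hB (n + 1) _ h2))⟩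

end Stage

/-- Corollary 2.4: `χ_B(𝒢_X) ≤ χ_B(𝒢_{Free(2^G)})`.  Formally: for any standard Borel
space `K`, any Borel `K`-coloring of the graph `𝒢_{Free(2^G)}` induced by `S` yields a
Borel `K`-coloring of the graph `𝒢_X` induced by `S`, for every free Borel action
`G ↷ X`. -/
theorem borel_chromatic_number_le
    {G : Type*} [Group G] [Countable G] [Infinite G]
    {X : Type*} [MeasurableSpace X] [StandardBorelSpace X] [MulAction G X]
    (hBorel : ∀ g : G, Measurable fun x : X => g • x)
    (hfree : ∀ (g : G) (x : X), g • x = x → g = 1)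
    (S : Set G)
    {K : Type*} [MeasurableSpace K] [StandardBorelSpace K]
    (κ : {w : G → Bool // w ∈ FreePart G} → K) (hκ : Measurable κ)
    (hκcol : ∀ s : G, (s ∈ S ∨ s⁻¹ ∈ S) → s ≠ 1 →
      ∀ (w : {w : G → Bool // w ∈ FreePart G}) (hs : shift s (w : G → Bool) ∈ FreePart G),
        κ ⟨shift s (w : G → Bool), hs⟩ ≠ κ w) :
    ∃ κ' : X → K, Measurable κ' ∧
      ∀ s : G, (s ∈ S ∨ s⁻¹ ∈ S) → s ≠ 1 → ∀ x : X, κ' (s • x) ≠ κ' x := by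
  classical
  obtain ⟨B, hB, hdist⟩ := exists_measurableSet_distinguishing hBorel hfree
  let φ : X → G → Bool := fun x h => decide (h⁻¹ • x ∈ B)
  have hφ : Measurable φ := measurable_pi_iff.2 fun h => by
    refine measurable_to_bool ?_
    convert hBorel h⁻¹ hB using 1
    ext x
    simp [φ]
  have hequiv : ∀ g x, shift g (φ x) = φ (g • x) := fun g x => by
    funext h
    simp [shift, φ, mul_smul]
  have hmem : ∀ x, φ x ∈ FreePart G := fun x g hg heq => by
    obtain ⟨h, hh⟩ := hdist g hg x
    rw [hequiv] at heq
    have := congrFun heq h⁻¹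
    simp only [φ, inv_inv, decide_eq_decide] at this
    exact hh this.symm
  refine ⟨fun x => κ ⟨φ x, hmem x⟩, hκ.comp (hφ.subtype_mk), fun s hs hs1 x => ?_⟩
  have h := hκcol s hs hs1 ⟨φ x, hmem x⟩ (by rw [hequiv]; exact hmem _)
  simpa only [hequiv] using h
end
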